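/- Let f(x) = 8x⁵ − 7x⁴ + 6x³ − x² + 2x + 1. For every quadratic field k and all x, y ∈ k with y² = f(x), if x is not rational then at least one of the following holds in k: 4x² = −2, or (2x + 1)² = −3, or (2x − 1)² = −3, or (2x − 3)² = 13. -/

import Mathlib

open Polynomial NumberField

noncomputable section

abbrev gZ : ℤ[X] := X ^ 5 - 3 * X ^ 3 + X - 2
abbrev gQ : ℚ[X] := X ^ 5 - 3 * X ^ 3 + X - 2

lemma gZ_deg : gZ.natDegree = 5 := by unfold gZ; compute_degree!
lemma gQ_deg : gQ.natDegree = 5 := by unfold gQ; compute_degree!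
lemma gZ_monic : gZ.Monic := by unfold gZ; monicity!
lemma gQ_monic : gQ.Monic := by unfold gQ; monicity!
lemma gZ_map : gZ.map (Int.castRingHom ℚ) = gQ := by simp [gZ, gQ]

lemma gZ_irred : Irreducible gZ := by
  have h1 : gZ ≠ 1 := by
    intro h; have := congrArg natDegree h; rw [gZ_deg] at this; simp at this
  refine gZ_monic.irreducible_iff_natDegree'.mpr ⟨h1, ?_⟩
  intro p q hp hq hpq hmem
  rw [gZ_deg] at hmem
  simp only [Finset.mem_Ioc] at hmem
  have hdeg : p.natDegree + q.natDegree = 5 := by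
    rw [← hp.natDegree_mul hq, hpq, gZ_deg]
  have hq2 : q.natDegree = 1 ∨ q.natDegree = 2 := by omega
  have hc (n : ℕ) : (p * q).coeff n = gZ.coeff n := by rw [hpq]
  rcases hq2 with h | h
  · have hq' : q = X + C (q.coeff 0) := by
      have := hq.eq_X_add_C h
      exact this
    have : gZ.eval (-(q.coeff 0)) = 0 := by
      rw [← hpq, hq']; simp
    generalize q.coeff 0 = a at this
    simp [gZ] at this
    have h2 : a ∣ 2 := ⟨-a^4+3*a^2-1, by linarith⟩
    have h3 : a ≤ 2 := Int.le_of_dvd (by norm_num) h2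
    have h4 : -a ≤ 2 := Int.le_of_dvd (by norm_num) (neg_dvd.mpr h2)
    have h5 : -2 ≤ a := by linarith
    interval_cases a <;> norm_num at this
  · have hp3 : p.natDegree = 3 := by omega
    have eq : q = X^2 + C (q.coeff 1) * X + C (q.coeff 0) := by
      conv_lhs => rw [q.as_sum_range_C_mul_X_pow, h]
      have : q.coeff 2 = 1 := by rw [← h]; exact hq
      simp [Finset.sum_range_succ, this]; ring
    have ep : p = X^3 + C (p.coeff 2) * X^2 + C (p.coeff 1) * X + C (p.coeff 0) := by
      conv_lhs => rw [p.as_sum_range_C_mul_X_pow, hp3]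
      have : p.coeff 3 = 1 := by rw [← hp3]; exact hp
      simp [Finset.sum_range_succ, this]; ring
    generalize q.coeff 1 = u at *
    generalize q.coeff 0 = v at *
    generalize p.coeff 2 = a at *
    generalize p.coeff 1 = b at *
    generalize p.coeff 0 = c at *
    have key : X^5 + C (u+a) * X^4 + C (v+u*a+b) * X^3 + C (c+u*b+v*a)*X^2 + C (u*c+v*b)*X + C (v*c)
       = (X ^ 5 - 3 * X ^ 3 + X - 2 : ℤ[X]) := by
      change _ = gZ
      rw [← hpq, ep, eq]; simp only [C_add, C_mul]; ring
    have k (n : ℤ) := congrArg (eval n) key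
    have e1 := k 0; have e2 := k 1; have e3 := k (-1); have e4 := k 2; have e5 := k (-2)
    simp at e1 e2 e3 e4 e5
    have k0 : v * c = -2 := by linarith
    have k4 : u + a = 0 := by linarith
    have k3 : v + u * a + b = -3 := by linarith
    have k2 : c + u * b + v * a = 0 := by linarith
    have k1 : u * c + v * b = 1 := by linarith
    clear e1 e2 e3 e4 e5 k key ep eq
    have ha : a = -u := by linarith
    subst ha
    have hb : b = -3 - v + u^2 := by linear_combination k3
    subst hb
    have h2 : v ∣ 2 := ⟨-c, by linarith⟩
    have h3 : v ≤ 2 := Int.le_of_dvd (by norm_num) h2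
    have h4 : -v ≤ 2 := Int.le_of_dvd (by norm_num) (neg_dvd.mpr h2)
    have h5 : -2 ≤ v := by linarith
    have h6 : u ∣ 2 := ⟨v*(-3-v+u^2)-v*v, by linear_combination k0 - v*k2⟩
    have h7 : u ≤ 2 := Int.le_of_dvd (by norm_num) h6
    have h8 : -u ≤ 2 := Int.le_of_dvd (by norm_num) (neg_dvd.mpr h6)
    have h9 : -2 ≤ u := by linarith
    have hc0 : c = -(u*(-3-v+u^2)+v*(-u)) := by linear_combination k2
    subst hc0
    interval_cases v <;> interval_cases u <;> simp at k0 k1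

lemma gQ_irred : Irreducible gQ := by
  rw [← gZ_map]
  exact (IsPrimitive.Int.irreducible_iff_irreducible_map_cast gZ_monic.isPrimitive).mp gZ_irred

instance : Fact (Irreducible gQ) := ⟨gQ_irred⟩

abbrev LL : Type := AdjoinRoot gQ

def wL : LL := AdjoinRoot.root gQ

lemma wL_eq : wL^5 = 3*wL^3 - wL + 2 := by
  have := AdjoinRoot.eval₂_root gQ
  simp [gQ] at this
  unfold wL
  linear_combination this

def bL : Module.Basis (Fin 5) ℚ LL :=
  (AdjoinRoot.powerBasis' gQ_monic).basis.reindex (finCongr (by simp [gQ_deg]))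

lemma bL_apply (i : Fin 5) : bL i = wL ^ (i:ℕ) := by
  simp [bL, wL]

instance : NumberField LL where
  to_charZero := inferInstance
  to_finiteDimensional := Module.Finite.of_basis bL

lemma LL_finrank : Module.finrank ℚ LL = 5 := by
  rw [Module.finrank_eq_card_basis bL]; simp

/-- element of `LL` with given coordinates -/
def el (c : Fin 5 → ℚ) : LL := ∑ i, c i • bL i

lemma el_surj (x : LL) : ∃ c, x = el c := ⟨bL.repr x, by simp [el, bL.sum_repr]⟩

lemma el_eq (c : Fin 5 → ℚ) : el c =
  (c 0 : LL) + c 1 * wL + c 2 * wL^2 + c 3 * wL^3 + c 4 * wL^4 := by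
  simp [el, Fin.sum_univ_five, bL_apply, Algebra.smul_def]

lemma el_inj {c : Fin 5 → ℚ} (h : el c = 0) : c = 0 := by
  have := Fintype.linearIndependent_iff.mp bL.linearIndependent c h
  ext i; exact this i

def mL (c0 c1 c2 c3 c4 : ℚ) : Matrix (Fin 5) (Fin 5) ℚ :=
  !![c0, 2*c4, 2*c3, 2*c2+6*c4, 2*c1 + 6*c3;
     c1, c0 - c4, 2*c4 - c3, 2*c3 - c2 - 3*c4, 2*c2 - c1 - 3*c3 + 6*c4;
     c2, c1, c0 - c4, 2*c4 - c3, 2*c3 - c2 - 3*c4;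
     c3, c2 + 3*c4, c1 + 3*c3, c0 + 3*c2 + 8*c4, 3*c1 + 8*c3 + 2*c4;
     c4, c3, c2 + 3*c4, c1 + 3*c3, c0 + 3*c2 + 8*c4]

lemma norm_el (c0 c1 c2 c3 c4 : ℚ) :
    Algebra.norm ℚ ((c0:LL) + c1 * wL + c2 * wL^2 + c3 * wL^3 + c4 * wL^4) =
      (mL c0 c1 c2 c3 c4).det := by
  rw [Algebra.norm_eq_matrix_det bL]
  congr 1
  ext i j
  rw [Algebra.leftMulMatrix_eq_repr_mul]
  have key : ∀ j : Fin 5, ((c0:LL) + c1 * wL + c2 * wL^2 + c3 * wL^3 + c4 * wL^4) * bL j =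
     ∑ i, mL c0 c1 c2 c3 c4 i j • bL i := by
    intro j
    have h5 := wL_eq
    have h6 : wL^6 = 3*wL^4 - wL^2 + 2*wL := by linear_combination wL * h5
    have h7 : wL^7 = 8*wL^3 + 2*wL^2 - 3*wL + 6 := by linear_combination wL^2 * h5 + 3 * h5
    have h8 : wL^8 = 8*wL^4 + 2*wL^3 - 3*wL^2 + 6*wL := by linear_combination wL * h7
    fin_cases j <;> simp [mL, Fin.sum_univ_five, bL_apply, Algebra.smul_def]
    · linear_combination (c4:LL) * h5
    · linear_combination c3 * h5 + c4 * h6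
    · linear_combination c2 * h5 + c3 * h6 + c4 * h7
    · linear_combination c1 * h5 + c2 * h6 + c3 * h7 + c4 * h8
  rw [key j]
  rw [map_sum]
  simp [Finsupp.single_apply]


end

open Polynomial NumberField

noncomputable section

abbrev OO : Type := 𝓞 LL

lemma wL_int : IsIntegral ℤ wL := by
  refine ⟨gZ, gZ_monic, ?_⟩
  have := wL_eq
  simp [gZ]
  linear_combination this

def ω : OO := ⟨wL, wL_int⟩

lemma ω_coe : algebraMap OO LL ω = wL := rfl

lemma OO_inj {a b : OO} (h : algebraMap OO LL a = algebraMap OO LL b) : a = b :=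
  FaithfulSMul.algebraMap_injective OO LL h

lemma ω5 : ω^5 = 3*ω^3 - ω + 2 := by
  apply OO_inj
  simp only [map_pow, map_add, map_sub, map_mul, map_ofNat, ω_coe]
  exact wL_eq

def eO (c0 c1 c2 c3 c4 : ℤ) : OO := c0 + c1 * ω + c2 * ω^2 + c3 * ω^3 + c4 * ω^4

lemma normO (c0 c1 c2 c3 c4 : ℤ) :
    ((Algebra.norm ℤ (eO c0 c1 c2 c3 c4) : ℤ) : ℚ) = (mL c0 c1 c2 c3 c4).det := by
  have h1 := Algebra.coe_norm_int (eO c0 c1 c2 c3 c4)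
  have h2 := norm_el c0 c1 c2 c3 c4
  rw [h1, ← h2]
  congr 1

lemma normO' (c0 c1 c2 c3 c4 : ℤ) (N : ℤ) (h : (mL c0 c1 c2 c3 c4).det = N) :
    Algebra.norm ℤ (eO c0 c1 c2 c3 c4) = N := by
  have h2 := normO c0 c1 c2 c3 c4
  rw [h] at h2
  exact_mod_cast h2

def q : OO := 1 - ω + ω^2
def p3 : OO := ω - 1
def u1 : OO := 1 + ω
def u2 : OO := 1 - ω + ω^3
def yy : OO := 11 - 16 * ω - 22 * ω^2 + 11 * ω^3 + 11 * ω^4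

lemma N_ω : Algebra.norm ℤ ω = 2 := by
  have := normO' 0 1 0 0 0 2 (by
    simp [mL, Matrix.det_succ_row_zero, Fin.sum_univ_succ, Fin.succAbove]; try norm_num)
  simpa [eO] using this
lemma N_q : Algebra.norm ℤ q = 4 := by
  have := normO' 1 (-1) 1 0 0 4 (by
    simp [mL, Matrix.det_succ_row_zero, Fin.sum_univ_succ, Fin.succAbove]; try norm_num)
  rw [← this]; congr 1; simp [q, eO]; try ring
lemma N_p3 : Algebra.norm ℤ p3 = 3 := by
  have := normO' (-1) 1 0 0 0 3 (by
    simp [mL, Matrix.det_succ_row_zero, Fin.sum_univ_succ, Fin.succAbove]; try norm_num)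
  rw [← this]; congr 1; simp [p3, eO]; try ring
lemma N_u1 : Algebra.norm ℤ u1 = 1 := by
  have := normO' 1 1 0 0 0 1 (by
    simp [mL, Matrix.det_succ_row_zero, Fin.sum_univ_succ, Fin.succAbove]; try norm_num)
  rw [← this]; congr 1; simp [u1, eO]
lemma N_u2 : Algebra.norm ℤ u2 = 1 := by
  have := normO' 1 (-1) 0 1 0 1 (by
    simp [mL, Matrix.det_succ_row_zero, Fin.sum_univ_succ, Fin.succAbove]; try norm_num)
  rw [← this]; congr 1; simp [u2, eO]; try ring
lemma N_yy : Algebra.norm ℤ yy = 97 := by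
  have := normO' 11 (-16) (-22) 11 11 97 (by
    simp [mL, Matrix.det_succ_row_zero, Fin.sum_univ_succ, Fin.succAbove]; try norm_num)
  rw [← this]; congr 1; simp [yy, eO]; try ring
end

open Polynomial NumberField
noncomputable section
set_option linter.style.haveILetI false

lemma minpoly_wL : minpoly ℚ wL = gQ := by
  refine (minpoly.eq_of_irreducible_of_monic gQ_irred ?_ gQ_monic).symm
  have := wL_eq
  simp only [gQ, map_add, map_sub, map_mul, map_pow, aeval_X, map_ofNat]
  linear_combination this

lemma discr_bL : Algebra.discr ℚ bL = 18624 := by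
  let pb : PowerBasis ℚ LL := ⟨wL, 5, bL, bL_apply⟩
  have h := Algebra.discr_powerBasis_eq_norm ℚ pb
  change Algebra.discr ℚ bL = (-1) ^ (Module.finrank ℚ LL * (Module.finrank ℚ LL - 1) / 2) *
      (Algebra.norm ℚ) ((aeval wL) (derivative (minpoly ℚ wL))) at h
  rw [h, LL_finrank, minpoly_wL]
  have h2 : (aeval wL) (derivative gQ) = ((1:ℚ):LL) + (0:ℚ) * wL + ((-9:ℚ):LL) * wL^2 + ((0:ℚ):LL) * wL^3 + ((5:ℚ):LL) * wL^4 := by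
    have h3 : (aeval wL) (3 : ℚ[X]) = 3 := map_ofNat _ 3
    simp [gQ, h3]; ring
  rw [h2, norm_el]
  simp [mL, Matrix.det_succ_row_zero, Fin.sum_univ_succ, Fin.succAbove]; norm_num

lemma discr_le : |NumberField.discr LL| ≤ 18624 := by
  let b0 := RingOfIntegers.basis LL
  let e : Module.Free.ChooseBasisIndex ℤ (𝓞 LL) ≃ Fin 5 := Fintype.equivFinOfCardEq (by
    rw [← Module.finrank_eq_card_chooseBasisIndex, RingOfIntegers.rank, LL_finrank])
  let b := b0.reindex e
  have hb : Algebra.discr ℤ b = NumberField.discr LL := NumberField.discr_eq_discr LL b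
  let w : Fin 5 → OO := fun i => ω ^ (i:ℕ)
  have h1 : w = Matrix.vecMul b ((b.toMatrix w).map (algebraMap ℤ OO)) := by
    funext i
    have := b.sum_toMatrix_smul_self w i
    rw [← this]
    simp only [Matrix.vecMul, dotProduct, Matrix.map_apply, Algebra.smul_def]
    exact Finset.sum_congr rfl (fun _ _ => mul_comm _ _)
  have h2 : Algebra.discr ℤ w = (b.toMatrix w).det^2 * NumberField.discr LL := by
    conv_lhs => rw [h1]
    rw [Algebra.discr_of_matrix_vecMul, hb]
  have h3 : ((Algebra.discr ℤ w : ℤ) : ℚ) = Algebra.discr ℚ bL := by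
    rw [Algebra.discr_def, Algebra.discr_def]
    rw [Int.cast_det]
    congr 1
    ext i j
    simp only [Matrix.map_apply, Algebra.traceMatrix_apply, Algebra.traceForm_apply]
    rw [Algebra.coe_trace_int]
    congr 1
    rw [bL_apply, bL_apply]
    change algebraMap OO LL _ = _
    simp [w, ω_coe]
  rw [discr_bL] at h3
  have h4 : Algebra.discr ℤ w = 18624 := by exact_mod_cast h3
  rw [h4] at h2
  have h5 : (b.toMatrix w).det ≠ 0 := by
    intro h; rw [h] at h2; norm_num at h2
  generalize (b.toMatrix w).det = D at *
  have h6 : 1 ≤ D^2 := by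
    have := sq_nonneg D
    have h7 : D^2 ≠ 0 := pow_ne_zero 2 h5
    omega
  rw [abs_le]; constructor <;> nlinarith

lemma M_bound : (4 / Real.pi) ^ InfinitePlace.nrComplexPlaces LL *
   (((Module.finrank ℚ LL).factorial : ℝ) / (Module.finrank ℚ LL : ℝ) ^ Module.finrank ℚ LL *
                √|(NumberField.discr LL : ℝ)|) < 9 := by
  have hr : InfinitePlace.nrRealPlaces LL + 2 * InfinitePlace.nrComplexPlaces LL = 5 := by
    rw [InfinitePlace.card_add_two_mul_card_eq_rank, LL_finrank]
  have h2 : InfinitePlace.nrComplexPlaces LL ≤ 2 := by omega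
  have hpi := Real.pi_gt_d2
  have hd : √|(NumberField.discr LL : ℝ)| ≤ 137 := by
    rw [Real.sqrt_le_left (by norm_num)]
    have := discr_le
    have h3 : ((|NumberField.discr LL| : ℤ) : ℝ) ≤ 18624 := by exact_mod_cast this
    push_cast at h3
    linarith
  have h4 : (4 / Real.pi) ^ InfinitePlace.nrComplexPlaces LL ≤ (4/3.14)^2 := by
    calc (4 / Real.pi) ^ InfinitePlace.nrComplexPlaces LL ≤ (4 / 3.14) ^ InfinitePlace.nrComplexPlaces LL := by
          gcongr
      _ ≤ _ := by
          apply pow_le_pow_right₀ (by norm_num) h2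
  rw [LL_finrank]
  calc _ ≤ (4/3.14:ℝ)^2 * (((5:ℕ).factorial:ℝ)/ ((5:ℕ):ℝ)^5 * 137) := by gcongr
    _ < 9 := by norm_num [Nat.factorial]

lemma span_of_norm {P : Ideal OO} {x : OO} (hx : x ∈ P) (h0 : Ideal.absNorm P ≠ 0)
   (h : (Algebra.norm ℤ x).natAbs = Ideal.absNorm P) :
   Submodule.IsPrincipal P := by
  have h1 : Ideal.span {x} ≤ P := (Ideal.span_singleton_le_iff_mem P).mpr hx
  obtain ⟨J, hJ⟩ := Ideal.dvd_iff_le.mpr h1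
  have h2 := Ideal.absNorm_span_singleton x
  rw [hJ, map_mul, h] at h2
  have h3 : Ideal.absNorm J = 1 := by
    exact Nat.eq_of_mul_eq_mul_left (Nat.pos_of_ne_zero h0) (by linarith)
  rw [Ideal.absNorm_eq_one_iff] at h3
  rw [h3] at hJ
  rw [← Ideal.one_eq_top, mul_one] at hJ
  exact ⟨x, hJ.symm⟩

lemma rootmod (P : Ideal OO) : (Ideal.Quotient.mk P ω)^5 = 3*(Ideal.Quotient.mk P ω)^3 - (Ideal.Quotient.mk P ω) + 2 := by
  rw [← map_pow, ω5]; simp only [map_add, map_sub, map_mul, map_pow, map_ofNat]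

lemma cast_surj (P : Ideal OO) (p : ℕ) (hp : p.Prime) (h : Ideal.absNorm P = p) (x : OO ⧸ P) :
    ∃ n : ℕ, n < p ∧ x = n := by
  haveI : Fact p.Prime := ⟨hp⟩
  have hc : Nat.card (OO ⧸ P) = p := by rw [← h]; rfl
  haveI : Finite (OO ⧸ P) := Nat.finite_of_card_ne_zero (by rw [hc]; exact hp.ne_zero)
  letI := Fintype.ofFinite (OO ⧸ P)
  have hc2 : Fintype.card (OO ⧸ P) = p := by rw [← Nat.card_eq_fintype_card]; exact hc
  let e := ZMod.ringEquivOfPrime (OO ⧸ P) hp hc2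
  obtain ⟨y, rfl⟩ := e.surjective x
  refine ⟨y.val, ZMod.val_lt y, ?_⟩
  conv_lhs => rw [← ZMod.natCast_zmod_val y]
  rw [map_natCast]

lemma pow_card_quot (P : Ideal OO) [hP : P.IsPrime] (n : ℕ) (hn : n ≠ 0) (h : Ideal.absNorm P = n) (x : OO ⧸ P) :
    x ^ n = x := by
  have hc : Nat.card (OO ⧸ P) = n := by rw [← h]; rfl
  haveI : Finite (OO ⧸ P) := Nat.finite_of_card_ne_zero (by rw [hc]; exact hn)
  letI := Fintype.ofFinite (OO ⧸ P)
  have hc2 : Fintype.card (OO ⧸ P) = n := by rw [← Nat.card_eq_fintype_card]; exact hc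
  have hc3 : Fintype.card (OO ⧸ P) ≠ 0 := by rw [hc2]; exact hn
  by_cases hx : x = 0
  · rw [hx, zero_pow hn]
  haveI : IsField (OO ⧸ P) := Finite.isField_of_domain _
  letI := this.toField
  rw [← hc2]
  exact FiniteField.pow_card x

instance : IsPrincipalIdealRing OO := by
  apply RingOfIntegers.isPrincipalIdealRing_of_isPrincipal_of_norm_le_of_isPrime
  intro I hI hn
  have hlt := lt_of_le_of_lt hn M_bound
  have hlt : Ideal.absNorm (I : Ideal OO) < 9 := by exact_mod_cast hlt
  have h0 : Ideal.absNorm (I : Ideal OO) ≠ 0 := by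
    rw [Ne, Ideal.absNorm_eq_zero_iff]; exact nonZeroDivisors.coe_ne_zero I
  generalize (I : Ideal OO) = P at *
  clear hn I
  have hmem := Ideal.absNorm_mem P
  have hr := rootmod P
  have hz (x : OO) : Ideal.Quotient.mk P x = 0 ↔ x ∈ P := Ideal.Quotient.eq_zero_iff_mem
  have hN (n : ℕ) (h : (n : OO ⧸ P) = 0) : Ideal.absNorm P ∣ n ^ 5 := by
    have : (n : OO) ∈ P := by rw [← hz]; simpa using h
    have h2 := Ideal.absNorm_dvd_absNorm_of_le ((Ideal.span_singleton_le_iff_mem P).mpr this)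
    rw [Ideal.absNorm_span_natCast, RingOfIntegers.rank, LL_finrank] at h2
    exact h2
  have hω : ω ∈ P → Ideal.absNorm P ∣ 2 := by
    intro h
    have := Ideal.absNorm_dvd_norm_of_mem h
    rw [N_ω] at this; exact_mod_cast this
  obtain ⟨n, hn⟩ : ∃ n, Ideal.absNorm P = n := ⟨_, rfl⟩
  rw [hn] at hlt h0 hN hω hmem
  have hmem0 : (n : OO ⧸ P) = 0 := by
    rw [← hz] at hmem; simpa using hmem
  have hsurj (hp : n.Prime) := cast_surj P n hp hn (Ideal.Quotient.mk P ω)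
  have hpow (x : OO ⧸ P) := pow_card_quot P n h0 hn x
  interval_cases n
  · exact absurd rfl h0
  · exact absurd (Ideal.absNorm_eq_one_iff.mp hn) hI.ne_top
  · -- 2
    obtain ⟨m, hm, h⟩ := hsurj (by norm_num)
    interval_cases m
    · have : ω ∈ P := by rw [← hz, h]; simp
      exact span_of_norm this (by rw [hn]; norm_num) (by rw [hn, N_ω]; rfl)
    · exfalso
      rw [h] at hr
      have := hN 3 (by push_cast at hr ⊢; linear_combination -hr)
      norm_num at this
  · obtain ⟨m, hm, h⟩ := hsurj (by norm_num)
    interval_cases m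
    · exfalso
      rw [h] at hr
      have := hN 2 (by push_cast at hr ⊢; linear_combination -hr)
      norm_num at this
    · have : p3 ∈ P := by rw [← hz, p3, map_sub, h]; simp
      exact span_of_norm this (by rw [hn]; norm_num) (by rw [hn, N_p3]; rfl)
    · exfalso
      rw [h] at hr
      have := hN 8 (by push_cast at hr ⊢; linear_combination hr)
      norm_num at this
  · -- 4
    have h2 : (2 : OO ⧸ P) = 0 := by
      have : (2 : OO ⧸ P) * 2 = 0 := by push_cast at hmem0; linear_combination hmem0
      exact mul_self_eq_zero.mp this
    have hw := hpow (Ideal.Quotient.mk P ω)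
    have : (Ideal.Quotient.mk P ω) * (Ideal.Quotient.mk P q) = 0 := by
      rw [q]; simp only [map_add, map_sub, map_one, map_pow]
      generalize (Ideal.Quotient.mk P) ω = w at *
      linear_combination (-1) * hr + w * hw + (-w^3+w-1) * h2
    rcases mul_eq_zero.mp this with h | h
    · exfalso
      have := hω ((hz _).mp h); norm_num at this
    · exact span_of_norm ((hz _).mp h) (by rw [hn]; norm_num) (by rw [hn, N_q]; rfl)
  · exfalso
    obtain ⟨m, hm, h⟩ := hsurj (by norm_num)
    rw [h] at hr
    interval_cases m
    · have := hN 2 (by push_cast at hr ⊢; linear_combination -hr)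
      norm_num at this
    · have := hN 3 (by push_cast at hr ⊢; linear_combination -hr)
      norm_num at this
    · have := hN 8 (by push_cast at hr ⊢; linear_combination hr)
      norm_num at this
    · have := hN 163 (by push_cast at hr ⊢; linear_combination hr)
      norm_num at this
    · have := hN 834 (by push_cast at hr ⊢; linear_combination hr)
      norm_num at this
  · exfalso
    have h6 : (2 : OO ⧸ P) * 3 = 0 := by push_cast at hmem0; linear_combination hmem0
    rcases mul_eq_zero.mp h6 with h | h
    · have := hN 2 (by exact_mod_cast h); norm_num at this
    · have := hN 3 (by exact_mod_cast h); norm_num at this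
  · exfalso
    obtain ⟨m, hm, h⟩ := hsurj (by norm_num)
    rw [h] at hr
    interval_cases m
    · have := hN 2 (by push_cast at hr ⊢; linear_combination -hr)
      norm_num at this
    · have := hN 3 (by push_cast at hr ⊢; linear_combination -hr)
      norm_num at this
    · have := hN 8 (by push_cast at hr ⊢; linear_combination hr)
      norm_num at this
    · have := hN 163 (by push_cast at hr ⊢; linear_combination hr)
      norm_num at this
    · have := hN 834 (by push_cast at hr ⊢; linear_combination hr)
      norm_num at this
    · have := hN (5^5-3*5^3+5-2) (by push_cast at hr ⊢; linear_combination hr)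
      norm_num at this
    · have := hN (6^5-3*6^3+6-2) (by push_cast at hr ⊢; linear_combination hr)
      norm_num at this
  · exfalso
    have h2 : (2 : OO ⧸ P) = 0 := by
      have : (2 : OO ⧸ P) ^ 3 = 0 := by push_cast at hmem0; linear_combination hmem0
      exact pow_eq_zero_iff (by norm_num) |>.mp this
    have hw := hpow (Ideal.Quotient.mk P ω)
    generalize hg : (Ideal.Quotient.mk P) ω = w at *
    have : w * (w - 1) = 0 := by
      linear_combination (-w^3 - 3*w) * hr + hw + (-4*w^4 - w^3+2*w^2-3*w) * h2
    rcases mul_eq_zero.mp this with h | h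
    · have := hω ((hz _).mp (by rw [hg, h])); norm_num at this
    · have h1 : w = 1 := by linear_combination h
      rw [h1] at hr
      have := hN 3 (by push_cast at hr ⊢; linear_combination -hr)
      norm_num at this
end

open Polynomial NumberField
noncomputable section

lemma g_root_pos (x : ℝ) (h : x^5 - 3*x^3 + x - 2 = 0) : 0 < x ∧ 3 < x^2 := by
  have h0 : 0 < x := by
    by_contra hx
    push Not at hx
    obtain ⟨t, rfl⟩ : ∃ t, x = -t := ⟨-x, by ring⟩
    have ht : 0 ≤ t := by linarith
    have h1 : t * ((t^2-3/2)^2 - 5/4) + 2 = 0 := by linear_combination -h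
    rcases le_or_gt t (3/2) with h2 | h2
    · nlinarith [mul_nonneg ht (sq_nonneg (t^2-3/2))]
    · rcases le_or_gt t (33/20) with h3 | h3
      · have h5 : (0.75:ℝ) ≤ t^2-3/2 := by nlinarith
        have h4 : (0:ℝ) ≤ (t^2-3/2)^2 - 0.5 := by nlinarith
        nlinarith [mul_nonneg ht h4]
      · have : (0:ℝ) ≤ (t^2-3/2)^2 - 5/4 := by
          have : 1.22 ≤ t^2 - 3/2 := by nlinarith
          nlinarith
        nlinarith [mul_nonneg ht this]
  refine ⟨h0, ?_⟩
  by_contra h3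
  push Not at h3
  have : x < 2 := by nlinarith
  have h4 : 0 < x^3 := by positivity
  nlinarith [mul_nonneg h4.le (sub_nonneg.mpr h3)]

lemma g_root_unique (x y : ℝ) (hx : x^5 - 3*x^3 + x - 2 = 0) (hy : y^5 - 3*y^3 + y - 2 = 0) : x = y := by
  obtain ⟨x0, x3⟩ := g_root_pos x hx
  obtain ⟨y0, y3⟩ := g_root_pos y hy
  have hxy : 3 < x*y := by
    by_contra h
    push Not at h
    have : 0 < x * y := by positivity
    nlinarith
  have h : (x - y) * (x^4+x^3*y+x^2*y^2+x*y^3+y^4-3*(x^2+x*y+y^2)+1) = 0 := by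
    linear_combination hx - hy
  rcases mul_eq_zero.mp h with h | h
  · linarith
  · exfalso
    have : 0 < x * y := by positivity
    have h5 : 0 < x^2 := by positivity
    have h6 : 0 < y^2 := by positivity
    nlinarith [mul_pos h5 (sub_pos.mpr x3), mul_pos h6 (sub_pos.mpr y3), mul_pos this (sub_pos.mpr hxy), mul_pos this h5, mul_pos this h6]

lemma real_emb (φ ψ : LL →+* ℂ) (h1 : ComplexEmbedding.IsReal φ) (h2 : ComplexEmbedding.IsReal ψ) : φ = ψ := by
  have key (φ : LL →+* ℂ) (h1 : ComplexEmbedding.IsReal φ) : ∃ x : ℝ, φ wL = x ∧ x^5 - 3*x^3 + x - 2 = 0 := by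
    have e : (starRingEnd ℂ) (φ wL) = φ wL := by
      have := congrArg (fun f : LL →+* ℂ => f wL) h1
      simpa using this
    obtain ⟨x, hx⟩ := Complex.conj_eq_iff_real.mp e
    refine ⟨x, hx, ?_⟩
    have := congrArg φ wL_eq
    simp only [map_pow, map_add, map_sub, map_mul, map_ofNat, hx] at this
    have h3 : ((x^5 : ℝ):ℂ) = ((3*x^3 - x + 2 : ℝ) : ℂ) := by push_cast; exact this
    have := Complex.ofReal_injective h3
    linarith
  obtain ⟨x, hx, gx⟩ := key φ h1
  obtain ⟨y, hy, gy⟩ := key ψ h2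
  have hw : φ wL = ψ wL := by rw [hx, hy, g_root_unique x y gx gy]
  refine RingHom.ext fun z => ?_
  obtain ⟨c, rfl⟩ := el_surj z
  rw [el_eq]
  simp only [map_add, map_mul, map_pow, map_ratCast, hw]

lemma rank2 : Units.rank LL = 2 := by
  have hr : InfinitePlace.nrRealPlaces LL + 2 * InfinitePlace.nrComplexPlaces LL = 5 := by
    rw [InfinitePlace.card_add_two_mul_card_eq_rank, LL_finrank]
  have h1 : InfinitePlace.nrRealPlaces LL ≤ 1 := by
    classical
    rw [← InfinitePlace.card_real_embeddings LL]
    have : Subsingleton { φ : LL →+* ℂ // ComplexEmbedding.IsReal φ } :=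
      ⟨fun a b => Subtype.ext (real_emb _ _ a.2 b.2)⟩
    exact Fintype.card_le_one_iff_subsingleton.mpr this
  have h2 := InfinitePlace.card_eq_nrRealPlaces_add_nrComplexPlaces LL
  unfold Units.rank
  omega

lemma oddrank : Odd (Module.finrank ℚ LL) := by rw [LL_finrank]; decide

/-! constants -/
def vO : OO := 17 - 19 * ω^2 - ω^3 + 5*ω^4
def vI : OO := 1 - ω^2 + 3*ω^3 - ω^4
lemma v_mul : vO * vI = 1 := by
  unfold vO vI; linear_combination (-5*ω^3+16*ω^2-4*ω-8)*ω5
lemma two_eq : 2 = vO * ω * q^2 := by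
  unfold vO q; linear_combination ((-1)+(8)*ω+(-13)*ω^2+(11)*ω^3+(-5)*ω^4)*ω5
lemma u1_inv : u1 * (-1 + 2*ω - 2*ω^2 - ω^3 + ω^4) = 1 := by
  unfold u1; linear_combination ω5
lemma u2_inv : u2 * (-1 + 2*ω + ω^2 - ω^3) = 1 := by
  unfold u2; linear_combination (1-ω)*ω5

lemma isUnit_iff_N (x : OO) : IsUnit x ↔ (Algebra.norm ℤ x).natAbs = 1 := by
  rw [← Ideal.absNorm_span_singleton, Ideal.absNorm_eq_one_iff, Ideal.span_singleton_eq_top]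

lemma dvd_N {a b : OO} (h : a ∣ b) : Algebra.norm ℤ a ∣ Algebra.norm ℤ b := by
  obtain ⟨c, rfl⟩ := h; rw [map_mul]; exact dvd_mul_right _ _

lemma q2_dvd_two : q^2 ∣ (2:OO) := ⟨vO * ω, by rw [mul_comm]; exact two_eq⟩
lemma q_dvd_two : q ∣ (2:OO) := (dvd_pow_self q (by norm_num)).trans q2_dvd_two

lemma q_ne : q ≠ 0 := by intro h; have := N_q; rw [h] at this; simp at this
lemma q_not_unit : ¬ IsUnit q := by rw [isUnit_iff_N, N_q]; norm_num
lemma q_ndvd_one : ¬ q ∣ 1 := fun h => q_not_unit (isUnit_of_dvd_one h)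

lemma q_prime : Prime q := by
  rw [← irreducible_iff_prime]
  refine ⟨q_not_unit, ?_⟩
  intro a b hab
  rw [isUnit_iff_N, isUnit_iff_N]
  have h := N_q
  rw [hab, map_mul] at h
  have h4 : (Algebra.norm ℤ a).natAbs * (Algebra.norm ℤ b).natAbs = 4 := by
    rw [← Int.natAbs_mul, h]; rfl
  have hn2 : (Algebra.norm ℤ a).natAbs ≠ 2 := by
    intro h2
    have h3 : Ideal.absNorm (Ideal.span {a}) = 2 := by rw [Ideal.absNorm_span_singleton, h2]
    obtain ⟨n, hn, hm⟩ := cast_surj _ 2 Nat.prime_two h3 (Ideal.Quotient.mk _ ω)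
    have h2mem := Ideal.absNorm_mem (Ideal.span {a})
    rw [h3, Ideal.mem_span_singleton] at h2mem
    have ha1 : ¬ a ∣ 1 := by
      intro h; have := (isUnit_iff_N a).mp (isUnit_of_dvd_one h); omega
    have hω : a ∣ ω - (n:OO) := by
      rw [← Ideal.mem_span_singleton, ← Ideal.Quotient.eq_zero_iff_mem, map_sub, hm]; simp
    apply ha1
    have hq : a ∣ q := ⟨b, hab⟩
    push_cast at h2mem
    interval_cases n
    · have : (1:OO) = q + (ω - ((0:ℕ):OO)) * (1 - ω) := by unfold q; push_cast; ring
      rw [this]; exact dvd_add hq (dvd_mul_of_dvd_left hω _)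
    · have : (1:OO) = q - (ω - ((1:ℕ):OO)) * ω := by unfold q; push_cast; ring
      rw [this]; exact dvd_sub hq (dvd_mul_of_dvd_left hω _)
  have : (Algebra.norm ℤ a).natAbs ∣ 4 := ⟨_, h4.symm⟩
  have hle := Nat.le_of_dvd (by norm_num) this
  generalize (Algebra.norm ℤ a).natAbs = m at *
  interval_cases m <;> omega

lemma q_ndvd_ω : ¬ q ∣ ω := by
  intro h; have := dvd_N h; rw [N_q, N_ω] at this; norm_num at this
lemma q_ndvd_u1 : ¬ q ∣ u1 := by
  intro h; have := dvd_N h; rw [N_q, N_u1] at this; norm_num at this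

lemma q_pow4 (z : OO) : q ∣ z^4 - z := by
  have : (Ideal.span {q}).IsPrime := (Ideal.span_singleton_prime q_ne).mpr q_prime
  have h := pow_card_quot (Ideal.span {q}) 4 (by norm_num)
    (by rw [Ideal.absNorm_span_singleton, N_q]; rfl) (Ideal.Quotient.mk _ z)
  rw [← Ideal.mem_span_singleton, ← Ideal.Quotient.eq_zero_iff_mem, map_sub, map_pow, h, sub_self]

lemma q_res (z : OO) : q ∣ z ∨ q ∣ z - 1 ∨ q ∣ z - ω ∨ q ∣ z - ω^2 := by
  have h := q_pow4 z
  obtain ⟨r, hr⟩ := q_dvd_two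
  have e : z * (z-1) * ((z - ω) * (z - ω^2)) = (z^4 - z) + q * (z*(z-1) * (-z - r*ω*z - r + (ω+1))) := by
    have : (z - ω) * (z - ω^2) = z^2 + z + 1 + (- q * z - 2*ω*z - 2 + (ω+1)*q) := by
      unfold q; ring
    rw [this]
    linear_combination (-ω*z - 1) * (z * (z-1)) * hr
  have h2 : q ∣ z * (z-1) * ((z - ω) * (z - ω^2)) := by
    rw [e]; exact dvd_add h (dvd_mul_right _ _)
  rcases q_prime.dvd_or_dvd h2 with h | h
  · rcases q_prime.dvd_or_dvd h with h | h
    · exact Or.inl h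
    · exact Or.inr (Or.inl h)
  · rcases q_prime.dvd_or_dvd h with h | h
    · exact Or.inr (Or.inr (Or.inl h))
    · exact Or.inr (Or.inr (Or.inr h))

lemma q_lin (a b : ℤ) (h : q ∣ (a:OO) + b * ω) : 2 ∣ a ∧ 2 ∣ b := by
  have ev (x : OO) : q ∣ 2 * x := dvd_mul_of_dvd_left q_dvd_two x
  rcases Int.even_or_odd' a with ⟨c, rfl | rfl⟩ <;> rcases Int.even_or_odd' b with ⟨d, rfl | rfl⟩
  · exact ⟨⟨c, rfl⟩, ⟨d, rfl⟩⟩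
  · exfalso; apply q_ndvd_ω
    push_cast at h
    have := dvd_sub h (ev (c + d * ω))
    convert! this using 1; ring
  · exfalso; apply q_ndvd_one
    push_cast at h
    have := dvd_sub h (ev (c + d * ω))
    convert! this using 1; ring
  · exfalso; apply q_ndvd_u1
    push_cast at h
    have := dvd_sub h (ev (c + d * ω))
    convert! this using 1; unfold u1; ring

lemma q_quad (a b c d : ℤ) (h : q ∣ (a:OO) + b * ω + c * ω^2 + d * ω^3) :
    2 ∣ a - c - d ∧ 2 ∣ b + c := by
  apply q_lin
  have e : ((a - c - d : ℤ) : OO) + ((b+c:ℤ):OO) * ω = ((a:OO) + b * ω + c * ω^2 + d * ω^3) - q * (c + d * (ω+1)) := by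
    push_cast; unfold q; ring
  rw [e]; exact dvd_sub h (dvd_mul_right _ _)

lemma q2_lem (a b c d : ℤ) (h : q^2 ∣ (a:OO) + b * ω + c * ω^2 + d * ω^3) :
    2 ∣ a ∧ 2 ∣ b ∧ 2 ∣ c ∧ 2 ∣ d := by
  obtain ⟨⟨r, hr⟩, ⟨s, hs⟩⟩ := q_quad a b c d ((dvd_pow_self q (by norm_num)).trans h)
  have e : ((a:OO) + b * ω + c * ω^2 + d * ω^3) = 2 * (r + s * ω) + q * (((c+d:ℤ):OO) + d * ω) := by
    have hr' : ((a - c - d : ℤ):OO) = ((2 * r:ℤ):OO) := by rw [hr]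
    have hs' : ((b + c : ℤ):OO) = ((2 * s:ℤ):OO) := by rw [hs]
    push_cast at hr' hs' ⊢
    unfold q
    linear_combination hr' + hs' * ω
  have h2 : q^2 ∣ q * (((c+d:ℤ):OO) + d * ω) := by
    have := dvd_sub h (dvd_mul_of_dvd_left q2_dvd_two ((r:OO) + s * ω))
    rw [e] at this
    convert! this using 1; ring
  rw [pow_two] at h2
  have h3 := q_lin _ _ ((mul_dvd_mul_iff_left q_ne).mp h2)
  omega

/-- residues of squares mod `q^2` -/
lemma sq_res (z : OO) : q^2 ∣ z^2 ∨ q^2 ∣ z^2 - 1 ∨ q^2 ∣ z^2 - ω^2 ∨ q^2 ∣ z^2 - (1 + ω^2) := by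
  have key (s : OO) (h : q ∣ z - s) : q^2 ∣ z^2 - s^2 := by
    obtain ⟨t, ht⟩ := h
    have e : z = s + q * t := by linear_combination ht
    have : z^2 - s^2 = 2 * (s * q * t) + q^2 * t^2 := by rw [e]; ring
    rw [this]
    exact dvd_add (dvd_mul_of_dvd_left q2_dvd_two _) (dvd_mul_right _ _)
  rcases q_res z with h | h | h | h
  · left; exact pow_dvd_pow_of_dvd h 2
  · right; left; simpa using key 1 h
  · right; right; left; exact key ω h
  · right; right; right
    have e : z^2 - (1 + ω^2) = (z^2 - (ω^2)^2) + q^2 + 2 * (ω^3 - 2*ω^2+ω-1) := by unfold q; ring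
    rw [e]
    exact dvd_add (dvd_add (key _ h) dvd_rfl) (dvd_mul_of_dvd_left q2_dvd_two _)
end

open Polynomial NumberField
noncomputable section

/-- if ε·(odd) matches a square class mod `q^2` -/
lemma nonsq (a b c d : ℤ) (x z : OO) (hx : q^2 ∣ x - (a + b * ω + c * ω^2 + d * ω^3)) (hz : q^2 ∣ x - z^2)
   (h0 : ¬ (2 ∣ a ∧ 2 ∣ b ∧ 2 ∣ c ∧ 2 ∣ d)) (h1 : ¬ (2 ∣ a - 1 ∧ 2 ∣ b ∧ 2 ∣ c ∧ 2 ∣ d))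
   (h2 : ¬ (2 ∣ a ∧ 2 ∣ b ∧ 2 ∣ c - 1 ∧ 2 ∣ d)) (h3 : ¬ (2 ∣ a - 1 ∧ 2 ∣ b ∧ 2 ∣ c - 1 ∧ 2 ∣ d)) : False := by
  have hd := dvd_sub hz hx
  rcases sq_res z with h | h | h | h
  · apply h0; apply q2_lem
    have := dvd_add hd h
    convert! this using 1; ring
  · apply h1; apply q2_lem
    have := dvd_add hd h
    convert! this using 1; push_cast; ring
  · apply h2; apply q2_lem
    have := dvd_add hd h
    convert! this using 1; push_cast; ring
  · apply h3; apply q2_lem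
    have := dvd_add hd h
    convert! this using 1; push_cast; ring

lemma q2_two (x : OO) : q^2 ∣ 2 * x := dvd_mul_of_dvd_left q2_dvd_two x

lemma ω4_mod : q^2 ∣ ω^4 - (1 + ω^2) := by
  have e : ω^4 - (1 + ω^2) = q^2 + 2 * (ω^3 - 2*ω^2+ω-1) := by unfold q; ring
  rw [e]; exact dvd_add dvd_rfl (q2_two _)

lemma u1_mod : q^2 ∣ u1 - (((1:ℤ):OO) + (1:ℤ) * ω + (0:ℤ) * ω^2 + (0:ℤ) * ω^3) := by
  have : u1 - (((1:ℤ):OO) + (1:ℤ) * ω + (0:ℤ) * ω^2 + (0:ℤ) * ω^3) = 0 := by unfold u1; push_cast; ring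
  rw [this]; exact dvd_zero _
lemma u2_mod : q^2 ∣ u2 - (((1:ℤ):OO) + (-1:ℤ) * ω + (0:ℤ) * ω^2 + (1:ℤ) * ω^3) := by
  have : u2 - (((1:ℤ):OO) + (-1:ℤ) * ω + (0:ℤ) * ω^2 + (1:ℤ) * ω^3) = 0 := by unfold u2; push_cast; ring
  rw [this]; exact dvd_zero _
lemma u12_mod : q^2 ∣ u1 * u2 - (((0:ℤ):OO) + (0:ℤ) * ω + (0:ℤ) * ω^2 + (1:ℤ) * ω^3) := by
  have : u1 * u2 - (((0:ℤ):OO) + (0:ℤ) * ω + (0:ℤ) * ω^2 + (1:ℤ) * ω^3) = (ω^4 - (1 + ω^2)) + 2 := by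
    unfold u1 u2; push_cast; ring
  rw [this]; exact dvd_add ω4_mod q2_dvd_two
lemma w_mod : q^2 ∣ ω - (((0:ℤ):OO) + (1:ℤ) * ω + (0:ℤ) * ω^2 + (0:ℤ) * ω^3) := by
  have : ω - (((0:ℤ):OO) + (1:ℤ) * ω + (0:ℤ) * ω^2 + (0:ℤ) * ω^3) = 0 := by push_cast; ring
  rw [this]; exact dvd_zero _
lemma wu1_mod : q^2 ∣ ω * u1 - (((0:ℤ):OO) + (1:ℤ) * ω + (1:ℤ) * ω^2 + (0:ℤ) * ω^3) := by
  have : ω * u1 - (((0:ℤ):OO) + (1:ℤ) * ω + (1:ℤ) * ω^2 + (0:ℤ) * ω^3) = 0 := by unfold u1; push_cast; ring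
  rw [this]; exact dvd_zero _
lemma wu2_mod : q^2 ∣ ω * u2 - (((1:ℤ):OO) + (1:ℤ) * ω + (0:ℤ) * ω^2 + (0:ℤ) * ω^3) := by
  have : ω * u2 - (((1:ℤ):OO) + (1:ℤ) * ω + (0:ℤ) * ω^2 + (0:ℤ) * ω^3) = (ω^4 - (1 + ω^2)) := by
    unfold u2; push_cast; ring
  rw [this]; exact ω4_mod

def sgn (b : Bool) : OO := if b then -1 else 1
def pw (x : OO) (b : Bool) : OO := if b then x else 1

/-- residue lemma: `(-1)^a u1^b u2^c ω^d` is a square mod `q^2` only if `b=c=d`. -/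
lemma eps_res (a b c d : Bool) (z : OO) (h : q^2 ∣ sgn a * pw u1 b * pw u2 c * pw ω d - z^2) :
    b = d ∧ c = d := by
  have h' : q^2 ∣ pw u1 b * pw u2 c * pw ω d - z^2 := by
    cases a
    · simpa [sgn] using h
    · have := dvd_add h (q2_two (pw u1 b * pw u2 c * pw ω d))
      convert! this using 1; simp only [sgn, if_true]; ring
  clear h
  cases b <;> cases c <;> cases d <;> simp [pw] at h' ⊢
  · exact nonsq _ _ _ _ _ _ w_mod h' (by decide) (by decide) (by decide) (by decide)
  · exact nonsq _ _ _ _ _ _ u2_mod h' (by decide) (by decide) (by decide) (by decide)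
  · rw [mul_comm] at h'
    exact nonsq _ _ _ _ _ _ wu2_mod h' (by decide) (by decide) (by decide) (by decide)
  · exact nonsq _ _ _ _ _ _ u1_mod h' (by decide) (by decide) (by decide) (by decide)
  · rw [mul_comm] at h'
    exact nonsq _ _ _ _ _ _ wu1_mod h' (by decide) (by decide) (by decide) (by decide)
  · exact nonsq _ _ _ _ _ _ u12_mod h' (by decide) (by decide) (by decide) (by decide)

lemma N_neg1 : Algebra.norm ℤ (-1 : OO) = -1 := by
  have := normO' (-1) 0 0 0 0 (-1) (by
    simp [mL, Matrix.det_succ_row_zero, Fin.sum_univ_succ, Fin.succAbove])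
  simpa [eO] using this

def U1 : OOˣ := Units.mkOfMulEqOne _ _ u1_inv
def U2 : OOˣ := Units.mkOfMulEqOne _ _ u2_inv
lemma U1_val : (U1 : OO) = u1 := rfl
lemma U2_val : (U2 : OO) = u2 := rfl

def bz (b : Bool) : ℤ := if b then 1 else 0
def gU (s : Bool × Bool × Bool) : OOˣ := (-1) ^ bz s.1 * U1 ^ bz s.2.1 * U2 ^ bz s.2.2

lemma gU_inj (s t : Bool × Bool × Bool) (z : OOˣ) (h : gU s = gU t * z^2) : s = t := by
  have hv := congrArg (Units.val) h
  have hN : Algebra.norm ℤ (z:OO)^2 = 1 := by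
    have := (isUnit_iff_N _).mp z.isUnit
    rw [← Int.natAbs_sq, this]; rfl
  -- gU s * gU t = square up to
  have hsq : q^2 ∣ (gU s * gU t : OOˣ) - ((gU t * z : OOˣ) : OO)^2 := by
    have : (gU s * gU t : OOˣ) = (gU t * z)^2 := by rw [h]; rw [mul_pow]; rw [mul_right_comm, ← pow_two]
    rw [this]; simp
  have hNs : Algebra.norm ℤ (gU s : OO) = Algebra.norm ℤ (gU t : OO) := by
    rw [hv]; simp only [Units.val_mul, Units.val_pow_eq_pow_val, map_mul, map_pow, hN, mul_one]
  obtain ⟨a, b, c⟩ := s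
  obtain ⟨a', b', c'⟩ := t
  have ha : a = a' := by
    have hg (a b c : Bool) : Algebra.norm ℤ (gU (a,b,c) : OO) = if a then -1 else 1 := by
      cases a <;> cases b <;> cases c <;> simp [gU, bz, U1_val, U2_val, N_u1, N_u2, N_neg1]
      all_goals
        first
        | rw [N_neg1]
        | (rw [← neg_one_mul, map_mul, N_neg1]; simp [N_u1, N_u2])
    rw [hg, hg] at hNs
    cases a <;> cases a' <;> simp at hNs ⊢
  subst ha
  have : gU (a, b, c) * gU (a, b', c') = gU (false, xor b b', xor c c') * (U1 ^ bz (b && b') * U2 ^ bz (c && c'))^2 := by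
    cases a <;> cases b <;> cases c <;> cases b' <;> cases c' <;> simp [gU, bz, pow_two] <;>
      ( try (first | rfl | (apply Units.ext; push_cast; ring)))
  have h3 : ∃ w : OO, q^2 ∣ sgn false * pw u1 (xor b b') * pw u2 (xor c c') * pw ω false - w^2 := by
    refine ⟨((gU (a,b',c') * z * (U1 ^ bz (b && b') * U2 ^ bz (c && c'))⁻¹ : OOˣ) : OO), ?_⟩
    have e : (gU (false, xor b b', xor c c') : OO) = sgn false * pw u1 (xor b b') * pw u2 (xor c c') * pw ω false := by
      cases (xor b b') <;> cases (xor c c') <;> simp [gU, sgn, pw, bz, U1_val, U2_val]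
    rw [← e]
    have e2 : gU (false, xor b b', xor c c') = (gU (a,b',c') * z * (U1 ^ bz (b && b') * U2 ^ bz (c && c'))⁻¹)^2 := by
      rw [mul_pow, inv_pow, ← div_eq_mul_inv, eq_div_iff_mul_eq', ← this, h]
      rw [mul_pow]; rw [mul_right_comm, ← pow_two]
    rw [e2]; simp
  obtain ⟨w, hw⟩ := h3
  obtain ⟨h4, h5⟩ := eps_res _ _ _ _ _ hw
  cases b <;> cases b' <;> cases c <;> cases c' <;> simp at h4 h5 ⊢


lemma unit_class : ∃ F0 F1 : OOˣ, ∀ x : OOˣ, ∃ (t : Bool × Bool × Bool) (z : OOˣ),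
    x = (-1) ^ bz t.1 * F0 ^ bz t.2.1 * F1 ^ bz t.2.2 * z^2 := by
  refine ⟨Units.fundSystem LL (Fin.cast rank2.symm 0), Units.fundSystem LL (Fin.cast rank2.symm 1), fun x => ?_⟩
  obtain ⟨⟨ζ, e⟩, he, -⟩ := Units.exist_unique_eq_mul_prod LL x
  simp only at he
  have hprod : ∏ i, (Units.fundSystem LL i) ^ (e i) = (Units.fundSystem LL (Fin.cast rank2.symm 0)) ^ (e (Fin.cast rank2.symm 0))
     * (Units.fundSystem LL (Fin.cast rank2.symm 1)) ^ (e (Fin.cast rank2.symm 1)) := by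
    have := Equiv.prod_comp (finCongr rank2.symm) (fun i => (Units.fundSystem LL i) ^ (e i))
    rw [← this, Fin.prod_univ_two]; rfl
  rw [hprod] at he
  generalize Units.fundSystem LL (Fin.cast rank2.symm 0) = f0 at *
  generalize Units.fundSystem LL (Fin.cast rank2.symm 1) = f1 at *
  generalize e (Fin.cast rank2.symm 0) = e0 at *
  generalize e (Fin.cast rank2.symm 1) = e1 at *
  have key (f : OOˣ) (n : ℤ) : ∃ (b : Bool) (z : OOˣ), f ^ n = f ^ bz b * z^2 := by
    rcases Int.even_or_odd' n with ⟨m, rfl | rfl⟩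
    · exact ⟨false, f^m, by simp [bz, zpow_mul, zpow_two, pow_two, mul_zpow]⟩
    · exact ⟨true, f^m, by rw [zpow_add, mul_comm]; simp [bz, zpow_mul, zpow_two, pow_two, mul_zpow]⟩
  obtain ⟨b0, z0, h0⟩ := key f0 e0
  obtain ⟨b1, z1, h1⟩ := key f1 e1
  have hζ := Units.torsion_eq_one_or_neg_one_of_odd_finrank oddrank ζ
  rw [h0, h1] at he
  rcases hζ with h | h
  · refine ⟨(false, b0, b1), z0 * z1, ?_⟩
    rw [he, h, mul_pow]; simp only [bz, Bool.false_eq_true, if_false, zpow_zero, one_mul]; rw [mul_mul_mul_comm]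
  · refine ⟨(true, b0, b1), z0 * z1, ?_⟩
    rw [he, h, mul_pow]; simp only [bz, if_true, zpow_one]; rw [mul_mul_mul_comm, mul_assoc, mul_assoc, mul_assoc]

lemma unit_gen (x : OO) (hx : IsUnit x) : ∃ (a b c : Bool) (z : OO), IsUnit z ∧
    x = sgn a * pw u1 b * pw u2 c * z^2 := by
  obtain ⟨F0, F1, hF⟩ := unit_class
  choose t z hz using hF
  have hinj : Function.Injective (fun s => t (gU s)) := by
    intro s s' h
    simp only at h
    apply gU_inj s s' (z (gU s) * (z (gU s'))⁻¹)
    have h1 := hz (gU s)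
    have h2 := hz (gU s')
    rw [← h] at h2
    rw [mul_pow, inv_pow]
    generalize (-1 : OOˣ) ^ bz (t (gU s)).1 * F0 ^ bz (t (gU s)).2.1 * F1 ^ bz (t (gU s)).2.2 = K at *
    rw [← mul_assoc, eq_mul_inv_iff_mul_eq]
    conv_lhs => rw [h1]
    conv_rhs => rw [h2]
    rw [mul_right_comm]
  have hsurj := Finite.injective_iff_surjective.mp hinj
  obtain ⟨x, rfl⟩ := hx
  obtain ⟨s, hs⟩ := hsurj (t x)
  simp only at hs
  have h1 := hz x
  have h2 := hz (gU s)
  rw [hs] at h2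
  generalize (-1 : OOˣ) ^ bz (t x).1 * F0 ^ bz (t x).2.1 * F1 ^ bz (t x).2.2 = K at *
  have h3 : x = gU s * (z x * (z (gU s))⁻¹)^2 := by
    rw [mul_pow, inv_pow, ← mul_assoc, eq_mul_inv_iff_mul_eq]
    conv_lhs => rw [h1]
    conv_rhs => rw [h2]
    rw [mul_right_comm]
  refine ⟨s.1, s.2.1, s.2.2, ((z x * (z (gU s))⁻¹ : OOˣ) : OO), Units.isUnit _, ?_⟩
  have e : (gU s : OO) = sgn s.1 * pw u1 s.2.1 * pw u2 s.2.2 := by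
    obtain ⟨a, b, c⟩ := s
    cases a <;> cases b <;> cases c <;> simp [gU, sgn, pw, bz, U1_val, U2_val]
  rw [← e]
  conv_lhs => rw [h3]
  simp only [Units.val_mul, Units.val_pow_eq_pow_val]
end

open Polynomial NumberField
noncomputable section

/-! generic lemmas -/
section Gen
variable {R : Type*} [CommRing R]

def mE3 (f5 f6 k1 k2 : R) : R := k1*f5 + k2*f6
def mE2 (f4 f5 f6 k1 k2 k3 : R) : R := k1^2*f4 + k2*mE3 f5 f6 k1 k2 - k1*k3*f6
def mE1 (f3 f4 f5 f6 k1 k2 k3 : R) : R :=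
  k1^3*f3 + k2*mE2 f4 f5 f6 k1 k2 k3 - k1*k3*mE3 f5 f6 k1 k2
def mE0 (f2 f3 f4 f5 f6 k1 k2 k3 D b1 : R) : R :=
  D^2*(k1^4*f2 + k2*mE1 f3 f4 f5 f6 k1 k2 k3 - k1*k3*mE2 f4 f5 f6 k1 k2 k3) - k1^4*b1^2

def Mum (f0 f1 f2 f3 f4 f5 f6 k1 k2 k3 D b1 b0 : R) : Prop :=
  k1^5*(f1*D^2 - 2*b1*b0) = -k2*mE0 f2 f3 f4 f5 f6 k1 k2 k3 D b1 + k1*k3*D^2*mE1 f3 f4 f5 f6 k1 k2 k3 ∧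
  k1^5*(f0*D^2 - b0^2) = k3*mE0 f2 f3 f4 f5 f6 k1 k2 k3 D b1

lemma parity [IsDomain R] [WfDvdMonoid R] (p t c E u Y : R) (hp : Prime p) (ht : ¬ p ∣ t) (hu : ¬ p ∣ u)
    (hc : c ≠ 0) (h : p*t*c^2*E = u*Y^2) : p ∣ E := by
  by_contra hE
  have hE0 : E ≠ 0 := fun h => hE (h ▸ dvd_zero _)
  have ht0 : t ≠ 0 := fun h => ht (h ▸ dvd_zero _)
  have hu0 : u ≠ 0 := fun h => hu (h ▸ dvd_zero _)
  have hY : Y ≠ 0 := by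
    rintro rfl
    have : p*t*c^2*E ≠ 0 := mul_ne_zero (mul_ne_zero (mul_ne_zero hp.ne_zero ht0) (pow_ne_zero 2 hc)) hE0
    exact this (by rw [h]; ring)
  have fin (x : R) (hx : x ≠ 0) : FiniteMultiplicity p x := FiniteMultiplicity.of_prime_left hp hx
  have h1 : emultiplicity p (p*t*c^2*E) = emultiplicity p (u*Y^2) := by rw [h]
  rw [emultiplicity_mul hp, emultiplicity_mul hp, emultiplicity_mul hp, emultiplicity_mul hp,
    emultiplicity_pow hp, emultiplicity_pow hp, emultiplicity_eq_zero.2 ht, emultiplicity_eq_zero.2 hu,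
    emultiplicity_eq_zero.2 hE, (fin c hc).emultiplicity_eq_multiplicity,
    (fin Y hY).emultiplicity_eq_multiplicity, (fin p hp.ne_zero).emultiplicity_eq_multiplicity,
    multiplicity_self] at h1
  norm_cast at h1
  omega

lemma lemR [IsDomain R] [WfDvdMonoid R] (f0 f1 f2 f3 f4 f5 f6 k1 k2 k3 D b1 b0 r w p t c z : R)
    (hM : Mum f0 f1 f2 f3 f4 f5 f6 k1 k2 k3 D b1 b0)
    (hcop : ∃ a b c, a*D + b*b1 + c*b0 = 1)
    (hF : f6*r^6+f5*r^5*w+f4*r^4*w^2+f3*r^3*w^3+f2*r^2*w^4+f1*r*w^5+f0*w^6 = 0)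
    (hp : Prime p) (hk1 : ¬ p ∣ k1) (hw : ¬ p ∣ w) (ht : ¬ p ∣ t) (hc : c ≠ 0)
    (hA : (k1*r^2-k2*r*w+k3*w^2)*z^2 = p*t*c^2) (hpA : p ∣ k1*r^2-k2*r*w+k3*w^2) :
    p ∣ 6*f6*r^5+5*f5*r^4*w+4*f4*r^3*w^2+3*f3*r^2*w^3+2*f2*r*w^4+f1*w^5 := by
  obtain ⟨h1, h0⟩ := hM
  set E0 := mE0 f2 f3 f4 f5 f6 k1 k2 k3 D b1 with hE0
  set E1 := mE1 f3 f4 f5 f6 k1 k2 k3 with hE1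
  set E2 := mE2 f4 f5 f6 k1 k2 k3 with hE2
  set E3 := mE3 f5 f6 k1 k2 with hE3
  rw [mE0, ← hE1, ← hE2] at hE0
  rw [mE1, ← hE2, ← hE3] at hE1
  rw [mE2, ← hE3] at hE2
  rw [mE3] at hE3
  set A := k1*r^2-k2*r*w+k3*w^2 with hAd
  set B := b1*r+b0*w with hB
  set E := D^2*(f6*k1^4*r^4+k1^3*E3*r^3*w+k1^2*E2*r^2*w^2+k1*E1*r*w^3)+E0*w^4 with hE
  have hAE : A*E = -k1^5*(B*w^2)^2 := by
    rw [hE, hB, hAd]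
    linear_combination (D^2*k1^5)*hF - w^6*h0 - r*w^5*h1 + (k1*r^2*w^4)*hE0
      + (k1^2*D^2*r^3*w^3)*hE1 + (k1^3*D^2*r^4*w^2)*hE2 + (k1^4*D^2*r^5*w)*hE3
  have hu : ¬ p ∣ -k1^5 := by
    rw [dvd_neg]; exact fun h => hk1 (hp.dvd_of_dvd_pow h)
  have hpE : p ∣ E := by
    apply parity p t c E (-k1^5) (B*w^2*z) hp ht hu hc
    rw [← hA]; linear_combination z^2*hAE
  have hpB : p ∣ B := by
    have : p ∣ -k1^5*(B*w^2)^2 := hAE ▸ (dvd_mul_of_dvd_left hpA _)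
    have := hp.dvd_of_dvd_pow ((hp.dvd_or_dvd this).resolve_left hu)
    exact (hp.dvd_or_dvd this).resolve_right (fun h => hw (hp.dvd_of_dvd_pow h))
  have hD : ¬ p ∣ D := by
    intro hD
    have hD2 : p ∣ D^2 := dvd_pow hD two_ne_zero
    have hb1 : p ∣ b1 := by
      have : p ∣ (k1^2*b1*w^2)^2 := by
        have e : (k1^2*b1*w^2)^2 = D^2*((f6*k1^4*r^4+k1^3*E3*r^3*w+k1^2*E2*r^2*w^2+k1*E1*r*w^3) +
          (k1^4*f2+k2*E1-k1*k3*E2)*w^4) - E := by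
          rw [hE, hE0]; ring
        rw [e]; exact dvd_sub (dvd_mul_of_dvd_left hD2 _) hpE
      have := hp.dvd_of_dvd_pow this
      rcases hp.dvd_or_dvd this with h | h
      · exact (hp.dvd_or_dvd h).resolve_left (fun h => hk1 (hp.dvd_of_dvd_pow h))
      · exact absurd (hp.dvd_of_dvd_pow h) hw
    have hb0 : p ∣ b0 := by
      have : p ∣ -k1^5*b0^2 := by
        have e : -k1^5*b0^2 = D^2*(k3*(k1^4*f2+k2*E1-k1*k3*E2) - k1^5*f0) - b1*(k1^4*b1*k3) := by
          linear_combination h0 + k3 * hE0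
        rw [e]; exact dvd_sub (dvd_mul_of_dvd_left hD2 _) (dvd_mul_of_dvd_left hb1 _)
      exact hp.dvd_of_dvd_pow ((hp.dvd_or_dvd this).resolve_left hu)
    obtain ⟨x, y, z, h⟩ := hcop
    apply hp.not_dvd_one
    rw [← h]
    exact dvd_add (dvd_add (dvd_mul_of_dvd_right hD _) (dvd_mul_of_dvd_right hb1 _)) (dvd_mul_of_dvd_right hb0 _)
  have hfin : p ∣ -k1^5*(D^2*(6*f6*r^5+5*f5*r^4*w+4*f4*r^3*w^2+3*f3*r^2*w^3+2*f2*r*w^4+f1*w^5)) := by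
    have e : -k1^5*(D^2*(6*f6*r^5+5*f5*r^4*w+4*f4*r^3*w^2+3*f3*r^2*w^3+2*f2*r*w^4+f1*w^5))
       = B*(-2*k1^5*b1*w^4) - E*(2*k1*r-k2*w)
         - A*(D^2*(4*f6*k1^4*r^3+3*k1^3*E3*r^2*w+2*k1^2*E2*r*w^2+k1*E1*w^3)) := by
      rw [hE, hB, hAd]
      linear_combination -w^5*h1 + (2*k1*r*w^4)*hE0
       + (3*k1^2*D^2*r^2*w^3)*hE1 + (4*k1^3*D^2*r^3*w^2)*hE2 + (5*k1^4*D^2*r^4*w)*hE3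
    rw [e]
    exact dvd_sub (dvd_sub (dvd_mul_of_dvd_left hpB _) (dvd_mul_of_dvd_left hpE _)) (dvd_mul_of_dvd_left hpA _)
  have := (hp.dvd_or_dvd hfin).resolve_left hu
  exact (hp.dvd_or_dvd this).resolve_left (fun h => hD (hp.dvd_of_dvd_pow h))

lemma sqfree_dec [IsDomain R] [UniqueFactorizationMonoid R] (a : R) (ha : a ≠ 0) :
    ∃ s c : R, Squarefree s ∧ a = s*c^2 := by
  induction a using UniqueFactorizationMonoid.induction_on_prime with
  | h₁ => exact absurd rfl ha
  | h₂ x hx => exact ⟨x, 1, hx.squarefree, by ring⟩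
  | h₃ a p ha0 hp ih =>
    obtain ⟨s, c, hs, h⟩ := ih ha0
    by_cases hps : p ∣ s
    · obtain ⟨t, rfl⟩ := hps
      exact ⟨t, p*c, hs.squarefree_of_dvd (dvd_mul_left _ _), by rw [h]; ring⟩
    · refine ⟨p*s, c, ?_, by rw [h]; ring⟩
      rw [squarefree_mul_iff]
      refine ⟨?_, hp.irreducible.squarefree, hs⟩
      exact (hp.irreducible.isRelPrime_iff_not_dvd).2 hps

end Gen

lemma sq_split (s p : OO) (hs : Squarefree s) (hp : Prime p) :
    ∃ (d : Bool) (s' : OO), s = pw p d * s' ∧ Squarefree s' ∧ ¬ p ∣ s' := by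
  by_cases h : p ∣ s
  · obtain ⟨t, rfl⟩ := h
    refine ⟨true, t, by simp [pw], hs.squarefree_of_dvd (dvd_mul_left _ _), ?_⟩
    rintro ⟨u, rfl⟩
    exact hp.not_isUnit (hs p ⟨u, by ring⟩)
  · exact ⟨false, s, by simp [pw], hs, h⟩

lemma prime_of_N (x : OO) (h : (Algebra.norm ℤ x).natAbs.Prime) : Prime x := by
  apply Irreducible.prime
  refine ⟨fun hu => ?_, fun a b hab => ?_⟩
  · rw [isUnit_iff_N] at hu; rw [hu] at h; exact Nat.not_prime_one h
  · rw [isUnit_iff_N, isUnit_iff_N]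
    rw [hab, map_mul, Int.natAbs_mul] at h
    rcases Nat.prime_mul_iff.1 h with ⟨_, h⟩ | ⟨_, h⟩
    · exact Or.inr h
    · exact Or.inl h

lemma ω_prime : Prime ω := prime_of_N _ (by rw [N_ω]; norm_num)
lemma p3_prime : Prime p3 := prime_of_N _ (by rw [N_p3]; norm_num)
lemma yy_prime : Prime yy := prime_of_N _ (by rw [N_yy]; norm_num)

def φ : OO := 2*ω^2 - ω^4

lemma φ5 : φ^5+2*φ^4-φ^3+6*φ^2-7*φ+8=0 := by
  unfold φ
  linear_combination ((-4)+(-2)*ω+(6)*ω^2+(9)*ω^3+(-8)*ω^4+(-15)*ω^5+(-6)*ω^6+(12)*ω^7+(8)*ω^8+(9)*ω^9+(-2)*ω^10+(-16)*ω^11+(7)*ω^13+(-1)*ω^15)*ω5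

lemma φ_dvd : φ ∣ 2^3 := by
  refine ⟨-φ^4-2*φ^3+φ^2-6*φ+7, ?_⟩
  linear_combination φ5

lemma two_cases (p : OO) (hp : Prime p) (h : p ∣ 2) : p ∣ ω ∨ p ∣ q := by
  rw [two_eq] at h
  rcases hp.dvd_or_dvd h with h | h
  · rcases hp.dvd_or_dvd h with h | h
    · exact absurd (isUnit_of_dvd_unit h (IsUnit.of_mul_eq_one _ v_mul)) hp.not_isUnit
    · exact Or.inl h
  · exact Or.inr (hp.dvd_of_dvd_pow h)

lemma φ_odd (p : OO) (hp : Prime p) (h2 : ¬ p ∣ 2) : ¬ p ∣ φ := fun h =>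
  h2 (hp.dvd_of_dvd_pow (h.trans φ_dvd))

lemma Δ_eq : 40-28*φ+18*φ^2-2*φ^3+2*φ^4 = 2^3*(p3^3*q*yy) := by
  unfold φ p3 q yy
  linear_combination ((-64)+(208)*ω+(-344)*ω^2+(284)*ω^3+(-96)*ω^4+(-12)*ω^5+(4)*ω^6+(18)*ω^7+(-10)*ω^9+(2)*ω^11)*ω5

lemma Δ_odd (p : OO) (hp : Prime p) (h2 : ¬ p ∣ 2) (h : p ∣ 40-28*φ+18*φ^2-2*φ^3+2*φ^4) :
    p ∣ p3 ∨ p ∣ yy := by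
  rw [Δ_eq] at h
  rcases hp.dvd_or_dvd h with h | h
  · exact absurd (hp.dvd_of_dvd_pow h) h2
  · rcases hp.dvd_or_dvd h with h | h
    · rcases hp.dvd_or_dvd h with h | h
      · exact Or.inl (hp.dvd_of_dvd_pow h)
      · exact absurd (h.trans q_dvd_two) h2
    · exact Or.inr h

lemma assoc_dvd {p r s : OO} (hp : Prime p) (hr : Prime r) (h : p ∣ r) (hs : p ∣ s) : r ∣ s :=
  ((hp.associated_of_dvd hr h).dvd_iff_dvd_left).1 hs

/-- reversal of Mumford data -/
lemma Mum_rev (f1 f2 f3 f4 f5 f6 f0 s p b1 b0 : ℚ) (hp : p ≠ 0)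
    (h : Mum f0 f1 f2 f3 f4 f5 f6 1 s p 1 b1 b0) :
    Mum f6 f5 f4 f3 f2 f1 f0 1 (s/p) (1/p) 1 (b1*(s/p)+b0*((s/p)^2-1/p)) (-b1*(1/p)-b0*(s/p)*(1/p)) := by
  obtain ⟨h1, h0⟩ := h
  simp only [mE0, mE1, mE2, mE3] at h1 h0
  simp only [Mum, mE0, mE1, mE2, mE3]
  obtain ⟨r, rfl⟩ : ∃ r, p = r⁻¹ := ⟨p⁻¹, by simp⟩
  have hr : r ≠ 0 := by simpa using hp
  obtain ⟨t, rfl⟩ : ∃ t, s = t * r⁻¹ := ⟨s*r, by field_simp⟩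
  have e1 : t * r⁻¹ / r⁻¹ = t := by field_simp
  have e2 : 1 / r⁻¹ = r := by field_simp
  rw [e1, e2]
  field_simp at h1 h0
  constructor
  · apply mul_left_cancel₀ (pow_ne_zero 5 hr)
    linear_combination (t^4-3*t^2*r+r^2)*h1 + (t*(t^4-3*t^2*r+r^2)-r*(t^3-2*t*r))*h0
  · apply mul_left_cancel₀ (pow_ne_zero 5 hr)
    linear_combination (-r*(t^3-2*t*r))*h1 + (-r*(t^4-3*t^2*r+r^2))*h0

lemma Mum_scale (f0 f1 f2 f3 f4 f5 f6 k1 k2 k3 D b1 b0 : ℚ) (hk : k1 ≠ 0) (hD : D ≠ 0)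
    (h : Mum f0 f1 f2 f3 f4 f5 f6 1 (k2/k1) (k3/k1) 1 (b1/D) (b0/D)) :
    Mum f0 f1 f2 f3 f4 f5 f6 k1 k2 k3 D b1 b0 := by
  obtain ⟨h1, h0⟩ := h
  simp only [mE0, mE1, mE2, mE3] at h1 h0
  simp only [Mum, mE0, mE1, mE2, mE3]
  constructor
  · field_simp at h1
    linear_combination h1
  · field_simp at h0
    linear_combination h0
end

open Polynomial NumberField
noncomputable section

lemma clear3 (σ π : ℚ) : ∃ k1 k2 k3 : ℤ, k1 ≠ 0 ∧ (∃ a b c, a*k1+b*k2+c*k3=1) ∧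
    σ = (k2:ℚ)/k1 ∧ π = (k3:ℚ)/k1 := by
  set m : ℤ := σ.den * π.den with hm
  set n2 : ℤ := σ.num * π.den with hn2
  set n3 : ℤ := π.num * σ.den with hn3
  have hm0 : m ≠ 0 := by simp [hm]
  set g : ℤ := gcd m (gcd n2 n3) with hg
  have hg0 : g ≠ 0 := by
    intro h
    rw [hg, gcd_eq_zero_iff] at h
    exact hm0 h.1
  obtain ⟨k1, h1⟩ : g ∣ m := gcd_dvd_left _ _
  obtain ⟨k2, h2⟩ : g ∣ n2 := (gcd_dvd_right _ _).trans (gcd_dvd_left _ _)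
  obtain ⟨k3, h3⟩ : g ∣ n3 := (gcd_dvd_right _ _).trans (gcd_dvd_right _ _)
  have hk1 : k1 ≠ 0 := by rintro rfl; simp at h1; exact hm0 h1
  refine ⟨k1, k2, k3, hk1, ?_, ?_, ?_⟩
  · obtain ⟨x, y, h⟩ : ∃ x y : ℤ, g = m*x + (gcd n2 n3)*y := exists_gcd_eq_mul_add_mul _ _
    obtain ⟨u, w, h'⟩ : ∃ u w : ℤ, gcd n2 n3 = n2*u+n3*w := exists_gcd_eq_mul_add_mul _ _
    refine ⟨x, u*y, w*y, ?_⟩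
    apply mul_left_cancel₀ hg0
    linear_combination -h - y * h' - x * h1 - u*y*h2 - w*y*h3
  · have hk1' : (k1:ℚ) ≠ 0 := by exact_mod_cast hk1
    have hg' : (g:ℚ) ≠ 0 := by exact_mod_cast hg0
    have e1 : (m:ℚ) = g * k1 := by exact_mod_cast h1
    have e2 : (n2:ℚ) = g * k2 := by exact_mod_cast h2
    have : σ = n2 / m := by
      rw [hn2, hm]; push_cast
      conv_lhs => rw [← Rat.num_div_den σ]
      field_simp
    rw [this, e1, e2]; field_simp
  · have hk1' : (k1:ℚ) ≠ 0 := by exact_mod_cast hk1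
    have hg' : (g:ℚ) ≠ 0 := by exact_mod_cast hg0
    have e1 : (m:ℚ) = g * k1 := by exact_mod_cast h1
    have e2 : (n3:ℚ) = g * k3 := by exact_mod_cast h3
    have : π = n3 / m := by
      rw [hn3, hm]; push_cast
      conv_lhs => rw [← Rat.num_div_den π]
      field_simp
    rw [this, e1, e2]; field_simp

lemma Mum_int (f0 f1 f2 f3 f4 f5 f6 k1 k2 k3 : ℤ) (hk1 : k1 ≠ 0) (s p b1 b0 : ℚ)
    (h : Mum (f0:ℚ) f1 f2 f3 f4 f5 f6 1 s p 1 b1 b0) (hs : s = k2/k1) (hp : p = k3/k1) :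
    ∃ D β1 β0 : ℤ, D ≠ 0 ∧ (∃ a b c, a*D+b*β1+c*β0=1) ∧ b1 = (β1:ℚ)/D ∧ b0 = (β0:ℚ)/D ∧
      Mum f0 f1 f2 f3 f4 f5 f6 k1 k2 k3 D β1 β0 := by
  obtain ⟨D, β1, β0, hD, hc, h1, h0⟩ := clear3 b1 b0
  refine ⟨D, β1, β0, hD, hc, h1, h0, ?_⟩
  rw [hs, hp, h1, h0] at h
  have := Mum_scale _ _ _ _ _ _ _ _ _ _ _ _ _ (by exact_mod_cast hk1) (by exact_mod_cast hD) h
  simp only [Mum, mE0, mE1, mE2, mE3] at this ⊢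
  exact_mod_cast this

lemma Mum_cast (R : Type*) [CommRing R] (f0 f1 f2 f3 f4 f5 f6 k1 k2 k3 D b1 b0 : ℤ)
    (h : Mum f0 f1 f2 f3 f4 f5 f6 k1 k2 k3 D b1 b0) :
    Mum (f0:R) f1 f2 f3 f4 f5 f6 k1 k2 k3 D b1 b0 := by
  simp only [Mum, mE0, mE1, mE2, mE3] at h ⊢
  obtain ⟨h1, h0⟩ := h
  have h1 := congrArg (Int.cast : ℤ → R) h1
  have h0 := congrArg (Int.cast : ℤ → R) h0
  push_cast at h1 h0
  exact ⟨h1, h0⟩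

lemma cop_cast (R : Type*) [CommRing R] (x y z : ℤ) (h : ∃ a b c, a*x+b*y+c*z=1) :
    ∃ a b c : R, a*x+b*y+c*z=1 := by
  obtain ⟨a, b, c, h⟩ := h
  refine ⟨a, b, c, ?_⟩
  exact_mod_cast congrArg (Int.cast : ℤ → R) h

/-- Mumford data on our curve. -/
def MC (s p b1 b0 : ℚ) : Prop := Mum (1:ℚ) 2 (-1) 6 (-7) 8 0 1 s p 1 b1 b0

def AA (k1 k2 k3 : ℤ) : OO := k1 - k2*φ + k3*φ^2

lemma core_odd (s p b1 b0 : ℚ) (hM : MC s p b1 b0) (k1 k2 k3 : ℤ) (hk1 : k1 ≠ 0)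
    (hcop : ∃ a b c, a*k1+b*k2+c*k3=1) (hs : s = k2/k1) (hp : p = k3/k1)
    (P t c : OO) (hc : c ≠ 0) (hP : Prime P) (ht : ¬ P ∣ t) (hA : AA k1 k2 k3 = P*t*c^2) (h2 : ¬ P ∣ 2) :
    P ∣ p3 ∨ P ∣ yy := by
  apply Δ_odd P hP h2
  have hφ := φ_odd P hP h2
  have hPA : P ∣ AA k1 k2 k3 := hA ▸ (dvd_mul_of_dvd_left (dvd_mul_right _ _) _)
  by_cases h1 : P ∣ (k1 : OO)
  · have h3 : ¬ P ∣ (k3 : OO) := by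
      intro h3
      have : P ∣ (k2:OO) * φ := by
        have e : (k2:OO)*φ = k1 + k3*φ^2 - AA k1 k2 k3 := by unfold AA; ring
        rw [e]; exact dvd_sub (dvd_add h1 (dvd_mul_of_dvd_left h3 _)) hPA
      have h2 := (hP.dvd_or_dvd this).resolve_right hφ
      obtain ⟨a, b, c, h⟩ := cop_cast OO _ _ _ hcop
      apply hP.not_dvd_one
      rw [← h]
      exact dvd_add (dvd_add (dvd_mul_of_dvd_right h1 _) (dvd_mul_of_dvd_right h2 _)) (dvd_mul_of_dvd_right h3 _)
    have hk3 : k3 ≠ 0 := by rintro rfl; exact h3 (by simp)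
    have hp0 : p ≠ 0 := by
      rw [hp]; exact div_ne_zero (by exact_mod_cast hk3) (by exact_mod_cast hk1)
    have hk1' : (k1:ℚ) ≠ 0 := by exact_mod_cast hk1
    have hk3' : (k3:ℚ) ≠ 0 := by exact_mod_cast hk3
    have hr := Mum_rev _ _ _ _ _ _ _ _ _ _ _ hp0 hM
    obtain ⟨D, β1, β0, hD, hcD, -, -, hMi⟩ := Mum_int 0 8 (-7) 6 (-1) 2 1 k3 k2 k1 hk3 _ _ _ _
      (by push_cast; exact hr) (by rw [hs, hp]; field_simp) (by rw [hp]; field_simp)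
    have hMO := Mum_cast OO _ _ _ _ _ _ _ _ _ _ _ _ _ hMi
    have := lemR _ _ _ _ _ _ _ _ _ _ _ _ _ φ 1 P t c 1 hMO (cop_cast OO _ _ _ hcD)
      (by push_cast; linear_combination φ * φ5) hP h3 (hP.not_dvd_one) ht hc
      (by rw [← hA]; unfold AA; ring) (by convert! hPA using 1; unfold AA; ring)
    have h' := (dvd_neg (a := P)).2 this
    convert! h' using 1
    push_cast
    linear_combination 6 * φ5
  · obtain ⟨D, β1, β0, hD, hcD, -, -, hMi⟩ := Mum_int 1 2 (-1) 6 (-7) 8 0 k1 k2 k3 hk1 _ _ _ _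
      (by push_cast; exact hM) hs hp
    have hMO := Mum_cast OO _ _ _ _ _ _ _ _ _ _ _ _ _ hMi
    have := lemR _ _ _ _ _ _ _ _ _ _ _ _ _ 1 φ P t c 1 hMO (cop_cast OO _ _ _ hcD)
      (by push_cast; linear_combination φ * φ5) hP h1 hφ ht hc
      (by rw [← hA]; unfold AA; ring) (by convert! hPA using 1; unfold AA; ring)
    have h' : P ∣ φ * (40-28*φ+18*φ^2-2*φ^3+2*φ^4) := by
      convert! this using 1
      push_cast; ring
    exact (hP.dvd_or_dvd h').resolve_left hφ

/-- odd rational primes do not divide `k1` to odd order (if prime to `k3`) -/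
lemma core_inf (s p b1 b0 : ℚ) (hM : MC s p b1 b0) (k1 k2 k3 : ℤ) (hk1 : k1 ≠ 0)
    (hs : s = k2/k1) (hp : p = k3/k1)
    (P t c z : ℤ) (hc : c ≠ 0) (hP : Prime P) (ht : ¬ P ∣ t) (hA : k1 * z^2 = P*t*c^2) (h2 : ¬ P ∣ 8)
    (hPk : P ∣ k1) (h3 : ¬ P ∣ k3) : False := by
  have hk3 : k3 ≠ 0 := by rintro rfl; exact h3 (by simp)
  have hp0 : p ≠ 0 := by
    rw [hp]; exact div_ne_zero (by exact_mod_cast hk3) (by exact_mod_cast hk1)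
  have hk1' : (k1:ℚ) ≠ 0 := by exact_mod_cast hk1
  have hk3' : (k3:ℚ) ≠ 0 := by exact_mod_cast hk3
  have hr := Mum_rev _ _ _ _ _ _ _ _ _ _ _ hp0 hM
  obtain ⟨D, β1, β0, hD, hcD, -, -, hMi⟩ := Mum_int 0 8 (-7) 6 (-1) 2 1 k3 k2 k1 hk3 _ _ _ _
    (by push_cast; exact hr) (by rw [hs, hp]; field_simp) (by rw [hp]; field_simp)
  have := lemR _ _ _ _ _ _ _ _ _ _ _ _ _ 0 1 P t c z hMi hcD
    (by ring) hP h3 (hP.not_dvd_one) ht hc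
    (by rw [← hA]; ring) (by convert! hPk using 1; ring)
  apply h2
  convert! this using 1
  
end

open Polynomial NumberField
noncomputable section

lemma d2 : ∀ b1 b0 : ZMod 2, Mum (1:ZMod 2) 2 (-1) 6 (-7) 8 0 1 1 1 0 b1 b0 → b1 = 0 ∧ b0 = 0 := by
  unfold Mum mE0 mE1 mE2 mE3; decide +kernel

lemma d8 : ∀ s p b1 b0 : ZMod 8, 2*s = 2 → 2*p = 6 → Mum (1:ZMod 8) 2 (-1) 6 (-7) 8 0 1 s p 1 b1 b0 →
    2*b1 = 0 ∧ 2*b0 = 0 := by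
  unfold Mum mE0 mE1 mE2 mE3; decide +kernel

lemma d64a : ∀ s : ZMod 64, 16*s = 16 → ∃ i : Fin 16, s = 1 + 4*((i:ℕ):ZMod 64) := by decide +kernel
lemma d64b : ∀ s : ZMod 64, 16*s = -16 → ∃ i : Fin 16, s = 3 + 4*((i:ℕ):ZMod 64) := by decide +kernel
lemma d64c : ∀ b : ZMod 64, 2 * (ZMod.castHom (by norm_num : 8 ∣ 64) (ZMod 8) b) = 0 →
    ∃ i : Fin 16, b = 4*((i:ℕ):ZMod 64) := by decide +kernel
lemma d64d : ∀ i j : Fin 16, ∃ x y : Bool, (4*((i:ℕ):ZMod 64))^2 = (if x then 16 else 0) ∧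
  (4*((j:ℕ):ZMod 64))^2 = (if y then 16 else 0) ∧
  2*(4*((i:ℕ):ZMod 64))*(4*((j:ℕ):ZMod 64)) = if (x && y) then 32 else 0 := by
  decide +kernel
lemma d64 : ∀ (i j : Fin 16) (x y : Bool),
  ¬ ((2 - (if (x && y) then 32 else 0) + (1 + 4*((i:ℕ):ZMod 64)) * (-1 - (if x then 16 else 0) +
      (1 + 4*((i:ℕ):ZMod 64)) * (6 + (1 + 4*((i:ℕ):ZMod 64)) * (-7 + (1 + 4*((i:ℕ):ZMod 64)) * 8) - (3 + 4*((j:ℕ):ZMod 64)) * 8)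
      - (3 + 4*((j:ℕ):ZMod 64)) * (-7 + (1 + 4*((i:ℕ):ZMod 64)) * 8))
      - (3 + 4*((j:ℕ):ZMod 64)) * (6 + (1 + 4*((i:ℕ):ZMod 64)) * (-7 + (1 + 4*((i:ℕ):ZMod 64)) * 8) - (3 + 4*((j:ℕ):ZMod 64)) * 8) = 0) ∧
    (1 - (if y then 16 else 0) - (3 + 4*((j:ℕ):ZMod 64)) * (-1 - (if x then 16 else 0) +
      (1 + 4*((i:ℕ):ZMod 64)) * (6 + (1 + 4*((i:ℕ):ZMod 64)) * (-7 + (1 + 4*((i:ℕ):ZMod 64)) * 8) - (3 + 4*((j:ℕ):ZMod 64)) * 8)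
      - (3 + 4*((j:ℕ):ZMod 64)) * (-7 + (1 + 4*((i:ℕ):ZMod 64)) * 8)) = 0)) := by
  decide +kernel

lemma Mum_hom {R S : Type*} [CommRing R] [CommRing S] (g : R →+* S) (f0 f1 f2 f3 f4 f5 f6 k1 k2 k3 D b1 b0 : R)
    (h : Mum f0 f1 f2 f3 f4 f5 f6 k1 k2 k3 D b1 b0) :
    Mum (g f0) (g f1) (g f2) (g f3) (g f4) (g f5) (g f6) (g k1) (g k2) (g k3) (g D) (g b1) (g b0) := by
  simp only [Mum, mE0, mE1, mE2, mE3] at h ⊢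
  obtain ⟨h1, h0⟩ := h
  have h1 := congrArg g h1
  have h0 := congrArg g h0
  simp only [map_add, map_sub, map_mul, map_neg, map_pow, map_ofNat] at h1 h0
  exact ⟨h1, h0⟩

lemma Mum_unit {R : Type*} [CommRing R] (f0 f1 f2 f3 f4 f5 f6 k1 k2 k3 D b1 b0 u v : R)
    (hu : k1 * u = 1) (hv : D * v = 1) 
    (h : Mum f0 f1 f2 f3 f4 f5 f6 k1 k2 k3 D b1 b0) :
    Mum f0 f1 f2 f3 f4 f5 f6 1 (k2*u) (k3*u) 1 (b1*v) (b0*v) := by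
  have e2 : k2 = k1 * (k2*u) := by linear_combination -k2 * hu
  have e3 : k3 = k1 * (k3*u) := by linear_combination -k3 * hu
  have e1 : b1 = D * (b1*v) := by linear_combination -b1 * hv
  have e0 : b0 = D * (b0*v) := by linear_combination -b0 * hv
  generalize k2*u = s at *
  generalize k3*u = p at *
  generalize b1*v = c1 at *
  generalize b0*v = c0 at *
  subst e2 e3 e1 e0
  have hw : k1^5*D^2*(u^5*v^2) = 1 := by
    have : k1^5*D^2*(u^5*v^2) = (k1*u)^5*(D*v)^2 := by ring
    rw [this, hu, hv]; ring
  have hU : IsUnit (k1^5*D^2) := IsUnit.of_mul_eq_one _ hw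
  simp only [Mum, mE0, mE1, mE2, mE3] at h ⊢
  obtain ⟨h1, h0⟩ := h
  constructor
  · apply hU.mul_left_cancel; linear_combination h1
  · apply hU.mul_left_cancel; linear_combination h0

lemma excl (k1 k2 k3 D b1 b0 m2 m3 : ℤ) (hM : Mum 1 2 (-1) 6 (-7) 8 0 k1 k2 k3 D b1 b0)
    (hcD : ∃ a b c, a*D+b*b1+c*b0=1)
    (h1 : Odd k1) (h2 : k2 = k1 + 4*m2) (h3 : k3 = -k1 + 4*m3) : False := by
  have hM2 := Mum_cast (ZMod 2) _ _ _ _ _ _ _ _ _ _ _ _ _ hM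
  have hM64 := Mum_cast (ZMod 64) _ _ _ _ _ _ _ _ _ _ _ _ _ hM
  have hk12 : (k1 : ZMod 2) = 1 := by
    obtain ⟨n, rfl⟩ := h1; push_cast; rw [show (2:ZMod 2) = 0 from rfl]; ring
  have hD : Odd D := by
    by_contra hD
    rw [Int.not_odd_iff_even, even_iff_two_dvd, ← Nat.cast_ofNat, ← ZMod.intCast_zmod_eq_zero_iff_dvd] at hD
    rw [hD, h2, h3] at hM2
    push_cast at hM2
    rw [hk12, show (4:ZMod 2) = 0 from rfl, zero_mul, zero_mul, add_zero, add_zero, show (-1 : ZMod 2) = 1 from rfl] at hM2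
    obtain ⟨e1, e0⟩ := d2 _ _ hM2
    obtain ⟨a, b, c, h⟩ := cop_cast (ZMod 2) _ _ _ hcD
    rw [hD, e1, e0] at h
    simp at h
  have un (n : ℤ) (h : Odd n) : ∃ u : ZMod 64, (n : ZMod 64) * u = 1 := by
    have : IsUnit (n : ZMod 64) := by
      rw [ZMod.coe_int_isUnit_iff_isCoprime]
      have : IsCoprime ((2:ℤ)^6) n := by
        apply IsCoprime.pow_left
        obtain ⟨m, rfl⟩ := h; exact ⟨-m, 1, by ring⟩
      simpa using this
    exact this.exists_right_inv
  obtain ⟨u, hu⟩ := un k1 h1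
  obtain ⟨v, hv⟩ := un D hD
  have hN := Mum_unit _ _ _ _ _ _ _ _ _ _ _ _ _ u v hu hv hM64
  have hs : (16:ZMod 64) * (k2 * u) = 16 := by
    rw [h2]; push_cast
    have : (64:ZMod 64) = 0 := rfl
    linear_combination 16 * hu + m2 * u * this
  have hp : (16:ZMod 64) * (k3 * u) = -16 := by
    rw [h3]; push_cast
    have : (64:ZMod 64) = 0 := rfl
    linear_combination -16 * hu + m3 * u * this
  generalize (k2:ZMod 64)*u = s at *
  generalize (k3:ZMod 64)*u = p at *
  generalize (b1:ZMod 64)*v = c1 at *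
  generalize (b0:ZMod 64)*v = c0 at *
  obtain ⟨i, rfl⟩ := d64a s hs
  obtain ⟨j, rfl⟩ := d64b p hp
  have h8 := Mum_hom (ZMod.castHom (by norm_num : 8 ∣ 64) (ZMod 8)) _ _ _ _ _ _ _ _ _ _ _ _ _ hN
  push_cast at h8
  simp only [map_one, map_neg, map_zero, map_add, map_mul, map_ofNat, map_natCast] at h8
  obtain ⟨e1, e0⟩ := d8 _ _ _ _ (by rw [mul_add]; rw [← mul_assoc]; simp [show (2*4:ZMod 8) = 0 from rfl])
     (by rw [mul_add]; rw [← mul_assoc]; simp [show (2*4:ZMod 8) = 0 from rfl]; rfl) h8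
  obtain ⟨i1, rfl⟩ := d64c _ e1
  obtain ⟨i0, rfl⟩ := d64c _ e0
  obtain ⟨x, y, hx, hy, hz⟩ := d64d i1 i0
  apply d64 i j x y
  rw [← hx, ← hy, ← hz]
  simp only [Mum, mE0, mE1, mE2, mE3] at hN
  obtain ⟨g1, g0⟩ := hN
  push_cast at g1 g0
  constructor
  · linear_combination g1
  · linear_combination g0
end

open Polynomial NumberField
noncomputable section

lemma φ2 : φ^2 = -2*ω+ω^2+2*ω^3 := by unfold φ; linear_combination (-ω+ω^3)*ω5

lemma AA_eO (k1 k2 k3 : ℤ) : AA k1 k2 k3 = eO k1 (-2*k3) (k3-2*k2) (2*k3) k2 := by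
  unfold AA; rw [φ2]; unfold φ eO; push_cast; ring

lemma AA_ne (k1 k2 k3 : ℤ) (h1 : k1 ≠ 0) : AA k1 k2 k3 ≠ 0 := by
  intro h
  rw [AA_eO] at h
  have h' : el ![(k1:ℚ), (-2*k3), (k3-2*k2), (2*k3), k2] = 0 := by
    rw [el_eq]
    have := congrArg (algebraMap OO LL) h
    simp only [eO, map_add, map_mul, map_pow, map_intCast, ω_coe, map_zero] at this
    rw [← this]; push_cast; simp
  have := congrFun (el_inj h') 0
  simp at this
  exact h1 this

lemma N_AA1 (k1 k2 k3 : ℤ) (hk : k1 ≠ 0) (s p b1 b0 : ℚ) (hM : MC s p b1 b0) (hs : s = k2/k1) (hp : p = k3/k1) :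
    ((Algebra.norm ℤ (AA k1 k2 k3) : ℤ) : ℚ) = k1^5 * (b0^2+s*b0*b1+p*b1^2)^2 := by
  have hk' : (k1:ℚ) ≠ 0 := by exact_mod_cast hk
  rw [AA_eO, normO]
  unfold MC Mum mE0 mE1 mE2 mE3 at hM
  obtain ⟨h1, h0⟩ := hM
  have g1 : 2*b0*b1+s*b1^2 = 2 + s*(-1+s*(6+s*(-7+s*8)-p*8)-p*(-7+s*8))-p*(6+s*(-7+s*8)-p*8) := by
    linear_combination -h1
  have g0 : b0^2-p*b1^2 = 1 - p*(-1+s*(6+s*(-7+s*8)-p*8)-p*(-7+s*8)) := by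
    linear_combination -h0
  have e : (b0^2+s*b0*b1+p*b1^2)^2 = (b0^2-p*b1^2)^2+s*(b0^2-p*b1^2)*(2*b0*b1+s*b1^2)+p*(2*b0*b1+s*b1^2)^2 := by ring
  rw [e, g1, g0]
  rw [hs, hp]
  push_cast
  simp [mL, Matrix.det_succ_row_zero, Fin.sum_univ_succ, Fin.succAbove]
  field_simp
  ring

lemma N_AA (k1 k2 k3 : ℤ) (hk : k1 ≠ 0) (s p b1 b0 : ℚ) (hM : MC s p b1 b0) (hs : s = k2/k1) (hp : p = k3/k1) :
    ∃ X : ℚ, ((Algebra.norm ℤ (AA k1 k2 k3) : ℤ) : ℚ) = k1^5 * X^2 :=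
  ⟨_, N_AA1 k1 k2 k3 hk s p b1 b0 hM hs hp⟩

lemma no_pr (pr : OO) (pp : ℤ) (hpr : Prime pr) (hN : Algebra.norm ℤ pr = pp) (hpp : Prime pp) (h8 : ¬ pp ∣ 8)
    (h2 : ¬ pr ∣ 2)
    (s p b1 b0 : ℚ) (hM : MC s p b1 b0) (k1 k2 k3 : ℤ) (hk1 : k1 ≠ 0)
    (hcop : ∃ a b c, a*k1+b*k2+c*k3=1) (hs : s = k2/k1) (hp : p = k3/k1)
    (n m : ℤ) (hn : ¬ pp ∣ n) (hm : m ≠ 0) (hA : Algebra.norm ℤ (AA k1 k2 k3) = pp * n * m^2)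
    (hd : pr ∣ AA k1 k2 k3) : False := by
  have hpd : pr ∣ (pp : OO) := by
    have := Ideal.absNorm_mem (Ideal.span {pr})
    rw [Ideal.absNorm_span_singleton, Ideal.mem_span_singleton, hN] at this
    rcases Int.natAbs_eq pp with h | h
    · rw [h]; simpa using this
    · rw [h]; push_cast; rw [dvd_neg]; simpa using this
  have hback (x : ℤ) (h : pr ∣ (x:OO)) : pp ∣ x := by
    have := dvd_N h
    rw [hN] at this
    have e : Algebra.norm ℤ (x:OO) = x^(Module.finrank ℤ OO) := by
      have := Algebra.norm_algebraMap (S := OO) x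
      simpa using this
    rw [e] at this
    exact hpp.dvd_of_dvd_pow this
  obtain ⟨X, hX⟩ := N_AA k1 k2 k3 hk1 s p b1 b0 hM hs hp
  rw [hA] at hX
  have hXd : (X.den:ℚ) ≠ 0 := by exact_mod_cast X.den_nz
  have key : k1 * (k1^2 * X.num)^2 = pp * n * (m * X.den)^2 := by
    rw [← Rat.num_div_den X] at hX
    field_simp at hX
    have : ((k1 * (k1^2 * X.num)^2 : ℤ) : ℚ) = ((pp * n * (m * X.den)^2 : ℤ):ℚ) := by
      push_cast at hX ⊢; linear_combination -hX
    exact_mod_cast this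
  have hc : m * X.den ≠ 0 := mul_ne_zero hm (by exact_mod_cast X.den_nz)
  have hk : pp ∣ k1 := by
    by_contra hk
    exact hpp.not_dvd_one (parity pp n (m*X.den) 1 k1 (k1^2*X.num) hpp hn hk hc (by linear_combination -key))
  have hk' : pr ∣ (k1:OO) := hpd.trans (Int.cast_dvd_cast _ _ hk)
  apply core_inf s p b1 b0 hM k1 k2 k3 hk1 hs hp pp n (m*X.den) (k1^2*X.num) hc hpp hn key h8 hk
  intro h3
  have h3' : pr ∣ (k3:OO) := hpd.trans (Int.cast_dvd_cast _ _ h3)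
  have : pr ∣ (k2:OO) * φ := by
    have e : (k2:OO)*φ = k1 + k3*φ^2 - AA k1 k2 k3 := by unfold AA; ring
    rw [e]; exact dvd_sub (dvd_add hk' (dvd_mul_of_dvd_left h3' _)) hd
  have hk2 := hback _ ((hpr.dvd_or_dvd this).resolve_right (φ_odd pr hpr h2))
  obtain ⟨a, b, c, h⟩ := hcop
  apply hpp.not_dvd_one
  rw [← h]
  exact dvd_add (dvd_add (dvd_mul_of_dvd_right hk _) (dvd_mul_of_dvd_right hk2 _)) (dvd_mul_of_dvd_right h3 _)

lemma q_AA (k1 k2 k3 : ℤ) (h : q ∣ AA k1 k2 k3) : 2 ∣ k1 - k3 ∧ 2 ∣ k2 - k3 := by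
  have := q_quad k1 (-2*k3-k2) (k3-2*k2) (2*k3) (by
    have e : (k1:OO) + ((-2*k3-k2:ℤ):OO) * ω + ((k3-2*k2:ℤ):OO) * ω^2 + ((2*k3:ℤ):OO)*ω^3 =
      AA k1 k2 k3 - q * (k2 * ω*(ω+1)) := by
      rw [AA_eO]; unfold eO q; push_cast; ring
    rw [e]; exact dvd_sub h (dvd_mul_right _ _))
  omega

lemma even_sq (k : ℤ) : ∃ n, k^2 = k + 2*n := by
  obtain ⟨n, hn⟩ := Int.even_mul_pred_self k
  exact ⟨n, by linear_combination hn⟩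

lemma AA_sq (k1 k2 k3 : ℤ) : ∃ z, q^2 ∣ AA k1 k2 k3 - z^2 := by
  obtain ⟨n1, h1⟩ := even_sq k1
  obtain ⟨n2, h2⟩ := even_sq k2
  obtain ⟨n3, h3⟩ := even_sq k3
  have h1 := congrArg (Int.cast : ℤ → OO) h1
  have h2 := congrArg (Int.cast : ℤ → OO) h2
  have h3 := congrArg (Int.cast : ℤ → OO) h3
  push_cast at h1 h2 h3
  refine ⟨k1 + k3*ω + k2*ω^2, ?_⟩
  have e : AA k1 k2 k3 - (k1 + k3*ω + k2*ω^2)^2 = 2 * (-n1 + (-k3-k1*k3)*ω + (-k2-n3-k1*k2)*ω^2+(k3-k2*k3)*ω^3-n2*ω^4) := by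
    rw [AA_eO]; unfold eO; push_cast
    linear_combination -h1 - ω^2 * h3 - ω^4*h2
  rw [e]; exact q2_two _

lemma AA_odd (k1 k2 k3 : ℤ) (z0 c0 : OO) (hz : z0 = q * c0) (hc0 : ¬ q ∣ c0) (B : OO)
    (h : AA k1 k2 k3 = z0^2 + 4*B ∨ AA k1 k2 k3 = -z0^2 + 4*B) :
    ∃ A1 z, AA k1 k2 k3 = A1*q^2 ∧ ¬ q ∣ A1 ∧ q^2 ∣ A1 - z^2 := by
  have h4 : (4:OO) = q^2*(q^2*(vO*ω)^2) := by
    have : (4:OO) = 2*2 := by norm_num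
    rw [this, two_eq]; ring
  have fin (A1 : OO) (e : q^2 ∣ A1 - c0^2) : ¬ q ∣ A1 := by
    intro h
    have h1 : q ∣ A1 - c0^2 := (dvd_pow_self q two_ne_zero).trans e
    have := (dvd_sub_right h).1 h1
    exact hc0 (q_prime.dvd_of_dvd_pow this)
  rcases h with h | h
  · refine ⟨c0^2 + q^2*((vO*ω)^2*B), c0, ?_, ?_⟩
    · rw [h, hz, h4]; ring
    · have e : q^2 ∣ c0^2 + q^2*((vO*ω)^2*B) - c0^2 := ⟨(vO*ω)^2*B, by ring⟩
      exact ⟨fin _ e, e⟩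
  · refine ⟨-c0^2 + q^2*((vO*ω)^2*B), c0, ?_, ?_⟩
    · rw [h, hz, h4]; ring
    · have e : q^2 ∣ -c0^2 + q^2*((vO*ω)^2*B) - c0^2 := by
        have : -c0^2 + q^2*((vO*ω)^2*B) - c0^2 = 2*(-c0^2) + q^2*((vO*ω)^2*B) := by ring
        rw [this]; exact dvd_add (q2_two _) (dvd_mul_right _ _)
      exact ⟨fin _ e, e⟩
end

open Polynomial NumberField
noncomputable section

lemma q_ndvd_lin (c t : OO) (a b : ℤ) (h : c = q * t + (a + b * ω)) (hab : ¬ (2 ∣ a ∧ 2 ∣ b)) : ¬ q ∣ c := by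
  intro hc
  apply hab
  apply q_lin
  rw [h] at hc
  exact (dvd_add_right (dvd_mul_right _ _)).1 hc

lemma AA_red (k1 k2 k3 : ℤ) (hk1 : k1 ≠ 0) (hcop : ∃ a b c, a*k1+b*k2+c*k3=1) (s p b1 b0 : ℚ) (hM : MC s p b1 b0)
    (hs : s = k2/k1) (hp : p = k3/k1) :
    ∃ A1 w z, AA k1 k2 k3 = A1*w^2 ∧ w ≠ 0 ∧ ¬ q ∣ A1 ∧ q^2 ∣ A1 - z^2 := by
  by_cases h : q ∣ AA k1 k2 k3
  swap
  · obtain ⟨z, hz⟩ := AA_sq k1 k2 k3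
    exact ⟨_, 1, z, by ring, one_ne_zero, h, hz⟩
  suffices ∃ A1 z, AA k1 k2 k3 = A1*q^2 ∧ ¬ q ∣ A1 ∧ q^2 ∣ A1 - z^2 by
    obtain ⟨A1, z, h1, h2, h3⟩ := this
    exact ⟨A1, q, z, h1, q_ne, h2, h3⟩
  obtain ⟨e1, e2⟩ := q_AA _ _ _ h
  have hodd : ¬ 2 ∣ k1 := by
    intro h1
    obtain ⟨a, b, c, h⟩ := hcop
    have h3 : (2:ℤ) ∣ k3 := by omega
    have h2 : (2:ℤ) ∣ k2 := by omega
    have : (2:ℤ) ∣ 1 := by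
      rw [← h]
      exact dvd_add (dvd_add (dvd_mul_of_dvd_right h1 _) (dvd_mul_of_dvd_right h2 _)) (dvd_mul_of_dvd_right h3 _)
    omega
  have lin (a1 a2 a3 m1 m2 m3 : ℤ) (g1 : k1 = a1 + 4*m1) (g2 : k2 = a2 + 4*m2) (g3 : k3 = a3+4*m3) :
      AA k1 k2 k3 = AA a1 a2 a3 + 4 * AA m1 m2 m3 := by
    subst g1 g2 g3; unfold AA; push_cast; ring
  have ex : ¬ (4 ∣ k2 - k1 ∧ 4 ∣ k3 + k1) := by
    rintro ⟨⟨m2, h2⟩, ⟨m3, h3⟩⟩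
    obtain ⟨D, β1, β0, hD, hcD, -, -, hMi⟩ := Mum_int 1 2 (-1) 6 (-7) 8 0 k1 k2 k3 hk1 _ _ _ _
      (by push_cast; exact hM) hs hp
    exact excl k1 k2 k3 D β1 β0 m2 m3 hMi hcD (by rw [← Int.not_even_iff_odd, even_iff_two_dvd]; exact hodd)
      (by linarith) (by linarith)
  have A (e : ℤ) (he : e = 1 ∨ e = -1) (g1 : 4 ∣ k1 - e) (g2 : 4 ∣ k2 + e) (g3 : 4 ∣ k3 - e) :
      ∃ A1 z, AA k1 k2 k3 = A1*q^2 ∧ ¬ q ∣ A1 ∧ q^2 ∣ A1 - z^2 := by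
    obtain ⟨m1, g1⟩ := g1
    obtain ⟨m2, g2⟩ := g2
    obtain ⟨m3, g3⟩ := g3
    have := lin e (-e) e m1 m2 m3 (by linarith) (by linarith) (by linarith)
    refine AA_odd _ _ _ (1-2*ω+ω^3) (1-3*ω-3*ω^2+ω^3+ω^4) (by unfold q; linear_combination (-ω)*ω5)
      (q_ndvd_lin _ (-2+2*ω+ω^2) 3 (-7) (by unfold q; push_cast; ring) (by omega)) (AA m1 m2 m3) ?_
    rw [this]
    rcases he with rfl | rfl
    · left; rw [AA_eO]; unfold eO; push_cast; linear_combination (-ω)*ω5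
    · right; rw [AA_eO]; unfold eO; push_cast; linear_combination (ω)*ω5
  have B (e : ℤ) (he : e = 1 ∨ e = -1) (g1 : 4 ∣ k1 - e) (g2 : 4 ∣ k2 - e) (g3 : 4 ∣ k3 - e) :
      ∃ A1 z, AA k1 k2 k3 = A1*q^2 ∧ ¬ q ∣ A1 ∧ q^2 ∣ A1 - z^2 := by
    obtain ⟨m1, g1⟩ := g1
    obtain ⟨m2, g2⟩ := g2
    obtain ⟨m3, g3⟩ := g3
    have := lin e e e m1 m2 m3 (by linarith) (by linarith) (by linarith)
    refine AA_odd _ _ _ (1-ω-ω^2) (3-ω-4*ω^2+ω^4) (by unfold q; linear_combination (1-ω)*ω5)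
      (q_ndvd_lin _ (-4+ω+ω^2) 7 (-6) (by unfold q; push_cast; ring) (by omega)) (AA m1 m2 m3) ?_
    rw [this]
    rcases he with rfl | rfl
    · left; rw [AA_eO]; unfold eO; push_cast; ring
    · right; rw [AA_eO]; unfold eO; push_cast; ring
  have C (e : ℤ) (he : e = 1 ∨ e = -1) (g1 : 4 ∣ k1 - e) (g2 : 4 ∣ k2 - 3*e) (g3 : 4 ∣ k3 + e) :
      ∃ A1 z, AA k1 k2 k3 = A1*q^2 ∧ ¬ q ∣ A1 ∧ q^2 ∣ A1 - z^2 := by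
    obtain ⟨m1, g1⟩ := g1
    obtain ⟨m2, g2⟩ := g2
    obtain ⟨m3, g3⟩ := g3
    have := lin e (3*e) (-e) m1 m2 m3 (by linarith) (by linarith) (by linarith)
    refine AA_odd _ _ _ (1+ω-2*ω^2-ω^3+ω^4) (5+2*ω-4*ω^2-ω^3+ω^4) (by unfold q; linear_combination (2-ω)*ω5)
      (q_ndvd_lin _ (-5+ω^2) 10 (-3) (by unfold q; push_cast; ring) (by omega)) (AA m1 m2 m3) ?_
    rw [this]
    rcases he with rfl | rfl
    · left; rw [AA_eO]; unfold eO; push_cast; linear_combination (2*ω^2-ω^3)*ω5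
    · right; rw [AA_eO]; unfold eO; push_cast; linear_combination -(2*ω^2-ω^3)*ω5
  have : (∃ e : ℤ, (e = 1 ∨ e = -1) ∧ 4 ∣ k1 - e ∧ 4 ∣ k2 + e ∧ 4 ∣ k3 - e) ∨
     (∃ e : ℤ, (e = 1 ∨ e = -1) ∧ 4 ∣ k1 - e ∧ 4 ∣ k2 - e ∧ 4 ∣ k3 - e) ∨
     (∃ e : ℤ, (e = 1 ∨ e = -1) ∧ 4 ∣ k1 - e ∧ 4 ∣ k2 - 3*e ∧ 4 ∣ k3 + e) := by
    have : k1 % 4 = 1 ∨ k1 % 4 = 3 := by omega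
    rcases this with h | h
    · by_cases h3 : k3 % 4 = 1
      · by_cases h2 : k2 % 4 = 1
        · right; left; exact ⟨1, by omega⟩
        · left; exact ⟨1, by omega⟩
      · right; right; exact ⟨1, by omega⟩
    · by_cases h3 : k3 % 4 = 3
      · by_cases h2 : k2 % 4 = 3
        · right; left; exact ⟨-1, by omega⟩
        · left; exact ⟨-1, by omega⟩
      · right; right; exact ⟨-1, by omega⟩
  rcases this with ⟨e, a, b, c, d⟩ | ⟨e, a, b, c, d⟩ | ⟨e, a, b, c, d⟩
  · exact A e a b c d
  · exact B e a b c d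
  · exact C e a b c d

lemma fin_q (A1 z z1 : OO) (a b c d e : Bool) (hA : A1 = sgn a * pw u1 b * pw u2 c * pw ω d * pw q e * z1^2)
    (hq : ¬ q ∣ A1) (hz : q^2 ∣ A1 - z^2) : e = false ∧ b = d ∧ c = d := by
  have he : e = false := by
    cases e
    · rfl
    · exfalso; apply hq; rw [hA]; exact ⟨sgn a * pw u1 b * pw u2 c * pw ω d * z1^2, by simp [pw]; ring⟩
  subst he
  refine ⟨rfl, ?_⟩
  have e1 : pw q false = 1 := by simp [pw]
  rw [e1, mul_one] at hA
  have hz1 : ¬ q ∣ z1 := fun h => hq (hA ▸ dvd_mul_of_dvd_right (dvd_pow h two_ne_zero) _)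
  have hcop : IsCoprime (q^2) z1 := by
    apply IsCoprime.pow_left
    exact (q_prime.irreducible.coprime_iff_not_dvd).2 hz1
  obtain ⟨x, y, hxy⟩ := hcop
  apply eps_res a b c d (z*y)
  have : sgn a * pw u1 b * pw u2 c * pw ω d - (z*y)^2 =
     (A1 - z^2)*y^2 + q^2 * (sgn a * pw u1 b * pw u2 c * pw ω d * (x * (1 + y*z1))) := by
    rw [hA]
    linear_combination (-sgn a * pw u1 b * pw u2 c * pw ω d)*(1+y*z1)*hxy
  rw [this]
  exact dvd_add (dvd_mul_of_dvd_left hz _) (dvd_mul_right _ _)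

lemma rt2 : ω*u1*u2*q^2 = 2*(1-ω+ω^2+ω^3)^2 := by
  have h1 : vI*u1*u2 = (1-ω+ω^2+ω^3)^2 := by
    unfold vI u1 u2; linear_combination (-ω+2*ω^2-ω^3)*ω5
  rw [← h1]
  conv_rhs => rw [two_eq]
  linear_combination (-ω*u1*u2*q^2)*v_mul

lemma N_ne {x : OO} (h : x ≠ 0) : Algebra.norm ℤ x ≠ 0 := by
  rw [Algebra.norm_ne_zero_iff]; exact h

lemma pwN (x : OO) (b : Bool) : Algebra.norm ℤ (pw x b) = if b then Algebra.norm ℤ x else 1 := by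
  cases b <;> simp [pw]

lemma main_sq (k1 k2 k3 : ℤ) (hk1 : k1 ≠ 0) (hcop : ∃ a b c, a*k1+b*k2+c*k3=1) (s p b1 b0 : ℚ) (hM : MC s p b1 b0)
    (hs : s = k2/k1) (hp : p = k3/k1) :
    ∃ (dd : ℤ) (x y : OO), dd ≠ 0 ∧ x ≠ 0 ∧ AA k1 k2 k3 * x^2 = dd * y^2 := by
  obtain ⟨A1, w, z, hA, hw, hq, hz⟩ := AA_red k1 k2 k3 hk1 hcop s p b1 b0 hM hs hp
  have hA0 := AA_ne k1 k2 k3 hk1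
  have hA1 : A1 ≠ 0 := by rintro rfl; exact hq (dvd_zero _)
  obtain ⟨S, c, hS, hSc⟩ := sqfree_dec A1 hA1
  have hS0 : S ≠ 0 := hS.ne_zero
  have hc0 : c ≠ 0 := by rintro rfl; apply hA1; rw [hSc]; ring
  have hAS : AA k1 k2 k3 = S * (c*w)^2 := by rw [hA, hSc]; ring
  have hcw : c*w ≠ 0 := mul_ne_zero hc0 hw
  have hodd (P : OO) (hP : Prime P) (hd : P ∣ S) (h2 : ¬ P ∣ 2) : P ∣ p3 ∨ P ∣ yy := by
    obtain ⟨t, rfl⟩ := hd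
    refine core_odd s p b1 b0 hM k1 k2 k3 hk1 hcop hs hp P t (c*w) hcw hP ?_ hAS h2
    rintro ⟨u, rfl⟩
    exact hP.not_isUnit (hS P ⟨u, by ring⟩)
  obtain ⟨d, S1, e1, hS1, n1⟩ := sq_split S ω hS ω_prime
  obtain ⟨e, S2, e2, hS2, n2⟩ := sq_split S1 q hS1 q_prime
  obtain ⟨g, S3, e3, hS3, n3⟩ := sq_split S2 p3 hS2 p3_prime
  obtain ⟨h, S4, e4, hS4, n4⟩ := sq_split S3 yy hS3 yy_prime
  have d4 : S4 ∣ S3 := ⟨_, by rw [e4, mul_comm]⟩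
  have d3 : S4 ∣ S2 := d4.trans ⟨_, by rw [e3, mul_comm]⟩
  have d2 : S4 ∣ S1 := d3.trans ⟨_, by rw [e2, mul_comm]⟩
  have d1 : S4 ∣ S := d2.trans ⟨_, by rw [e1, mul_comm]⟩
  have hU : IsUnit S4 := by
    by_contra hU
    obtain ⟨P, hPi, hPd⟩ := WfDvdMonoid.exists_irreducible_factor hU hS4.ne_zero
    have hP := hPi.prime
    by_cases h2 : P ∣ 2
    · rcases two_cases P hP h2 with h | h
      · exact n1 (assoc_dvd hP ω_prime h (hPd.trans d2))
      · exact n2 (assoc_dvd hP q_prime h (hPd.trans d3))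
    · rcases hodd P hP (hPd.trans d1) h2 with h | h
      · exact n3 (assoc_dvd hP p3_prime h (hPd.trans d4))
      · exact n4 (assoc_dvd hP yy_prime h hPd)
  have hSe : S = pw ω d * pw q e * pw p3 g * pw yy h * S4 := by rw [e1, e2, e3, e4]; ring
  have hU' := (isUnit_iff_N S4).1 hU
  have hUN : Algebra.norm ℤ S4 = 1 ∨ Algebra.norm ℤ S4 = -1 := by omega
  have hNA : Algebra.norm ℤ (AA k1 k2 k3) = (if d then 2 else 1) * (if e then 4 else 1) * (if g then 3 else 1) *
      (if h then 97 else 1) * Algebra.norm ℤ S4 * (Algebra.norm ℤ (c*w))^2 := by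
    rw [hAS, hSe]; simp only [map_mul, map_pow, pwN, N_ω, N_q, N_p3, N_yy]
  have hg : g = false := by
    by_contra hg
    have hg : g = true := by simpa using hg
    subst hg
    refine no_pr p3 3 p3_prime N_p3 Int.prime_three (by norm_num) ?_ s p b1 b0 hM k1 k2 k3 hk1 hcop hs hp
      ((if d then 2 else 1) * (if e then 4 else 1) * (if h then 97 else 1) * Algebra.norm ℤ S4)
      (Algebra.norm ℤ (c*w)) ?_ (N_ne hcw) ?_ ?_
    · intro h; rcases two_cases _ p3_prime h with h | h
      · have := dvd_N h; rw [N_p3, N_ω] at this; norm_num at this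
      · have := dvd_N h; rw [N_p3, N_q] at this; norm_num at this
    · rcases hUN with h | h <;> rw [h] <;> split_ifs <;> norm_num
    · rw [hNA]; simp only [if_true]; ring
    · rw [hAS, hSe]; exact ⟨pw ω d * pw q e * pw yy h * S4 * (c*w)^2, by simp only [pw, if_true]; ring⟩
  have hh : h = false := by
    by_contra hh
    have hh : h = true := by simpa using hh
    subst hh
    refine no_pr yy 97 yy_prime N_yy (by rw [Int.prime_iff_natAbs_prime]; norm_num) (by norm_num) ?_ s p b1 b0 hM k1 k2 k3 hk1 hcop hs hp
      ((if d then 2 else 1) * (if e then 4 else 1) * (if g then 3 else 1) * Algebra.norm ℤ S4)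
      (Algebra.norm ℤ (c*w)) ?_ (N_ne hcw) ?_ ?_
    · intro h; rcases two_cases _ yy_prime h with h | h
      · have := dvd_N h; rw [N_yy, N_ω] at this; norm_num at this
      · have := dvd_N h; rw [N_yy, N_q] at this; norm_num at this
    · rcases hUN with h | h <;> rw [h] <;> split_ifs <;> norm_num
    · rw [hNA]; simp only [if_true]; ring
    · rw [hAS, hSe]; exact ⟨pw ω d * pw q e * pw p3 g * S4 * (c*w)^2, by simp only [pw, if_true]; ring⟩
  subst hg hh
  obtain ⟨a, b, c', z0, hz0, hS4e⟩ := unit_gen S4 hU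
  have hA1e : A1 = sgn a * pw u1 b * pw u2 c' * pw ω d * pw q e * (z0*c)^2 := by
    rw [hSc, hSe, hS4e]; simp only [pw, Bool.false_eq_true, if_false]; ring
  obtain ⟨rfl, rfl, rfl⟩ := fin_q A1 z (z0*c) a b c' d e hA1e hq hz
  have hsg : ∃ ss : ℤ, ss ≠ 0 ∧ sgn a = (ss : OO) := by
    cases a
    · exact ⟨1, by norm_num, by simp [sgn]⟩
    · exact ⟨-1, by norm_num, by simp [sgn]⟩
  obtain ⟨ss, hss, hsse⟩ := hsg
  cases c'
  · refine ⟨ss, 1, z0*c*w, hss, one_ne_zero, ?_⟩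
    rw [hA, hA1e, hsse]; simp only [pw, Bool.false_eq_true, if_false]; ring
  · refine ⟨2*ss, q, (1-ω+ω^2+ω^3)*(z0*c*w), by omega, q_ne, ?_⟩
    rw [hA, hA1e, hsse]; simp only [pw, Bool.false_eq_true, if_false, if_true]; push_cast
    linear_combination (ss * (z0*c*w)^2) * rt2

def φL : LL := algebraMap OO LL φ

theorem A_II (s p b1 b0 : ℚ) (hM : MC s p b1 b0) : ∃ c : LL, 1 - (s:LL)*φL + (p:LL)*φL^2 = c^2 := by
  obtain ⟨k1, k2, k3, hk1, hcop, hs, hp⟩ := clear3 s p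
  obtain ⟨dd, x, y, hdd, hx, h⟩ := main_sq k1 k2 k3 hk1 hcop s p b1 b0 hM hs hp
  obtain ⟨X, hX⟩ := N_AA k1 k2 k3 hk1 s p b1 b0 hM hs hp
  have hN := congrArg (Algebra.norm ℤ) h
  have e : Algebra.norm ℤ (dd:OO) = dd^5 := by
    have := Algebra.norm_algebraMap (S := OO) dd
    rw [NumberField.RingOfIntegers.rank, LL_finrank] at this
    simpa using this
  rw [map_mul, map_mul, map_pow, map_pow, e] at hN
  have hNq : ((Algebra.norm ℤ (AA k1 k2 k3) : ℤ):ℚ) * ((Algebra.norm ℤ x : ℤ):ℚ)^2 = dd^5 * ((Algebra.norm ℤ y:ℤ):ℚ)^2 := by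
    exact_mod_cast hN
  have hA0 := AA_ne k1 k2 k3 hk1
  have hX0 : X ≠ 0 := by
    rintro rfl
    apply N_ne hA0
    have : ((Algebra.norm ℤ (AA k1 k2 k3) : ℤ):ℚ) = 0 := by rw [hX]; ring
    exact_mod_cast this
  have hNx : ((Algebra.norm ℤ x : ℤ):ℚ) ≠ 0 := by exact_mod_cast N_ne hx
  have hy : y ≠ 0 := by
    rintro rfl
    have : AA k1 k2 k3 * x^2 ≠ 0 := mul_ne_zero hA0 (pow_ne_zero 2 hx)
    apply this; rw [h]; ring
  have hNy : ((Algebra.norm ℤ y : ℤ):ℚ) ≠ 0 := by exact_mod_cast N_ne hy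
  rw [hX] at hNq
  have hk1' : (k1:ℚ) ≠ 0 := by exact_mod_cast hk1
  have hd' : (dd:ℚ) ≠ 0 := by exact_mod_cast hdd
  obtain ⟨t, ht0, ht⟩ : ∃ t : ℚ, t ≠ 0 ∧ (dd:ℚ) = k1 * t^2 := by
    refine ⟨k1^2 * X * (Algebra.norm ℤ x : ℤ) / (dd^2 * (Algebra.norm ℤ y:ℤ)), by positivity, ?_⟩
    field_simp
    linear_combination -hNq
  have hL := congrArg (algebraMap OO LL) h
  simp only [map_mul, map_pow, AA, map_sub, map_add, map_intCast] at hL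
  have hxL : algebraMap OO LL x ≠ 0 := fun h => hx (OO_inj (by rw [h, map_zero]))
  have ht' : (t:LL) ≠ 0 := by exact_mod_cast ht0
  have hk1L : (k1:LL) ≠ 0 := by exact_mod_cast hk1
  have htL : (dd:LL) = k1 * t^2 := by exact_mod_cast congrArg (Rat.cast : ℚ → LL) ht
  refine ⟨t * algebraMap OO LL y / algebraMap OO LL x, ?_⟩
  rw [hs, hp]
  push_cast
  rw [htL] at hL
  unfold φL
  field_simp
  apply mul_left_cancel₀ hk1L
  linear_combination k1 * hL
end

open Polynomial NumberField
noncomputable section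

def θ : LL := φL⁻¹

lemma MC_iff (s p b1 b0 : ℚ) : MC s p b1 b0 ↔
   (2*b0*b1+s*b1^2 = 2 + s*(-1+s*(6+s*(-7+s*8)-p*8)-p*(-7+s*8))-p*(6+s*(-7+s*8)-p*8) ∧
    b0^2-p*b1^2 = 1 - p*(-1+s*(6+s*(-7+s*8)-p*8)-p*(-7+s*8))) := by
  unfold MC Mum mE0 mE1 mE2 mE3
  constructor
  · rintro ⟨h1, h0⟩
    exact ⟨by linear_combination -h1, by linear_combination -h0⟩
  · rintro ⟨h1, h0⟩
    exact ⟨by linear_combination -h1, by linear_combination -h0⟩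

lemma MC_X (s p b1 b0 : ℚ) (hM : MC s p b1 b0) : b0^2+s*b0*b1+p*b1^2 ≠ 0 := by
  obtain ⟨k1, k2, k3, hk1, hcop, hs, hp⟩ := clear3 s p
  have h := N_AA1 k1 k2 k3 hk1 s p b1 b0 hM hs hp
  intro h0
  rw [h0] at h
  have : ((Algebra.norm ℤ (AA k1 k2 k3) : ℤ):ℚ) = 0 := by rw [h]; ring
  exact N_ne (AA_ne k1 k2 k3 hk1) (by exact_mod_cast this)

lemma φL_eq : φL = 2*wL^2 - wL^4 := by
  unfold φL φ; simp only [map_sub, map_mul, map_pow, map_ofNat, ω_coe]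

lemma φL5 : φL^5+2*φL^4-φL^3+6*φL^2-7*φL+8=0 := by
  have := congrArg (algebraMap OO LL) φ5
  simp only [map_add, map_sub, map_mul, map_pow, map_ofNat, map_zero] at this
  exact this

lemma φL_ne : φL ≠ 0 := by
  intro h
  have := φL5
  rw [h] at this
  norm_num at this

lemma φL2 : φL^2 = -2*wL+wL^2+2*wL^3 := by rw [φL_eq]; linear_combination (-wL+wL^3)*wL_eq
lemma φL3 : φL^3 = -2*wL-3*wL^2-2*wL^3-wL^4 := by
  rw [φL_eq]; linear_combination (-wL-2*wL^2-2*wL^3+3*wL^5-wL^7)*wL_eq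
lemma φL4 : φL^4 = 8+4*wL+8*wL^3+5*wL^4 := by
  rw [φL_eq]; linear_combination (4+4*wL+2*wL^2-wL^3-4*wL^4-3*wL^5+2*wL^6+8*wL^7-5*wL^9+wL^11)*wL_eq

lemma φ_surj (x : LL) : ∃ d0 d1 d2 d3 d4 : ℚ, x = d0 + d1*φL + d2*φL^2 + d3*φL^3 + d4*φL^4 := by
  obtain ⟨c, rfl⟩ := el_surj x
  rw [el_eq]
  refine ⟨c 0 - 4/3*c 1 + 4/3*c 2 - 2*c 3 + 8/3*c 4, 7/12*c 1 - 1/3*c 2 + 3/4*c 3-5/3*c 4,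
    -5/12*c 1+1/6*c 2+1/3*c 4, 1/4*c 1-1/2*c 2+1/2*c 3-c 4, 1/6*c 1-1/6*c 2+1/4*c 3-1/3*c 4, ?_⟩
  rw [φL2, φL3, φL4, φL_eq]
  push_cast
  ring

lemma φ_ind (d0 d1 d2 d3 d4 : ℚ) (h : (d0:LL) + d1*φL + d2*φL^2 + d3*φL^3 + d4*φL^4 = 0) :
    d0 = 0 ∧ d1 = 0 ∧ d2 = 0 ∧ d3 = 0 ∧ d4 = 0 := by
  rw [φL2, φL3, φL4, φL_eq] at h
  have h' : el ![d0+8*d4, -2*d2-2*d3+4*d4, 2*d1+d2-3*d3, 2*d2-2*d3+8*d4, -d1-d3+5*d4] = 0 := by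
    rw [el_eq, ← h]
    simp
    ring
  have h0 := el_inj h'
  have e0 := congrFun h0 0
  have e1 := congrFun h0 1
  have e2 := congrFun h0 2
  have e3 := congrFun h0 3
  have e4 := congrFun h0 4
  simp at e0 e1 e2 e3 e4
  refine ⟨?_, ?_, ?_, ?_, ?_⟩ <;> linarith

lemma θφ : θ * φL = 1 := inv_mul_cancel₀ φL_ne

lemma θ_surj (x : LL) : ∃ d0 d1 d2 d3 d4 : ℚ, x = d0 + d1*θ + d2*θ^2 + d3*θ^3 + d4*θ^4 := by
  obtain ⟨d0, d1, d2, d3, d4, h⟩ := φ_surj (x * φL^4)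
  refine ⟨d4, d3, d2, d1, d0, ?_⟩
  have h' : x = x*φL^4*θ^4 := by
    have : θ^4*φL^4 = 1 := by rw [← mul_pow, θφ, one_pow]
    linear_combination -x*this
  rw [h', h]
  have e := θφ
  have e2 : θ^2*φL^2 = 1 := by rw [← mul_pow, θφ, one_pow]
  have e3 : θ^3*φL^3 = 1 := by rw [← mul_pow, θφ, one_pow]
  have e4 : θ^4*φL^4 = 1 := by rw [← mul_pow, θφ, one_pow]
  linear_combination d4*e4 + d3*θ*e3+d2*θ^2*e2+d1*θ^3*e

lemma θ_ind (d0 d1 d2 d3 d4 : ℚ) (h : (d0:LL) + d1*θ + d2*θ^2 + d3*θ^3 + d4*θ^4 = 0) :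
    d0 = 0 ∧ d1 = 0 ∧ d2 = 0 ∧ d3 = 0 ∧ d4 = 0 := by
  have e := θφ
  have e2 : θ^2*φL^2 = 1 := by rw [← mul_pow, θφ, one_pow]
  have e3 : θ^3*φL^3 = 1 := by rw [← mul_pow, θφ, one_pow]
  have e4 : θ^4*φL^4 = 1 := by rw [← mul_pow, θφ, one_pow]
  have := φ_ind d4 d3 d2 d1 d0 (by
    linear_combination φL^4*h - d4*e4-d3*φL*e3-d2*φL^2*e2-d1*φL^3*e)
  tauto

lemma θ5 : 8*θ^5-7*θ^4+6*θ^3-θ^2+2*θ+1 = 0 := by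
  have e := θφ
  have e2 : θ^2*φL^2 = 1 := by rw [← mul_pow, θφ, one_pow]
  have e3 : θ^3*φL^3 = 1 := by rw [← mul_pow, θφ, one_pow]
  have e4 : θ^4*φL^4 = 1 := by rw [← mul_pow, θφ, one_pow]
  have e5 : θ^5*φL^5 = 1 := by rw [← mul_pow, θφ, one_pow]
  linear_combination θ^5*φL5 - e5-2*θ*e4+θ^2*e3-6*θ^3*e2+7*θ^4*e

lemma θ_ind5 (e0 e1 e2 e3 e4 e5 : ℚ) (h : (e0:LL) + e1*θ + e2*θ^2 + e3*θ^3 + e4*θ^4+e5*θ^5 = 0) :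
    ∃ q : ℚ, e0 = q ∧ e1 = 2*q ∧ e2 = -q ∧ e3 = 6*q ∧ e4 = -7*q ∧ e5 = 8*q := by
  have := θ_ind (e0-e5/8) (e1-2*(e5/8)) (e2+e5/8) (e3-6*(e5/8)) (e4+7*(e5/8)) (by
    push_cast
    linear_combination h - e5/8*θ5)
  refine ⟨e5/8, ?_, ?_, ?_, ?_, ?_, ?_⟩ <;> linarith

lemma θ_ind6 (e0 e1 e2 e3 e4 e5 e6 : ℚ)
    (h : (e0:LL) + e1*θ + e2*θ^2 + e3*θ^3 + e4*θ^4+e5*θ^5+e6*θ^6 = 0) :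
    ∃ m0 m1 : ℚ, e0 = m0 ∧ e1 = 2*m0 + m1 ∧ e2 = -m0 + 2*m1 ∧ e3 = 6*m0 - m1 ∧ e4 = -7*m0 + 6*m1 ∧
      e5 = 8*m0 -7*m1 ∧ e6 = 8*m1 := by
  have := θ_ind5 e0 (e1-(e6/8)) (e2-2*(e6/8)) (e3+(e6/8)) (e4-6*(e6/8)) (e5+7*(e6/8)) (by
    push_cast
    linear_combination h - e6/8*θ*θ5)
  obtain ⟨q, h0, h1, h2, h3, h4, h5⟩ := this
  refine ⟨q, e6/8, ?_, ?_, ?_, ?_, ?_, ?_, ?_⟩ <;> linarith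

lemma two_three (a b c a' b' c' : ℚ) : ∃ x y z : ℚ, (x ≠ 0 ∨ y ≠ 0 ∨ z ≠ 0) ∧ a*x+b*y+c*z = 0 ∧ a'*x+b'*y+c'*z = 0 := by
  have h : LinearMap.ker (Matrix.toLin' !![a, b, c; a', b', c']) ≠ ⊥ :=
    LinearMap.ker_ne_bot_of_finrank_lt (by simp)
  obtain ⟨v, hv, hv0⟩ := Submodule.exists_mem_ne_zero_of_ne_bot h
  refine ⟨v 0, v 1, v 2, ?_, ?_⟩
  · by_contra hc
    push Not at hc
    apply hv0
    ext i; fin_cases i <;> simp [hc]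
  · rw [LinearMap.mem_ker, Matrix.toLin'_apply] at hv
    have e0 := congrFun hv 0
    have e1 := congrFun hv 1
    simp [Matrix.mulVec, dotProduct, Fin.sum_univ_three] at e0 e1
    exact ⟨e0, e1⟩
end

open Polynomial NumberField
noncomputable section

lemma half_t (c : LL) (ε : ℚ) : ∃ t0 t1 t2 b0 b1 b2 : ℚ, (t0 ≠ 0 ∨ t1 ≠ 0 ∨ t2 ≠ 0) ∧
    (b0:LL)+b1*θ+b2*θ^2+(ε*t2:ℚ)*θ^3 = c*(t0+t1*θ+t2*θ^2) := by
  obtain ⟨d0, d1, d2, d3, d4, rfl⟩ := θ_surj c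
  -- coefficients of θ^4 and θ^3
  obtain ⟨t0, t1, t2, ht, h4, h3⟩ := two_three d4 (d3+7/8*d4) (d2-6/8*d4+7/8*(d3+7/8*d4))
    d3 (d2-6/8*d4) (d1+d4/8-6/8*(d3+7/8*d4)-ε)
  refine ⟨t0, t1, t2, d0*t0-(d4*t1+d3*t2+7/8*(d4*t2))/8, d0*t1+d1*t0-d4*t2/8-2/8*(d4*t1+d3*t2+7/8*(d4*t2)),
    d0*t2+d1*t1+d2*t0-2/8*(d4*t2)+(d4*t1+d3*t2+7/8*(d4*t2))/8, ht, ?_⟩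
  have h4' := congrArg (Rat.cast : ℚ → LL) h4
  have h3' := congrArg (Rat.cast : ℚ → LL) h3
  push_cast at h4' h3' ⊢
  linear_combination (-θ^4)*h4' - θ^3*h3' - (d4*t2/8*θ+(d4*t1+d3*t2+7/8*(d4*t2))/8)*θ5

/-- `u² ≡ 0 mod a` forces `u = 0` when the discriminant is nonzero -/
lemma sq_mod (s p α β : ℚ) (hd : s^2 ≠ 4*p) (h1 : α*(α*s+2*β) = 0) (h0 : β^2 - p*α^2 = 0) : α = 0 ∧ β = 0 := by
  have hα : α = 0 := by
    by_contra hα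
    have h2 : α*s+2*β = 0 := (mul_eq_zero.mp h1).resolve_left hα
    apply hd
    have : α^2*(s^2-4*p) = 0 := by linear_combination 4*h0 + (α*s-2*β)*h2
    have := (mul_eq_zero.mp this).resolve_left (pow_ne_zero 2 hα)
    linarith
  subst hα
  exact ⟨rfl, by simpa using h0⟩

/-- reductions mod `a = x² - s x + p` -/
lemma div_b (s p b1 b0 u1 u0 : ℚ) (hX : b0^2+s*b0*b1+p*b1^2 ≠ 0) :
    ∃ α β : ℚ, u1 = α*b0+β*b1+α*s*b1 ∧ u0 = β*b0-α*p*b1 := by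
  refine ⟨(u1*b0-u0*b1)/(b0^2+s*b0*b1+p*b1^2), (u0*(b0+b1*s)+u1*b1*p)/(b0^2+s*b0*b1+p*b1^2), ?_, ?_⟩
  · generalize hY : b0^2+s*b0*b1+p*b1^2 = Y at hX ⊢
    field_simp
    rw [← hY]; ring
  · generalize hY : b0^2+s*b0*b1+p*b1^2 = Y at hX ⊢
    field_simp
    rw [← hY]; ring

lemma unit_b (s p b1 b0 r1 r0 : ℚ) (hX : b0^2+s*b0*b1+p*b1^2 ≠ 0)
    (h1 : r1*b0+r0*b1+r1*s*b1 = 0) (h0 : r0*b0-r1*p*b1 = 0) : r1 = 0 ∧ r0 = 0 := by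
  constructor
  · apply (mul_eq_zero.mp (_ : (b0^2+s*b0*b1+p*b1^2) * r1 = 0)).resolve_left hX
    linear_combination b0*h1-b1*h0
  · apply (mul_eq_zero.mp (_ : (b0^2+s*b0*b1+p*b1^2) * r0 = 0)).resolve_left hX
    linear_combination (b0+b1*s)*h0+b1*p*h1

/-- data for one sign -/
def Half (s p b1 b0 q t0 t1 t2 c0 c1 c2 c3 α β : ℚ) : Prop :=
  (t0 ≠ 0 ∨ t1 ≠ 0 ∨ t2 ≠ 0) ∧
  c0^2-p*t0^2 = q ∧
  2*c0*c1-(2*p*t0*t1-s*t0^2) = 2*q ∧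
  c1^2+2*c0*c2-(t0^2-2*s*t0*t1+p*(t1^2+2*t0*t2)) = -q ∧
  2*c0*c3+2*c1*c2-(2*t0*t1-s*(t1^2+2*t0*t2)+2*p*t1*t2) = 6*q ∧
  c2^2+2*c1*c3-(t1^2+2*t0*t2-2*s*t1*t2+p*t2^2) = -7*q ∧
  2*c2*c3-(2*t1*t2-s*t2^2) = 8*q ∧
  c1 + s*c2+(s^2-p)*c3 = α*b0+β*b1+α*s*b1 ∧ c0 - p*c2 - s*p*c3 = β*b0-α*p*b1

lemma half_one (s p b1 b0 : ℚ) (hM : MC s p b1 b0) (c : LL) (hc : c^2 = θ^2-s*θ+p) (ε : ℚ) (hε : ε^2 = 1) :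
    ∃ q t0 t1 t2 c0 c1 c2 α β : ℚ, Half s p b1 b0 q t0 t1 t2 c0 c1 c2 (ε*t2) α β ∧
    (c0:LL)+c1*θ+c2*θ^2+(ε*t2:ℚ)*θ^3 = c*(t0+t1*θ+t2*θ^2) := by
  obtain ⟨t0, t1, t2, c0, c1, c2, ht, h⟩ := half_t c ε
  generalize hc3 : ε*t2 = c3 at h ⊢
  have h6 : c3^2 = t2^2 := by rw [← hc3, mul_pow, hε, one_mul]
  obtain ⟨α, β, h7, h8⟩ := div_b s p b1 b0 (c1 + s*c2+(s^2-p)*c3) (c0 - p*c2 - s*p*c3) (MC_X s p b1 b0 hM)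
  obtain ⟨q, e0, e1, e2, e3, e4, e5⟩ := θ_ind5 (c0^2-p*t0^2) (2*c0*c1-(2*p*t0*t1-s*t0^2))
    (c1^2+2*c0*c2-(t0^2-2*s*t0*t1+p*(t1^2+2*t0*t2)))
    (2*c0*c3+2*c1*c2-(2*t0*t1-s*(t1^2+2*t0*t2)+2*p*t1*t2))
    (c2^2+2*c1*c3-(t1^2+2*t0*t2-2*s*t1*t2+p*t2^2))
    (2*c2*c3-(2*t1*t2-s*t2^2)) (by
      have h6' := congrArg (Rat.cast : ℚ → LL) h6
      push_cast at h6' ⊢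
      linear_combination (c0+c1*θ+c2*θ^2+c3*θ^3+c*(t0+t1*θ+t2*θ^2))*h + (t0+t1*θ+t2*θ^2)^2*hc - θ^6*h6')
  refine ⟨q, t0, t1, t2, c0, c1, c2, α, β, ?_, by rw [hc3]; exact h⟩
  rw [hc3]
  exact ⟨ht, e0, e1, e2, e3, e4, e5, h7, h8⟩

/-- R² = q -/
lemma half_R {s p b1 b0 q t0 t1 t2 c0 c1 c2 c3 α β : ℚ} (hM : MC s p b1 b0) (h6 : c3^2 = t2^2)
    (h : Half s p b1 b0 q t0 t1 t2 c0 c1 c2 c3 α β) : α*(α*s+2*β) = 0 ∧ β^2-p*α^2 = q := by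
  obtain ⟨ht, e0, e1, e2, e3, e4, e5, h7, h8⟩ := h
  have hX := MC_X s p b1 b0 hM
  rw [MC_iff] at hM
  obtain ⟨g1, g0⟩ := hM
  -- c(x)² ≡ q b² mod a
  have k1 : 2*(c0 - p*c2 - s*p*c3)*(c1 + s*c2+(s^2-p)*c3)+s*(c1 + s*c2+(s^2-p)*c3)^2 = q*(2*b0*b1+s*b1^2) := by
    rw [g1]
    linear_combination e1 + s*e2+(s^2-p)*e3+(s^3-2*s*p)*e4+(s^4-3*s^2*p+p^2)*e5+(s^5-4*s^3*p+3*s*p^2)*h6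
  have k0 : (c0 - p*c2 - s*p*c3)^2-p*(c1 + s*c2+(s^2-p)*c3)^2 = q*(b0^2-p*b1^2) := by
    rw [g0]
    linear_combination e0-p*(e2+s*e3+(s^2-p)*e4+(s^3-2*s*p)*e5+(s^4-3*s^2*p+p^2)*h6)
  rw [h7, h8] at k1 k0
  have := unit_b s p (2*b0*b1+s*b1^2) (b0^2-p*b1^2) (α*(α*s+2*β)) (β^2-p*α^2-q) (by
    have : (b0^2-p*b1^2)^2+s*(b0^2-p*b1^2)*(2*b0*b1+s*b1^2)+p*(2*b0*b1+s*b1^2)^2 = (b0^2+s*b0*b1+p*b1^2)^2 := by ring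
    rw [this]; exact pow_ne_zero 2 hX) (by linear_combination k1) (by linear_combination k0)
  exact ⟨this.1, by linarith [this.2]⟩

lemma half_q {s p b1 b0 q t0 t1 t2 c0 c1 c2 c3 α β : ℚ} (hM : MC s p b1 b0) (h6 : c3^2 = t2^2) (hd : s^2 ≠ 4*p)
    (h : Half s p b1 b0 q t0 t1 t2 c0 c1 c2 c3 α β) : q ≠ 0 ∧ t2 ≠ 0 := by
  have hq : q ≠ 0 := by
    rintro rfl
    obtain ⟨hR1, hR0⟩ := half_R hM h6 h
    obtain ⟨rfl, rfl⟩ := sq_mod s p α β hd hR1 hR0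
    obtain ⟨ht, e0, e1, e2, e3, e4, e5, h7, h8⟩ := h
    -- c = a*(c3 x + d)
    obtain ⟨d, hdd⟩ : ∃ d, c2 = d - s*c3 := ⟨c2+s*c3, by ring⟩
    have hc1 : c1 = p*c3 - s*d := by rw [hdd] at h7; linear_combination h7
    have hc0 : c0 = p*d := by rw [hdd] at h8; linear_combination h8
    subst hdd hc1 hc0
    have g4 : c3^2-t2^2 = 0 := by linear_combination h6
    have g3 : 2*c3*d-s*c3^2-2*t1*t2 = 0 := by linear_combination e5 + s*g4
    have g2 : d^2-2*s*c3*d+p*c3^2-t1^2-2*t0*t2 = 0 := by linear_combination e4 + s*g3-p*g4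
    have g1 : -s*d^2+2*p*c3*d-2*t0*t1 = 0 := by linear_combination e3 + s*g2 -p*g3
    have g0 : p*d^2-t0^2 = 0 := by linear_combination e2 + s*g1 - p*g2
    obtain ⟨r1, r0⟩ := sq_mod s p (t1+s*t2) (t0-p*t2) hd
      (by linear_combination -(g1+s*g2+(s^2-p)*g3+(s^3-2*s*p)*g4))
      (by linear_combination -(g0-p*g2-p*s*g3-p*(s^2-p)*g4))
    have z1 : t1 = -s*t2 := by linarith
    have z0 : t0 = p*t2 := by linarith
    subst z1 z0
    have h1 : 2*c3*d+s*t2^2 = 0 := by linear_combination g3+s*g4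
    have h0 : d^2-p*t2^2 = 0 := by linear_combination g2+s*h1-p*g4
    obtain ⟨rfl, rfl⟩ := sq_mod s p c3 d hd (by linear_combination h1+s*g4) (by linear_combination h0-p*g4)
    have : t2 = 0 := by simpa using g4
    subst this
    simp at ht
  refine ⟨hq, ?_⟩
  rintro rfl
  have : c3 = 0 := by simpa using h6
  subst this
  obtain ⟨ht, e0, e1, e2, e3, e4, e5, h7, h8⟩ := h
  apply hq; linarith

lemma half_sgn (s p b1 b0 : ℚ) (hM : MC s p b1 b0) (hd : s^2 ≠ 4*p) :
    ∃ q t0 t1 t2 c0 c1 c2 c3 β : ℚ, Half s p b1 b0 q t0 t1 t2 c0 c1 c2 c3 0 β ∧ c3^2 = t2^2 := by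
  obtain ⟨c, hc⟩ := A_II s p b1 b0 hM
  have hc' : (θ*c)^2 = θ^2-s*θ+p := by
    have e := θφ
    have e2 : θ^2*φL^2 = 1 := by rw [← mul_pow, θφ, one_pow]
    linear_combination -θ^2*hc - s*θ*e+p*e2
  obtain ⟨q, t0, t1, t2, c0, c1, c2, α, β, H, h⟩ := half_one s p b1 b0 hM (θ*c) hc' 1 (by norm_num)
  obtain ⟨q', t0', t1', t2', c0', c1', c2', α', β', H', h'⟩ := half_one s p b1 b0 hM (θ*c) hc' (-1) (by norm_num)
  have k6 : (1*t2)^2 = t2^2 := by ring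
  have k6' : (-1*t2')^2 = t2'^2 := by ring
  by_cases hα : α = 0
  · subst hα
    exact ⟨q, t0, t1, t2, c0, c1, c2, _, β, H, k6⟩
  by_cases hα' : α' = 0
  · subst hα'
    exact ⟨q', t0', t1', t2', c0', c1', c2', _, β', H', k6'⟩
  exfalso
  have ht2 := (half_q hM k6 hd H).2
  have ht2' := (half_q hM k6' hd H').2
  have r := (mul_eq_zero.mp (half_R hM k6 H).1).resolve_left hα
  have r' := (mul_eq_zero.mp (half_R hM k6' H').1).resolve_left hα'
  obtain ⟨-, -, -, -, -, -, -, h7, h8⟩ := H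
  obtain ⟨-, -, -, -, -, -, -, h7', h8'⟩ := H'
  generalize hc3 : 1*t2 = c3 at *
  generalize hc3' : -1*t2' = c3' at *
  obtain ⟨m0, m1, e0, e1, e2, e3, e4, e5, e6⟩ := θ_ind6
    (c0*c0'-p*t0*t0')
    (c0*c1'+c1*c0'-(p*(t0*t1'+t1*t0')-s*(t0*t0')))
    (c0*c2'+c1*c1'+c2*c0'-(p*(t0*t2'+t1*t1'+t2*t0')-s*(t0*t1'+t1*t0')+t0*t0'))
    (c0*c3'+c1*c2'+c2*c1'+c3*c0'-(p*(t1*t2'+t2*t1')-s*(t0*t2'+t1*t1'+t2*t0')+(t0*t1'+t1*t0')))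
    (c1*c3'+c2*c2'+c3*c1'-(p*(t2*t2')-s*(t1*t2'+t2*t1')+(t0*t2'+t1*t1'+t2*t0')))
    (c2*c3'+c3*c2'-(-s*(t2*t2')+(t1*t2'+t2*t1')))
    (c3*c3'-t2*t2') (by
      push_cast
      linear_combination (c0'+c1'*θ+c2'*θ^2+c3'*θ^3)*h + θ*c*(t0+t1*θ+t2*θ^2)*h' + (t0+t1*θ+t2*θ^2)*(t0'+t1'*θ+t2'*θ^2)*hc')
  have hm1 : m1 ≠ 0 := by
    rintro rfl
    have : t2*t2' = 0 := by rw [← hc3, ← hc3'] at e6; linarith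
    rcases mul_eq_zero.mp this with h | h <;> contradiction
  have hX := MC_X s p b1 b0 hM
  obtain ⟨g1, g0⟩ := (MC_iff s p b1 b0).mp hM
  -- product mod a
  set u1 := c1 + s*c2+(s^2-p)*c3 with hu1
  set u0 := c0 - p*c2 - s*p*c3 with hu0
  set u1' := c1' + s*c2'+(s^2-p)*c3' with hu1'
  set u0' := c0' - p*c2' - s*p*c3' with hu0'
  have k1 : u0*u1'+u1*u0'+s*u1*u1' = m1*(b0^2-p*b1^2)+m0*(2*b0*b1+s*b1^2)+m1*s*(2*b0*b1+s*b1^2) := by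
    rw [g1, g0, hu1, hu0, hu1', hu0']
    linear_combination e1 + s*e2+(s^2-p)*e3+(s^3-2*s*p)*e4+(s^4-3*s^2*p+p^2)*e5+(s^5-4*s^3*p+3*s*p^2)*e6
  have k0 : u0*u0'-p*u1*u1' = m0*(b0^2-p*b1^2)-p*m1*(2*b0*b1+s*b1^2) := by
    rw [g1, g0, hu1, hu0, hu1', hu0']
    linear_combination e0-p*(e2+s*e3+(s^2-p)*e4+(s^3-2*s*p)*e5+(s^4-3*s^2*p+p^2)*e6)
  rw [h7, h8, h7', h8'] at k1 k0
  have := unit_b s p (2*b0*b1+s*b1^2) (b0^2-p*b1^2) (α*β'+α'*β+s*α*α'-m1) (β*β'-p*α*α'-m0) (by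
    have : (b0^2-p*b1^2)^2+s*(b0^2-p*b1^2)*(2*b0*b1+s*b1^2)+p*(2*b0*b1+s*b1^2)^2 = (b0^2+s*b0*b1+p*b1^2)^2 := by ring
    rw [this]; exact pow_ne_zero 2 hX) (by linear_combination k1) (by linear_combination k0)
  apply hm1
  linear_combination -this.1 + 1/2*α'*r + 1/2*α*r'

/-- doubling data: `Q = (x² - t1 x + t0, s1 x + s0)`, `l = l1 x + l0`, `m = 8 x + m0`. -/
def DD (t1 t0 s1 s0 l1 l0 m0 : ℚ) : Prop := MC t1 t0 s1 s0 ∧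
  2*s1*l1+m0-8*t1 = -7+8*t1 ∧
  2*s1*l0+2*s0*l1-t1*m0+8*t0 = 6+t1*(-7+8*t1)-8*t0 ∧
  2*s0*l0+m0*t0 = -1-s1^2+t1*(6+t1*(-7+8*t1)-8*t0)-t0*(-7+8*t1)

lemma DD_of (t1 t0 s1 s0 l1 l0 m0 : ℚ)
   (h0 : s0^2 + 2*s0*t0*l0 + m0*t0^2 = 1)
   (h1 : 2*s0*s1 + 2*(s0*t0*l1 + s0*(-t1)*l0+s1*t0*l0) + m0*(-2*t0*t1)+8*t0^2 = 2)
   (h2 : s1^2 + 2*(s0*(-t1)*l1+s0*l0+s1*t0*l1+s1*(-t1)*l0)+m0*(t1^2+2*t0)+8*(-2*t0*t1) = -1)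
   (h3 : 2*(s0*l1+s1*(-t1)*l1+s1*l0)+m0*(-2*t1)+8*(t1^2+2*t0) = 6)
   (h4 : 2*s1*l1+m0+8*(-2*t1) = -7) : DD t1 t0 s1 s0 l1 l0 m0 := by
  have k2 : 2*s1*l1+m0-8*t1 = -7+8*t1 := by linear_combination h4
  have k1 : 2*s1*l0+2*s0*l1-t1*m0+8*t0 = 6+t1*(-7+8*t1)-8*t0 := by linear_combination h3+t1*k2
  have k0 : 2*s0*l0+m0*t0 = -1-s1^2+t1*(6+t1*(-7+8*t1)-8*t0)-t0*(-7+8*t1) := by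
    linear_combination h2+t1*k1-t0*k2
  refine ⟨?_, k2, k1, k0⟩
  rw [MC_iff]
  constructor
  · linear_combination h1 + t1*k0-t0*k1
  · linear_combination h0-t0*k0

theorem half_II (s p b1 b0 : ℚ) (hM : MC s p b1 b0) (hd : s^2 ≠ 4*p) :
    ∃ t1 t0 s1 s0 l1 l0 m0 : ℚ, l1 ≠ 0 ∧ DD t1 t0 s1 s0 l1 l0 m0 ∧ l1^2*s = 8-2*l0*l1 ∧ l1^2*p = l0^2-m0 ∧
    b1 = (s1+t0*l1-t1*l0)+s*(l0-t1*l1)+(s^2-p)*l1 := by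
  obtain ⟨q, t0, t1, t2, c0, c1, c2, c3, β, H, h6⟩ := half_sgn s p b1 b0 hM hd
  obtain ⟨hq, ht2⟩ := half_q hM h6 hd H
  have hqβ := (half_R hM h6 H).2
  have hβ : β ≠ 0 := by rintro rfl; apply hq; rw [← hqβ]; ring
  obtain ⟨-, e0, e1, e2, e3, e4, e5, h7, h8⟩ := H
  have hc3 : c3 ≠ 0 := by
    rintro rfl
    exact ht2 (by simpa using h6.symm)
  obtain ⟨B0, rfl⟩ : ∃ B, c0 = β*B := ⟨c0/β, by field_simp⟩
  obtain ⟨B1, rfl⟩ : ∃ B, c1 = β*B := ⟨c1/β, by field_simp⟩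
  obtain ⟨B2, rfl⟩ : ∃ B, c2 = β*B := ⟨c2/β, by field_simp⟩
  obtain ⟨B3, rfl⟩ : ∃ B, c3 = β*B := ⟨c3/β, by field_simp⟩
  obtain ⟨v0, rfl⟩ : ∃ v, t0 = t2*v := ⟨t0/t2, by field_simp⟩
  obtain ⟨v1, rfl⟩ : ∃ v, t1 = -t2*v := ⟨-t1/t2, by field_simp⟩
  have hB3 : B3 ≠ 0 := by rintro rfl; simp at hc3
  have hβ2 : β^2 ≠ 0 := pow_ne_zero 2 hβ
  obtain rfl : q = β^2 := by rw [← hqβ]; ring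
  have hb1 : b1 = B1+s*B2+(s^2-p)*B3 := by
    apply mul_left_cancel₀ hβ; linear_combination -h7
  have f0 : B0^2-p*(B3^2*v0^2) = 1 := by
    apply mul_left_cancel₀ hβ2; linear_combination e0 -p*v0^2*h6
  have f1 : 2*B0*B1-B3^2*(-2*p*v0*v1-s*v0^2) = 2 := by
    apply mul_left_cancel₀ hβ2; linear_combination e1-(-2*p*v0*v1-s*v0^2)*h6
  have f2 : B1^2+2*B0*B2-B3^2*(v0^2+2*s*v0*v1+p*(v1^2+2*v0)) = -1 := by
    apply mul_left_cancel₀ hβ2; linear_combination e2 -(v0^2+2*s*v0*v1+p*(v1^2+2*v0))*h6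
  have f3 : 2*B0*B3+2*B1*B2-B3^2*(-2*v0*v1-s*(v1^2+2*v0)-2*p*v1) = 6 := by
    apply mul_left_cancel₀ hβ2; linear_combination e3 -(-2*v0*v1-s*(v1^2+2*v0)-2*p*v1)*h6
  have f4 : B2^2+2*B1*B3-B3^2*(v1^2+2*v0+2*s*v1+p) = -7 := by
    apply mul_left_cancel₀ hβ2; linear_combination e4 -(v1^2+2*v0+2*s*v1+p)*h6
  have f5 : 2*B2*B3-B3^2*(-2*v1-s) = 8 := by
    apply mul_left_cancel₀ hβ2; linear_combination e5 -(-2*v1-s)*h6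
  obtain ⟨l0, hl0⟩ : ∃ l0, B2 = l0 - v1*B3 := ⟨B2+v1*B3, by ring⟩
  obtain ⟨s1, hs1⟩ : ∃ s1, B1 = s1 + v0*B3-v1*l0 := ⟨B1-v0*B3+v1*l0, by ring⟩
  obtain ⟨s0, hs0⟩ : ∃ s0, B0 = s0 + v0*l0 := ⟨B0-v0*l0, by ring⟩
  subst hl0 hs1 hs0
  have a1 : B3^2*s = 8-2*l0*B3 := by linear_combination f5
  obtain ⟨m0, hm⟩ : ∃ m0, B3^2*p = l0^2-m0 := ⟨l0^2-B3^2*p, by ring⟩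
  refine ⟨v1, v0, s1, s0, B3, l0, m0, hB3, ?_, a1, hm, hb1⟩
  apply DD_of
  · linear_combination f0 + v0^2*hm
  · linear_combination f1 - 2*v0*v1*hm-v0^2*a1
  · linear_combination f2 + (v1^2+2*v0)*hm+2*v0*v1*a1
  · linear_combination f3 -2*v1*hm-(v1^2+2*v0)*a1
  · linear_combination f4 + hm+2*v1*a1
end

open Polynomial NumberField
noncomputable section

def rL : LL := 2-wL-wL^2+wL^3
lemma rL2 : rL^2 = -2*φL := by
  rw [φL_eq]; unfold rL; linear_combination (wL-2)*wL_eq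
lemma rL_ne : rL ≠ 0 := by
  intro h
  have := rL2
  rw [h] at this
  apply φL_ne
  linear_combination this/2

lemma A_I (x y : ℚ) (h : y^2 = 8*x^5-7*x^4+6*x^3-x^2+2*x+1) : ∃ c : LL, c^2 = 8*(x-θ) := by
  have h0 : ∃ c : LL, 1 - (x:LL)*φL = c^2 := by
    by_cases hx : x = 0
    · exact ⟨1, by simp [hx]⟩
    · obtain ⟨c, hc⟩ := A_II x 0 ((y-1)/x) 1 (by
        rw [MC_iff]
        constructor
        · field_simp
          linear_combination h
        · ring)
      exact ⟨c, by rw [← hc]; push_cast; ring⟩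
  obtain ⟨c, hc⟩ := h0
  refine ⟨4*c/rL, ?_⟩
  rw [div_pow, mul_pow, ← hc, rL2, θ]
  have := φL_ne
  field_simp
  ring

theorem half_I (x y : ℚ) (h : y^2 = 8*x^5-7*x^4+6*x^3-x^2+2*x+1) :
    ∃ t1 t0 s1 s0 l0 m0 : ℚ, DD t1 t0 s1 s0 0 l0 m0 ∧ 8*x = l0^2-m0 := by
  obtain ⟨c, hc⟩ := A_I x y h
  obtain ⟨t0, t1, t2, c0, c1, c2, ht, hb⟩ := half_t c 0
  obtain ⟨q, e0, e1, e2, e3, e4, e5⟩ := θ_ind5 (c0^2-8*x*t0^2) (2*c0*c1-8*(2*x*t0*t1-t0^2))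
    (c1^2+2*c0*c2-8*(x*(t1^2+2*t0*t2)-2*t0*t1)) (2*c1*c2-8*(2*x*t1*t2-(t1^2+2*t0*t2)))
    (c2^2-8*(x*t2^2-2*t1*t2)) (8*t2^2) (by
      push_cast at hb ⊢
      linear_combination (c0+c1*θ+c2*θ^2+c*(t0+t1*θ+t2*θ^2))*hb + (t0+t1*θ+t2*θ^2)^2*hc)
  have ht2 : t2 ≠ 0 := by
    rintro rfl
    obtain rfl : q = 0 := by linarith
    have z2 : c2 = 0 := by simpa using e4
    subst z2
    have z1 : t1 = 0 := by simpa using e3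
    subst z1
    have w1 : c1 = 0 := by simpa using e2
    subst w1
    have z0 : t0 = 0 := by simpa using e1
    subst z0
    simp at ht
  obtain rfl : q = t2^2 := by linarith
  have hβ2 : t2^2 ≠ 0 := pow_ne_zero 2 ht2
  obtain ⟨B0, rfl⟩ : ∃ B, c0 = t2*B := ⟨c0/t2, by field_simp⟩
  obtain ⟨B1, rfl⟩ : ∃ B, c1 = t2*B := ⟨c1/t2, by field_simp⟩
  obtain ⟨l0, rfl⟩ : ∃ B, c2 = t2*B := ⟨c2/t2, by field_simp⟩
  obtain ⟨v0, rfl⟩ : ∃ v, t0 = t2*v := ⟨t0/t2, by field_simp⟩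
  obtain ⟨v1, rfl⟩ : ∃ v, t1 = -t2*v := ⟨-t1/t2, by field_simp⟩
  obtain ⟨s1, rfl⟩ : ∃ s1, B1 = s1 -v1*l0 := ⟨B1+v1*l0, by ring⟩
  obtain ⟨s0, rfl⟩ : ∃ s0, B0 = s0 + v0*l0 := ⟨B0-v0*l0, by ring⟩
  refine ⟨v1, v0, s1, s0, l0, l0^2-8*x, ?_, by ring⟩
  apply DD_of <;> apply mul_left_cancel₀ hβ2
  · linear_combination e0
  · linear_combination e1
  · linear_combination e2
  · linear_combination e3
  · linear_combination e4
end

open Polynomial NumberField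
noncomputable section

section
variable {R : Type*} [CommRing R]
def dl1 (a b c d : R) : R := (-7)*a^4+16*a^3*b+(-8)*a^3*c+14*a^3*d+(-4)*a^2*b^2+4*a^2*b*c+(-16)*a^2*b*d+36*a^2*c^2+(-8)*a^2*c*d+(-7)*a^2*d^2+(-16)*a*b^2*c+(-4)*a*b^2*d+(-16)*a*b*c^2+12*a*b*c*d+(-16)*a*c^3+(-12)*a*c^2*d+4*a*d^3+4*b^4+8*b^3*c+(-4)*b^2*c^2+24*b*c^3+(-8)*b*c*d^2+(-28)*c^4+32*c^3*d
def dl2 (a b c d : R) : R := (-5)*a^4+11*a^3*b+23*a^3*c+7*a^3*d+(-7)*a^2*b^2+(-35)*a^2*b*c+7*a^2*b*d+7*a^2*c^2+(-43)*a^2*c*d+2*a^2*d^2+10*a*b^3+(-8)*a*b^2*c+(-3)*a*b^2*d+(-20)*a*b*c^2+37*a*b*c*d+(-8)*a*b*d^2+50*a*c^3+(-37)*a*c^2*d+18*a*c*d^2+8*b^3*c+4*b^3*d+8*b^2*c^2+(-4)*b^2*c*d+36*b*c^2*d+(-14)*b*c*d^2+4*b*d^3+(-24)*c^4+8*c^2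*d^2
def dl3 (a b c d : R) : R := 3*a^3*b+(-11)*a^3*c+7*a^3*d+(-9)*a^2*b^2+9*a^2*b*c+(-7)*a^2*b*d+10*a^2*c^2+7*a^2*c*d+(-3)*a^2*d^2+6*a*b^3+(-16)*a*b^2*c+7*a*b^2*d+8*a*b*c^2+(-5)*a*b*c*d+(-2)*a*b*d^2+(-22)*a*c^3+(-1)*a*c^2*d+(-6)*a*c*d^2+(-4)*b^3*d+12*b^2*c^2+(-4)*b^2*c*d+16*b*c^3+(-4)*c^4+12*c^3*d+(-7)*c^2*d^2+4*c*d^3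
def dl4 (a b c d : R) : R := (-4)*a^4+4*a^3*b+(-8)*a^3*c+14*a^3*d+(-4)*a^2*b^2+16*a^2*b*c+(-24)*a^2*b*d+30*a^2*c^2+8*a^2*c*d+(-7)*a^2*d^2+4*a*b^2*d+(-8)*a*b*c^2+12*a*b*c*d+4*a*b*d^2+(-24)*a*c^3+(-8)*a*c^2*d+4*b^4+(-8)*b^3*c+20*b^2*c^2+(-16)*b^2*c*d+24*b*c^3+(-24)*b*c^2*d+(-4)*b*c*d^2+(-20)*c^4+24*c^3*d+(-6)*c^2*d^2+1*d^4
def kum (a b c d : R) : R := 1*a^4+(-1)*a^3*b+(-3)*a^3*c+(-1)*a^3*d+2*a^2*b^2+7*a^2*b*c+(-1)*a^2*b*d+(-1)*a^2*c^2+5*a^2*c*d+(-2)*a*b^3+(-4)*a*b^2*c+(-1)*a*b^2*d+4*a*b*c^2+(-3)*a*b*c*d+(-6)*a*c^3+7*a*c^2*d+(-4)*a*c*d^2+1*b^2*d^2+(-4)*b*c^2*d+4*c^4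
end

/-- polynomial quantities attached to `Q` -/
def S01 (t r q : ℚ) : ℚ := (-8)*t^2*r+7*t*r+(-2)*t*q+1*t+4*r^2+(-3)*r+1
def S00 (t r q : ℚ) : ℚ := 8*t*r^2+(-7)*r^2+4*r*q+(-2)*r+1
def ww (t r q : ℚ) : ℚ := 8*t^3+(-7)*t^2+(-8)*t*r+6*t+4*q+(-3)
def ee1 (t r : ℚ) : ℚ := 24*t^2+(-14)*t+(-16)*r+6
def ee0 (t r q : ℚ) : ℚ := (-24)*t*r+14*r+(-4)*q+2
def NN (t r q : ℚ) : ℚ := (-2)*t^2*q+1*t^2+4*t*r^2+3*t*r+1*t+(-7)*r^2+8*r*q+(-5)*r+1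
def M10 (t r q : ℚ) : ℚ := 16*t^2*r*q+(-8)*t^2*r+24*t^2+(-32)*t*r^3+(-24)*t*r^2+24*t*r+(-8)*t*q^2+8*t*q+(-16)*t+56*r^3+(-48)*r^2*q+24*r^2+12*r*q+(-36)*r+4*q+4
def M11 (t r q : ℚ) : ℚ := (-16)*t^3*q+8*t^3+32*t^2*r^2+24*t^2*r+24*t^2+(-56)*t*r^2+96*t*r*q+(-72)*t*r+12*t*q+(-20)*t+(-64)*r^3+72*r^2+(-56)*r*q+8*r+16*q^2+(-20)*q+12

lemma hK_kum (t r q : ℚ) : S01 t r q^2 - S00 t r q * ww t r q = 4 * kum 1 t r q := by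
  unfold S01 S00 ww kum; ring

lemma M10_eq (t r q : ℚ) : M10 t r q = ee1 t r * S00 t r q - ee0 t r q * S01 t r q := by
  unfold M10 ee1 ee0 S00 S01; ring
lemma M11_eq (t r q : ℚ) : M11 t r q = ee1 t r * S01 t r q - ee0 t r q * ww t r q := by
  unfold M11 ee1 ee0 ww S01; ring
lemma NN_eq (t r q : ℚ) : NN t r q = S00 t r q + t*S01 t r q + r*ww t r q := by
  unfold NN S01 S00 ww; ring

lemma dblp1 (t r q : ℚ) (hK : kum 1 t r q = 0) : ee1 t r * M10 t r q - ee0 t r q * M11 t r q = 16*dl1 1 t r q := by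
  unfold kum at hK; unfold ee1 ee0 M10 M11 dl1
  linear_combination ((-256)*t+112)*hK

lemma dblp2 (t r q : ℚ) (hK : kum 1 t r q = 0) : 32*NN t r q^2 - 2*(ee0 t r q*M10 t r q+(ee0 t r q*t+ee1 t r*r)*M11 t r q) = 16*dl2 1 t r q := by
  unfold kum at hK; unfold ee1 ee0 M10 M11 dl2 NN
  linear_combination ((-512)*r+96)*hK

lemma dblp3 (t r q : ℚ) (hK : kum 1 t r q = 0) : ee0 t r q^2*S00 t r q+2*ee0 t r q*(ee0 t r q*t+ee1 t r*r)*S01 t r q+(ee0 t r q*t+ee1 t r*r)^2*ww t r q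
    -(4*NN t r q^2*(-7+16*t)-4*NN t r q*M11 t r q) = 16*dl3 1 t r q := by
  unfold kum at hK; unfold ee1 ee0 M11 dl3 NN S00 S01 ww
  linear_combination ((-128)*q+80)*hK

def Gp (t r N D l11 l01 l00 m10 k3 : ℚ) : ℚ :=
  -2*(2*N*m10+r*l01)*(8*D-l01-t*l11)+k3*(l00-2*(8*D-l01)*t+t^2*l11)+l11^2*r^2+7*k3*D

lemma dblp4 (t r q : ℚ) (hK : kum 1 t r q = 0) :
    (Gp t r (NN t r q) (4*NN t r q^2) (16*dl1 1 t r q) (16*NN t r q^2-8*dl2 1 t r q)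
      (16*dl3 1 t r q+4*NN t r q^2*(-7+16*t)-4*NN t r q*M11 t r q) (M10 t r q) (16*dl3 1 t r q)
      + 2*(16*dl1 1 t r q)*(4*NN t r q^2))/4 = 16*dl4 1 t r q*(4*NN t r q^2) := by
  unfold kum at hK; unfold Gp M10 M11 NN dl1 dl2 dl3 dl4
  linear_combination (2048*t^6*q+(-1536)*t^6+(-4096)*t^5*r^2+3072*t^5*r*q+(-1024)*t^5*q^3+1536*t^5*q^2+(-768)*t^5*q+(-384)*t^5+(-6144)*t^4*r^3+4096*t^4*r^2*q^2+(-5120)*t^4*r^2*q+(-256)*t^4*r^2+3072*t^4*r*q^2+(-16384)*t^4*r*q+10496*t^4*r+(-512)*t^4*q^2+(-6400)*t^4*q+5376*t^4+(-4096)*t^3*r^4*q+4096*t^3*r^4+(-3072)*t^3*r^3*q+28160*t^3*r^3+(-7168)*t^3*r^2*q^2+(-8448)*t^3*r^2*q+9600*t^3*r^2+7168*t^3*r*q^3+(-10240)*t^3*r*q^2+11776*t^3*r*q+(-15616)*t^3*r+(-7296)*t^3*q^2+18496*t^3*q+(-8384)*t^3+(-6144)*t^2*r^5+14336*t^2*r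^4*q+21760*t^2*r^4+(-14336)*t^2*r^3*q^2+26112*t^2*r^3*q+(-15616)*t^2*r^3+(-19968)*t^2*r^2*q^2+65792*t^2*r^2*q+(-15744)*t^2*r^2+1792*t^2*r*q^3+(-16384)*t^2*r*q^2+(-320)*t^2*r*q+10304*t^2*r+256*t^2*q^4+(-512)*t^2*q^3+7232*t^2*q^2+(-16320)*t^2*q+7296*t^2+(-14848)*t*r^5+15104*t*r^4*q+(-64384)*t*r^4+25088*t*r^3*q^2+4096*t*r^3*q+(-27008)*t*r^3+(-17408)*t*r^2*q^3+30208*t*r^2*q^2+(-10944)*t*r^2*q+8640*t*r^2+(-768)*t*r*q^3+6144*t*r*q^2+(-320)*t*r*q+(-7232)*t*r+(-1280)*t*q^3+(-4864)*t*q^2+6848*t*q+(-1344)*t+12544*r^6+(-28672)*r^5*q+26112*r^5+16384*r^4*q^2+(-40704)*r^4*q+32128*r^4+21632*r^3*q^2+(-54656)*r^3*q+24320*r^3+(-8960)*r^2*q^3+18432*r^2*q^2+(-640)*r^2*q+1792*r^2+2560*r*q^4+(-5376)*r*q^3+4608*r*q^2+(-7296)*r*q+1664*r+(-1280)*q^3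+4096*q^2+(-1792)*q+128)*hK
end

open Polynomial NumberField
noncomputable section

lemma DD_dbl (t r s1 s0 l1 l0 m0 q : ℚ) (h : DD t r s1 s0 l1 l0 m0)
    (hq : 4*q = s1^2-(8*t*(t^2-r)-7*t^2+6*t-1)+2) :
    kum 1 t r q = 0 ∧ NN t r q ≠ 0 ∧ NN t r q^2*l1^2 = 4*dl1 1 t r q ∧ NN t r q^2*(8-2*l0*l1) = 4*dl2 1 t r q ∧
    NN t r q^2*(l0^2-m0) = 4*dl3 1 t r q ∧
    NN t r q^2*(-2*l1*(s0+r*l0)*(8-l0*l1-t*l1^2)+(l0^2-m0)*(l0^2-2*(8-l0*l1)*t+t^2*l1^2)+l1^4*r^2+7*(l0^2-m0)+2*l1^2)/4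
      = 4*dl4 1 t r q := by
  obtain ⟨hM, k2, k1, k0⟩ := h
  have hX := MC_X _ _ _ _ hM
  obtain ⟨g1, g0⟩ := (MC_iff _ _ _ _).mp hM
  have hw : s1^2 = ww t r q := by unfold ww; linear_combination -hq
  have h01 : s0*s1 = S01 t r q := by
    unfold S01; linear_combination g1/2 - t/2*(-hq)
  have h00 : s0^2 = S00 t r q := by
    unfold S00; linear_combination g0 + r*(-hq)
  have hK : kum 1 t r q = 0 := by
    have := hK_kum t r q
    rw [← h01, ← h00, ← hw] at this
    linear_combination -this/4
  have hN : s0^2+t*s0*s1+r*s1^2 = NN t r q := by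
    rw [NN_eq]; linear_combination h00 + t*h01+r*hw
  rw [hN] at hX
  have p1 := dblp1 t r q hK
  have p2 := dblp2 t r q hK
  have p3 := dblp3 t r q hK
  have p4 := dblp4 t r q hK
  have h10 := M10_eq t r q
  have h11 := M11_eq t r q
  have hm0 : m0 = -7+16*t-2*s1*l1 := by linear_combination k2
  -- linear system
  have A : 2*s1*l0+(2*s0+2*t*s1)*l1 = ee1 t r := by
    unfold ee1; linear_combination k1 + t*k2
  have B : 2*s0*l0-2*r*s1*l1 = ee0 t r q := by
    unfold ee0; linear_combination k0 - r*k2 +hq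
  have C1 : 2*NN t r q*l1 = ee1 t r*s0-ee0 t r q*s1 := by
    rw [← hN]; linear_combination s0*A - s1*B
  have C0 : 2*NN t r q*l0 = ee0 t r q*s0+(ee0 t r q*t+ee1 t r*r)*s1 := by
    rw [← hN]; linear_combination (s0+s1*t)*B+s1*r*A
  have m10 : 2*NN t r q*l1*s0 = M10 t r q := by
    rw [h10]; linear_combination s0*C1 + ee1 t r*h00 - ee0 t r q*h01
  have m11 : 2*NN t r q*l1*s1 = M11 t r q := by
    rw [h11]; linear_combination s1*C1 + ee1 t r*h01 - ee0 t r q*hw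
  generalize NN t r q = N at *
  generalize ee1 t r = e1 at *
  generalize ee0 t r q = e0 at *
  generalize M10 t r q = m10' at *
  generalize M11 t r q = m11' at *
  generalize S00 t r q = S00' at *
  generalize S01 t r q = S01' at *
  generalize ww t r q = w' at *
  have q1 : N^2*l1^2 = 4*dl1 1 t r q := by
    linear_combination p1/4 + N*l1/2*C1 + (e1*m10-e0*m11)/4
  have q2 : N^2*(8-2*l0*l1) = 4*dl2 1 t r q := by
    linear_combination p2/4 - N*l1*C0 - e0/2*m10-(e0*t+e1*r)/2*m11
  have q3 : N^2*(l0^2-m0) = 4*dl3 1 t r q := by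
    rw [hm0]
    linear_combination p3/4 + (2*N*l0+e0*s0+(e0*t+e1*r)*s1)/4*C0 + e0^2/4*h00+e0*(e0*t+e1*r)/2*h01+(e0*t+e1*r)^2/4*hw + N*m11
  refine ⟨hK, hX, q1, q2, q3, ?_⟩
  have hN2 : 4*N^2 ≠ 0 := by positivity
  apply mul_left_cancel₀ hN2
  have e11 : 16*dl1 1 t r q = 4*N^2*l1^2 := by linear_combination -4*q1
  have e01 : 16*N^2-8*dl2 1 t r q = 4*N^2*(l0*l1) := by linear_combination 2*q2
  have e3 : 16*dl3 1 t r q = 4*N^2*(l0^2-m0) := by linear_combination -4*q3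
  have e00 : 4*N^2*(l0^2-m0)+4*N^2*(-7+16*t)-4*N*m11' = 4*N^2*l0^2 := by
    rw [hm0, ← m11]; ring
  rw [e11, e01, e3, e00, ← m10] at p4
  unfold Gp at p4
  linear_combination p4/4

lemma k4_eq (t r s1 s0 l1 l0 m0 s p b1 : ℚ) (h : DD t r s1 s0 l1 l0 m0) (a1 : l1^2*s = 8-2*l0*l1) (a0 : l1^2*p = l0^2-m0)
    (hb1 : b1 = (s1+r*l1-t*l0)+s*(l0-t*l1)+(s^2-p)*l1) :
    l1^2*(b1^2-(8*s*(s^2-p)-7*s^2+6*s-1)) = -2*l1*(s0+r*l0)*(8-l0*l1-t*l1^2)+(l0^2-m0)*(l0^2-2*(8-l0*l1)*t+t^2*l1^2)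
      +l1^4*r^2+7*(l0^2-m0) := by
  obtain ⟨-, k2, k1, k0⟩ := h
  obtain ⟨B2, hB2⟩ : ∃ B2, B2 = l0-t*l1 := ⟨_, rfl⟩
  obtain ⟨B1, hB1⟩ : ∃ B1, B1 = s1+r*l1-t*l0 := ⟨_, rfl⟩
  obtain ⟨B0, hB0⟩ : ∃ B0, B0 = s0+r*l0 := ⟨_, rfl⟩
  have f2 : B1^2+2*B0*B2-l1^2*(r^2+2*s*r*t+p*(t^2+2*r)) = -1 := by
    rw [hB2, hB1, hB0]; linear_combination k0-t*k1+r*k2+(t*t-t^2)*k2 - (t^2+2*r)*a0-2*r*t*a1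
  have f3 : 2*B0*l1+2*B1*B2-l1^2*(-2*r*t-s*(t^2+2*r)-2*p*t) = 6 := by
    rw [hB2, hB1, hB0]; linear_combination k1-t*k2+2*t*a0+(t^2+2*r)*a1
  have f4 : B2^2+2*B1*l1-l1^2*(t^2+2*r+2*s*t+p) = -7 := by
    rw [hB2, hB1]; linear_combination k2 -a0-2*t*a1
  have f5 : 2*B2*l1-l1^2*(-2*t-s) = 8 := by rw [hB2]; linear_combination a1
  have hb : b1 = B1+s*B2+(s^2-p)*l1 := by rw [hB1, hB2, hb1]
  obtain ⟨h0, hh0⟩ : ∃ h0, h0 = B2+l1*s := ⟨_, rfl⟩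
  have E3 : 2*h0*l1-s*l1^2+2*l1^2*t = 8 := by rw [hh0]; linear_combination f5
  have E2 : 2*b1*l1+h0^2-2*s*h0*l1+p*l1^2-l1^2*(t^2+2*r) = -7+8*s := by
    rw [hb, hh0]; rw [hh0] at E3; linear_combination f4 + s*E3
  have E1 : 2*(B0-p*h0)*l1+2*b1*h0+(2*p*h0*l1-s*h0^2)+2*l1^2*t*r = 6+s*(-7+8*s)-8*p := by
    rw [hb, hh0]; rw [hb, hh0] at E2; rw [hh0] at E3; linear_combination f3+s*E2-p*E3
  have E0 : 2*(B0-p*h0)*h0+p*h0^2-l1^2*r^2 = -1-b1^2+s*(6+s*(-7+8*s)-8*p)-p*(-7+8*s) := by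
    rw [hb, hh0]; rw [hb, hh0] at E2 E1; linear_combination f2+s*E1-p*E2
  have hν : l1*h0 = 8-l0*l1-t*l1^2 := by rw [hh0, hB2]; linear_combination a1
  have key : b1^2-(8*s*(s^2-p)-7*s^2+6*s-1) = -2*B0*h0+p*h0^2+l1^2*r^2-8*p*s+7*p := by
    linear_combination E0
  rw [key, ← hB0, ← a0]
  linear_combination (-2*l1*B0 + p*(l1*h0+(8-l0*l1-t*l1^2)))*hν-8*p*a1

/-- rational Kummer points -/
def KP (a b c d : ℚ) : Prop :=
  (a ≠ 0 ∧ ∃ s p b1 b0, MC s p b1 b0 ∧ b = a*s ∧ c = a*p ∧ 4*d = a*(b1^2-(8*s*(s^2-p)-7*s^2+6*s-1)+2)) ∨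
  (a = 0 ∧ b ≠ 0 ∧ ∃ x y, y^2 = 8*x^5-7*x^4+6*x^3-x^2+2*x+1 ∧ c = b*x ∧ d = 2*b*x^2)

lemma KP_smul (u a b c d : ℚ) (hu : u ≠ 0) (h : KP a b c d) : KP (u*a) (u*b) (u*c) (u*d) := by
  rcases h with ⟨ha, s, p, b1, b0, hM, hb, hc, hd⟩ | ⟨ha, hb, x, y, h, hc, hd⟩
  · left
    exact ⟨mul_ne_zero hu ha, s, p, b1, b0, hM, by rw [hb]; ring, by rw [hc]; ring, by linear_combination u*hd⟩
  · right
    exact ⟨by rw [ha]; ring, mul_ne_zero hu hb, x, y, h, by rw [hc]; ring, by rw [hd]; ring⟩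

lemma MC_kum (t r s1 s0 q : ℚ) (hM : MC t r s1 s0) (hq : 4*q = s1^2-(8*t*(t^2-r)-7*t^2+6*t-1)+2) : kum 1 t r q = 0 := by
  obtain ⟨g1, g0⟩ := (MC_iff _ _ _ _).mp hM
  have hw : s1^2 = ww t r q := by unfold ww; linear_combination -hq
  have h01 : s0*s1 = S01 t r q := by
    unfold S01; linear_combination g1/2 - t/2*(-hq)
  have h00 : s0^2 = S00 t r q := by
    unfold S00; linear_combination g0 + r*(-hq)
  have := hK_kum t r q
  rw [← h01, ← h00, ← hw] at this
  linear_combination -this/4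

lemma KP_kum (a b c d : ℚ) (h : KP a b c d) : kum a b c d = 0 := by
  rcases h with ⟨ha, s, p, b1, b0, hM, rfl, rfl, hd⟩ | ⟨rfl, hb, x, y, h, rfl, rfl⟩
  · have := MC_kum s p b1 b0 (d/a) hM (by field_simp; linear_combination hd)
    obtain ⟨q, rfl⟩ : ∃ q, d = a*q := ⟨d/a, by field_simp⟩
    rw [mul_div_cancel_left₀ _ ha] at this
    unfold kum at *
    linear_combination a^4*this
  · unfold kum; ring

lemma f_ne (x y : ℚ) (h : y^2 = 8*x^5-7*x^4+6*x^3-x^2+2*x+1) : y ≠ 0 := by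
  rintro rfl
  by_cases hx : x = 0
  · subst hx; norm_num at h
  have hM : MC x 0 ((0-1)/x) 1 := by
    rw [MC_iff]
    constructor
    · field_simp
      linear_combination h
    · ring
  apply MC_X _ _ _ _ hM
  field_simp
  ring

theorem KP_half (a b c d : ℚ) (h : KP a b c d) : ∃ u a' b' c' d', u ≠ 0 ∧ KP a' b' c' d' ∧
    a = u*dl1 a' b' c' d' ∧ b = u*dl2 a' b' c' d' ∧ c = u*dl3 a' b' c' d' ∧ d = u*dl4 a' b' c' d' := by
  rcases h with ⟨ha, s, p, b1, b0, hM, rfl, rfl, hd⟩ | ⟨rfl, hb, x, y, h, rfl, rfl⟩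
  · by_cases hdisc : s^2 = 4*p
    · obtain ⟨x, rfl⟩ : ∃ x, s = 2*x := ⟨s/2, by ring⟩
      obtain rfl : p = x^2 := by linarith
      obtain ⟨g1, g0⟩ := (MC_iff _ _ _ _).mp hM
      have hy : (b1*x+b0)^2 = 8*x^5-7*x^4+6*x^3-x^2+2*x+1 := by linear_combination x*g1+g0
      have hy0 := f_ne _ _ hy
      generalize hyy : b1*x+b0 = y at *
      have hb0 : b0 = y - b1*x := by linarith
      subst hb0
      have hs : 2*y*b1 = 40*x^4-28*x^3+18*x^2-2*x+2 := by linear_combination g1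
      refine ⟨a/(4*y^2), 0, 1, x, 2*x^2, by positivity, Or.inr ⟨rfl, one_ne_zero, x, y, hy, by ring, by ring⟩, ?_, ?_, ?_, ?_⟩
      · unfold dl1; field_simp; linear_combination 4*hy
      · unfold dl2; field_simp; linear_combination 8*x*hy
      · unfold dl3; field_simp; linear_combination 4*x^2*hy
      · apply mul_left_cancel₀ (by norm_num : (4:ℚ) ≠ 0)
        rw [hd]; unfold dl4; field_simp
        linear_combination (2*y*b1+(40*x^4-28*x^3+18*x^2-2*x+2))/4*hs + (-(8*(2*x)*((2*x)^2-x^2)-7*(2*x)^2+6*(2*x)-1)+2)*hy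
    · obtain ⟨t, r, s1, s0, l1, l0, m0, hl1, hD, a1, a0, hb1⟩ := half_II s p b1 b0 hM hdisc
      have hk := k4_eq t r s1 s0 l1 l0 m0 s p b1 hD a1 a0 hb1
      obtain ⟨q, hq⟩ : ∃ q, 4*q = s1^2-(8*t*(t^2-r)-7*t^2+6*t-1)+2 := ⟨(s1^2-(8*t*(t^2-r)-7*t^2+6*t-1)+2)/4, by ring⟩
      obtain ⟨-, hN, q1, q2, q3, q4⟩ := DD_dbl t r s1 s0 l1 l0 m0 q hD hq
      refine ⟨4*a/(NN t r q^2*l1^2), 1, t, r, q, by positivity, Or.inl ⟨one_ne_zero, t, r, s1, s0, hD.1, by ring, by ring, by linear_combination hq⟩, ?_, ?_, ?_, ?_⟩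
      · field_simp; linear_combination q1
      · field_simp; linear_combination q2 + NN t r q^2*a1
      · field_simp; linear_combination q3 + NN t r q^2*a0
      · apply mul_left_cancel₀ (by norm_num : (4:ℚ) ≠ 0)
        rw [hd]
        field_simp
        linear_combination 4*q4 + NN t r q^2*hk
  · obtain ⟨t, r, s1, s0, l0, m0, hD, hx⟩ := half_I x y h
    obtain ⟨q, hq⟩ : ∃ q, 4*q = s1^2-(8*t*(t^2-r)-7*t^2+6*t-1)+2 := ⟨(s1^2-(8*t*(t^2-r)-7*t^2+6*t-1)+2)/4, by ring⟩
    obtain ⟨-, hN, q1, q2, q3, q4⟩ := DD_dbl t r s1 s0 0 l0 m0 q hD hq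
    have hm0 : m0 = -7+16*t := by linear_combination hD.2.1
    refine ⟨b/(2*NN t r q^2), 1, t, r, q, by positivity, Or.inl ⟨one_ne_zero, t, r, s1, s0, hD.1, by ring, by ring, by linear_combination hq⟩, ?_, ?_, ?_, ?_⟩
    · field_simp; linear_combination b/4*q1
    · field_simp; linear_combination q2/4
    · field_simp; linear_combination q3/4+NN t r q^2/4*hx
    · field_simp
      rw [← hx] at q4 
      linear_combination q4/4 + NN t r q^2/2*x*(hx-hm0)
end

open Polynomial NumberField
noncomputable section

def ev (a b c d : ℤ) : List (ℤ × ℕ × ℕ × ℕ × ℕ) → ℤ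
  | [] => 0
  | (n, i, j, k, l) :: t => n * (a^i * b^j * c^k * d^l) + ev a b c d t

def gg11 : List (ℤ × ℕ × ℕ × ℕ × ℕ) := [(-176,0,0,0,4), (-9920,0,0,1,3), (12240,0,0,2,2), (-9792,0,0,3,1), (-6644,0,0,4,0), (1616,0,1,0,3), (-8816,0,1,1,2), (14036,0,1,2,1), (9856,0,1,3,0), (-2093,0,2,0,2), (-13408,0,2,1,1), (5568,0,2,2,0), (-10976,0,3,0,1), (-64,0,3,1,0), (-704,0,4,0,0), (-1716,1,0,0,3), (-4,1,0,1,2), (13229,1,0,2,1), (24126,1,0,3,0), (-3968,1,1,0,2), (-10881,1,1,1,1), (-10836,1,1,2,0), (26005,1,2,0,1), (-29484,1,2,1,0), (714,1,3,0,0), (-1,2,0,0,2), (-245,2,0,1,1), (-2091,2,0,2,0), (-13351,2,1,0,1), (104077,2,1,1,0), (-19246,2,2,0,0), (-7037,3,0,0,1), (-18189,3,0,1,0), (-839,3,1,0,0), (-19711,4,0,0,0)]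
def gg12 : List (ℤ × ℕ × ℕ × ℕ × ℕ) := [(176,0,0,0,4), (528,0,0,1,3), (21540,0,0,2,2), (-25936,0,0,3,1), (33424,0,0,4,0), (-1680,0,1,0,3), (-1000,0,1,1,2), (4560,0,1,2,1), (72,0,2,0,2), (-3008,0,2,1,1), (27888,0,2,2,0), (-2208,0,3,0,1), (10144,0,3,1,0), (1440,0,4,0,0), (400,1,0,0,3), (-30808,1,0,2,1), (-25168,1,0,3,0), (2840,1,1,0,2), (-2832,1,1,1,1), (-61808,1,1,2,0), (-13760,1,2,0,1), (5984,1,2,1,0), (-2496,1,3,0,0), (2928,2,0,0,2), (32128,2,0,1,1), (2568,2,0,2,0), (-6656,2,1,0,1), (-5144,2,1,1,0), (13812,2,2,0,0), (944,3,0,0,1), (-19288,3,0,1,0), (4080,3,1,0,0), (41574,4,0,0,0)]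
def gg13 : List (ℤ × ℕ × ℕ × ℕ × ℕ) := [(-176,0,0,0,4), (21376,0,0,3,1), (-34116,0,0,4,0), (-528,0,1,0,3), (-30728,0,1,1,2), (55508,0,1,2,1), (-17280,0,1,3,0), (103,0,2,0,2), (-20848,0,2,1,1), (2976,0,2,2,0), (816,0,3,0,1), (-20128,0,3,1,0), (-10944,0,4,0,0), (5120,1,0,0,3), (-10852,1,0,1,2), (-18427,1,0,2,1), (-17138,1,0,3,0), (8992,1,1,0,2), (29655,1,1,1,1), (-22356,1,1,2,0), (-10571,1,2,0,1), (69732,1,2,1,0), (-1334,1,3,0,0), (-9624,2,0,0,2), (54255,2,0,1,1), (49461,2,0,2,0), (7949,2,1,0,1), (-12027,2,1,1,0), (-9122,2,2,0,0), (-17523,3,0,0,1), (-33129,3,0,1,0), (-2115,3,1,0,0), (35117,4,0,0,0)]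
def gg14 : List (ℤ × ℕ × ℕ × ℕ × ℕ) := [(704,0,0,1,3), (-2640,0,0,2,2), (7744,0,0,3,1), (40448,0,0,4,0), (-704,0,1,0,3), (1056,0,1,1,2), (-48192,0,1,2,1), (7040,0,1,3,0), (10464,0,2,0,2), (-1408,0,3,0,1), (704,0,4,0,0), (704,1,0,0,3), (12960,1,0,2,1), (-22976,1,0,3,0), (-7008,1,1,0,2), (4800,1,1,1,1), (25536,1,1,2,0), (-11712,1,2,0,1), (1408,1,3,0,0), (4752,2,0,0,2), (-27792,2,0,2,0), (13920,2,1,0,1), (-84192,2,1,1,0), (20640,2,2,0,0), (6200,3,0,0,1), (25808,3,0,1,0), (-3840,3,1,0,0), (-47,4,0,0,0)]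
def gg21 : List (ℤ × ℕ × ℕ × ℕ × ℕ) := [(54,0,0,0,4), (3872,0,0,1,3), (-9632,0,0,2,2), (14424,0,0,3,1), (-2225,0,0,4,0), (2976,0,1,0,3), (1848,0,1,1,2), (12,0,1,2,1), (24446,0,1,3,0), (2882,0,2,0,2), (17580,0,2,1,1), (-42561,0,2,2,0), (-3068,0,3,0,1), (-1390,0,3,1,0), (28427,0,4,0,0), (-84,1,0,0,3), (-35690,1,0,2,1), (2434,1,0,3,0), (-1984,1,1,0,2), (3254,1,1,1,1), (8104,1,1,2,0), (-250,1,2,0,1), (13796,1,2,1,0), (-13330,1,3,0,0), (-723,2,0,0,2), (12374,2,0,1,1), (-13129,2,0,2,0), (5122,2,1,0,1), (-26400,2,1,1,0), (3404,2,2,0,0), (-2680,3,0,0,1), (10718,3,0,1,0), (5220,3,1,0,0), (-1662,4,0,0,0)]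
def gg22 : List (ℤ × ℕ × ℕ × ℕ × ℕ) := [(388,0,0,0,4), (-2420,0,0,1,3), (14423,0,0,2,2), (-15708,0,0,3,1), (-2454,0,0,4,0), (-2316,0,1,0,3), (7550,0,1,1,2), (-2804,0,1,3,0), (1585,0,2,0,2), (4544,0,2,1,1), (3090,0,2,2,0), (8456,0,3,0,1), (4044,0,3,1,0), (-10914,0,4,0,0), (-2136,1,0,0,3), (-9000,1,0,1,2), (21045,1,0,2,1), (-9574,1,0,3,0), (-1390,1,1,0,2), (-36419,1,1,1,1), (131,1,2,0,1), (-1812,1,2,1,0), (6386,1,3,0,0), (5651,2,0,0,2), (-1095,2,0,1,1), (26668,2,0,2,0), (-3001,2,1,0,1), (-1043,2,1,1,0), (-2,2,2,0,0), (45,3,0,0,1), (2225,3,0,1,0), (3637,3,1,0,0), (-2542,4,0,0,0)]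
def gg23 : List (ℤ × ℕ × ℕ × ℕ × ℕ) := [(128,0,0,0,4), (-2436,0,0,1,3), (-1241,0,0,2,2), (-41596,0,0,3,1), (28486,0,0,4,0), (3104,0,1,0,3), (-7016,0,1,1,2), (7872,0,1,2,1), (9444,0,1,3,0), (-4054,0,2,0,2), (-14820,0,2,1,1), (20606,0,2,2,0), (-13140,0,3,0,1), (-9604,0,3,1,0), (-10130,0,4,0,0), (580,1,0,0,3), (-13410,1,0,1,2), (57339,1,0,2,1), (6342,1,0,3,0), (4330,1,1,0,2), (1787,1,1,1,1), (-5136,1,1,2,0), (17019,1,2,0,1), (11402,1,3,0,0), (1504,2,0,0,2), (3,2,0,1,1), (122,2,0,2,0), (61,2,1,0,1), (12077,2,1,1,0), (-30779,2,2,0,0), (-13579,3,0,0,1), (-1475,3,0,1,0), (9295,3,1,0,0), (7865,4,0,0,0)]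
def gg24 : List (ℤ × ℕ × ℕ × ℕ × ℕ) := [(-512,0,0,1,3), (7536,0,0,2,2), (936,0,0,3,1), (-12819,0,0,4,0), (-1552,0,1,0,3), (3128,0,1,1,2), (11696,0,1,2,1), (-29366,0,1,3,0), (1939,0,2,0,2), (-1436,0,2,1,1), (37149,0,2,2,0), (3852,0,3,0,1), (-6682,0,3,1,0), (13477,0,4,0,0), (-216,1,0,0,3), (5276,1,0,1,2), (3589,1,0,2,1), (-8184,1,0,3,0), (-19341,1,1,1,1), (-4,1,1,2,0), (9613,1,2,0,1), (-17048,1,2,1,0), (2976,1,3,0,0), (322,2,0,0,2), (-18977,2,0,1,1), (15224,2,0,2,0), (549,2,1,0,1), (14259,2,1,1,0), (4314,2,2,0,0), (9761,3,0,0,1), (-12745,3,0,1,0), (-8133,3,1,0,0), (-2676,4,0,0,0)]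
def gg31 : List (ℤ × ℕ × ℕ × ℕ × ℕ) := [(13,0,0,0,4), (-116,0,0,1,3), (-363,0,0,2,2), (-1084,0,0,3,1), (1373,0,0,4,0), (208,0,1,0,3), (-348,0,1,1,2), (744,0,1,2,1), (-1310,0,1,3,0), (-5,0,2,0,2), (-504,0,2,1,1), (-2235,0,2,2,0), (-186,0,3,1,0), (-53,0,4,0,0), (554,1,0,1,2), (3430,1,0,2,1), (-3562,1,0,3,0), (-594,1,1,0,2), (1304,1,1,1,1), (-292,1,1,2,0), (202,1,2,0,1), (2312,1,2,1,0), (-1342,1,3,0,0), (-332,2,0,0,2), (232,2,0,1,1), (-1571,2,0,2,0), (8,2,1,0,1), (-6,2,1,1,0), (114,2,2,0,0), (12,3,0,0,1), (-104,3,0,1,0), (-370,3,1,0,0), (166,4,0,0,0)]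
def gg32 : List (ℤ × ℕ × ℕ × ℕ × ℕ) := [(23,0,0,0,4), (156,0,0,1,3), (587,0,0,2,2), (-12,0,0,3,1), (3250,0,0,4,0), (-84,0,1,0,3), (66,0,1,1,2), (-1428,0,1,2,1), (924,0,1,3,0), (120,0,2,0,2), (-152,0,2,1,1), (1490,0,2,2,0), (-384,0,3,0,1), (1212,0,3,1,0), (94,0,4,0,0), (-208,1,0,0,3), (-120,1,0,1,2), (-744,1,0,2,1), (-228,1,0,3,0), (-142,1,1,0,2), (438,1,1,1,1), (-1372,1,1,2,0), (-702,1,2,0,1), (-1136,1,2,1,0), (650,2,0,0,2), (-210,2,0,1,1), (3857,2,0,2,0), (118,2,1,0,1), (-596,2,1,1,0), (1424,2,2,0,0), (-106,3,0,0,1), (-1514,3,0,1,0), (16,3,1,0,0), (-49,4,0,0,0)]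
def gg33 : List (ℤ × ℕ × ℕ × ℕ × ℕ) := [(35,0,0,0,4), (-204,0,0,1,3), (-805,0,0,2,2), (2836,0,0,3,1), (2914,0,0,4,0), (-48,0,1,0,3), (-1092,0,1,1,2), (-3280,0,1,2,1), (3492,0,1,3,0), (4,0,2,1,1), (-2426,0,2,2,0), (36,0,3,0,1), (588,0,3,1,0), (-110,0,4,0,0), (-124,1,0,0,3), (42,1,0,1,2), (1207,1,0,2,1), (-4706,1,0,3,0), (26,1,1,0,2), (567,1,1,1,1), (7184,1,1,2,0), (-1317,1,2,0,1), (856,1,2,1,0), (-246,1,3,0,0), (-199,2,0,0,2), (-93,2,0,1,1), (-1864,2,0,2,0), (1021,2,1,0,1), (421,2,1,1,0), (-331,2,2,0,0), (-637,3,0,0,1), (901,3,0,1,0), (499,3,1,0,0), (179,4,0,0,0)]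
def gg34 : List (ℤ × ℕ × ℕ × ℕ × ℕ) := [(-140,0,0,1,3), (877,0,0,2,2), (-1132,0,0,3,1), (-5097,0,0,4,0), (-92,0,1,0,3), (-6,0,1,1,2), (932,0,1,2,1), (-1330,0,1,3,0), (521,0,2,0,2), (436,0,2,1,1), (427,0,2,2,0), (-204,0,3,0,1), (210,0,3,1,0), (53,0,4,0,0), (-52,1,0,0,3), (16,1,0,1,2), (-1319,1,0,2,1), (2292,1,0,3,0), (254,1,1,0,2), (-1027,1,1,1,1), (-888,1,1,2,0), (-141,1,2,0,1), (-1360,1,2,1,0), (1080,1,3,0,0), (150,2,0,0,2), (717,2,0,1,1), (564,2,0,2,0), (-985,2,1,0,1), (887,2,1,1,0), (-5,2,2,0,0), (235,3,0,0,1), (-1657,3,0,1,0), (257,3,1,0,0), (244,4,0,0,0)]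
def gg41 : List (ℤ × ℕ × ℕ × ℕ × ℕ) := [(20709,0,0,0,4), (-124856,0,0,1,3), (268248,0,0,2,2), (-188736,0,0,3,1), (838504,0,0,4,0), (-95964,0,1,0,3), (-361298,0,1,1,2), (642172,0,1,2,1), (-1181248,0,1,3,0), (170272,0,2,0,2), (-223964,0,2,1,1), (-847944,0,2,2,0), (167772,0,3,0,1), (-98632,0,3,1,0), (-61472,0,4,0,0), (231460,1,0,0,3), (-244618,1,0,1,2), (-19,1,0,2,1), (304190,1,0,3,0), (300896,1,1,0,2), (19,1,1,1,1), (2477172,1,1,2,0), (-117461,1,2,0,1), (694312,1,2,1,0), (154726,1,3,0,0), (-663564,2,0,0,2), (759435,2,0,1,1), (-1144783,2,0,2,0), (438073,2,1,0,1), (-1632829,2,1,1,0), (-602861,2,2,0,0), (26101,3,0,0,1), (-402335,3,0,1,0), (30645,3,1,0,0), (146529,4,0,0,0)]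
def gg42 : List (ℤ × ℕ × ℕ × ℕ × ℕ) := [(-1,0,0,0,4), (139792,0,0,1,3), (-203446,0,0,2,2), (316280,0,0,3,1), (-94728,0,0,4,0), (109632,0,1,0,3), (580588,0,1,1,2), (-10440,0,1,2,1), (-1488640,0,1,3,0), (278560,0,2,1,1), (1070744,0,2,2,0), (-200048,0,3,0,1), (54800,0,3,1,0), (60784,0,4,0,0), (-74308,1,0,0,3), (51080,1,0,1,2), (-363200,1,0,2,1), (-96672,1,0,3,0), (-191084,1,1,0,2), (-737836,1,1,1,1), (-864072,1,1,2,0), (-286004,1,2,0,1), (-709488,1,2,1,0), (-122136,1,3,0,0), (323890,2,0,0,2), (-685140,2,0,1,1), (2078426,2,0,2,0), (162924,2,1,0,1), (568384,2,1,1,0), (783200,2,2,0,0), (69712,3,0,0,1), (-126900,3,0,1,0), (-234416,3,1,0,0), (-154999,4,0,0,0)]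
def gg43 : List (ℤ × ℕ × ℕ × ℕ × ℕ) := [(16469,0,0,0,4), (194736,0,0,1,3), (-1187826,0,0,2,2), (1313864,0,0,3,1), (-341016,0,0,4,0), (546908,0,1,1,2), (-1263460,0,1,2,1), (1748280,0,1,3,0), (3,0,2,0,2), (186272,0,2,1,1), (-619436,0,2,2,0), (309040,0,3,0,1), (-11048,0,3,1,0), (113524,0,4,0,0), (-271032,1,0,0,3), (758636,1,0,1,2), (-1233783,1,0,2,1), (1281118,1,0,3,0), (-318084,1,1,0,2), (-1225841,1,1,1,1), (84388,1,1,2,0), (-66995,1,2,0,1), (-1246252,1,2,1,0), (-389902,1,3,0,0), (198267,2,0,0,2), (-141637,2,0,1,1), (352299,2,0,2,0), (459425,2,1,0,1), (2719425,2,1,1,0), (121266,2,2,0,0), (-13,3,0,0,1), (314019,3,0,1,0), (-796891,3,1,0,0), (125659,4,0,0,0)]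
def gg44 : List (ℤ × ℕ × ℕ × ℕ × ℕ) := [(167616,0,0,0,4), (-65876,0,0,1,3), (342043,0,0,2,2), (-282236,0,0,3,1), (-821084,0,0,4,0), (4,0,1,0,3), (276954,0,1,1,2), (634956,0,1,2,1), (92784,0,1,3,0), (19402,0,2,0,2), (412800,0,2,1,1), (550540,0,2,2,0), (-115032,0,3,0,1), (222952,0,3,1,0), (61472,0,4,0,0), (-82836,1,0,0,3), (-149336,1,0,1,2), (675090,1,0,2,1), (-873812,1,0,3,0), (43554,1,1,0,2), (-36492,1,1,1,1), (-2903780,1,1,2,0), (4,1,2,0,1), (32128,1,2,1,0), (161856,1,3,0,0), (441844,2,0,0,2), (-936916,2,0,1,1), (1548759,2,0,2,0), (-183824,2,1,0,1), (2,2,1,1,0), (-2,2,2,0,0), (-179612,3,0,0,1), (312488,3,0,1,0), (413666,3,1,0,0), (-299987,4,0,0,0)]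
lemma cert1 (a b c d : ℤ) (hK : kum a b c d = 0) : 167616*a^8 = ev a b c d gg11 * dl1 a b c d + ev a b c d gg12 * dl2 a b c d + ev a b c d gg13 * dl3 a b c d + ev a b c d gg14 * dl4 a b c d := by
  simp only [ev, gg11, gg12, gg13, gg14, dl1, dl2, dl3, dl4]; unfold kum at hK
  linear_combination ((-3744)*d^4 + (-9820)*c^1*d^3 + (103585)*c^2*d^2 + (-251252)*c^3*d^1 + (322160)*c^4 + (-288)*b^1*d^3 + (12680)*b^1*c^1*d^2 + (61728)*b^1*c^2*d^1 + (20552)*b^1*c^3 + (13440)*b^2*d^2 + (-40196)*b^2*c^1*d^1 + (3640)*b^2*c^2 + (-9284)*b^3*d^1 + (48808)*b^3*c^1 + (-21388)*b^4 + (-5644)*a^1*d^3 + (77754)*a^1*c^1*d^2 + (-179597)*a^1*c^2*d^1 + (-20230)*a^1*c^3 + (74798)*a^1*b^1*d^2 + (-99193)*a^1*b^1*c^1*d^1 + (-294760)*a^1*b^1*c^2 + (13155)*a^1*b^2*d^1 + (130208)*a^1*b^2*c^1 + (9126)*a^1*b^3 + (2666)*a^2*d^2 + (131487)*a^2*c^1*d^1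 + (-76310)*a^2*c^2 + (-66967)*a^2*b^1*d^1 + (99861)*a^2*b^1*c^1 + (49931)*a^2*b^2 + (-42643)*a^3*d^1 + (-136547)*a^3*c^1 + (-10613)*a^3*b^1 + (237321)*a^4) * hK

lemma cert2 (a b c d : ℤ) (hK : kum a b c d = 0) : 167616*b^8 = ev a b c d gg21 * dl1 a b c d + ev a b c d gg22 * dl2 a b c d + ev a b c d gg23 * dl3 a b c d + ev a b c d gg24 * dl4 a b c d := by
  simp only [ev, gg21, gg22, gg23, gg24, dl1, dl2, dl3, dl4]; unfold kum at hK
  linear_combination ((7325)*d^4 + (-25308)*c^1*d^3 + (94863)*c^2*d^2 + (-20940)*c^3*d^1 + (-65908)*c^4 + (-11232)*b^1*d^3 + (68788)*b^1*c^1*d^2 + (-27780)*b^1*c^2*d^1 + (-6768)*b^1*c^3 + (-25837)*b^2*d^2 + (65340)*b^2*c^1*d^1 + (-99972)*b^2*c^2 + (15404)*b^3*d^1 + (53840)*b^3*c^1 + (-105668)*b^4 + (-13884)*a^1*d^3 + (-55266)*a^1*c^1*d^2 + (29252)*a^1*c^2*d^1 + (-72312)*a^1*c^3 + (4658)*a^1*b^1*d^2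 + (-198162)*a^1*b^1*c^1*d^1 + (21260)*a^1*b^1*c^2 + (-96072)*a^1*b^2*d^1 + (40420)*a^1*b^2*c^1 + (-24120)*a^1*b^3 + (27331)*a^2*d^2 + (20698)*a^2*c^1*d^1 + (183837)*a^2*c^2 + (2106)*a^2*b^1*d^1 + (-16474)*a^2*b^1*c^1 + (56737)*a^2*b^2 + (8932)*a^3*d^1 + (40304)*a^3*c^1 + (28808)*a^3*b^1 + (-35048)*a^4) * hK

lemma cert3 (a b c d : ℤ) (hK : kum a b c d = 0) : 167616*c^8 = ev a b c d gg31 * dl1 a b c d + ev a b c d gg32 * dl2 a b c d + ev a b c d gg33 * dl3 a b c d + ev a b c d gg34 * dl4 a b c d := by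
  simp only [ev, gg31, gg32, gg33, gg34, dl1, dl2, dl3, dl4]; unfold kum at hK
  linear_combination ((-185)*d^4 + (-348)*c^1*d^3 + (2471)*c^2*d^2 + (372)*c^3*d^1 + (48444)*c^4 + (-228)*b^1*d^3 + (250)*b^1*c^1*d^2 + (-3432)*b^1*c^2*d^1 + (3904)*b^1*c^3 + (1575)*b^2*d^2 + (-7120)*b^2*c^1*d^1 + (6492)*b^2*c^2 + (-1320)*b^3*d^1 + (1736)*b^3*c^1 + (-384)*b^4 + (20)*a^1*d^3 + (4164)*a^1*c^1*d^2 + (-11863)*a^1*c^2*d^1 + (3430)*a^1*c^3 + (1186)*a^1*b^1*d^2 + (2649)*a^1*b^1*c^1*d^1 + (-23520)*a^1*b^1*c^2 + (-589)*a^1*b^2*d^1 + (10636)*a^1*b^2*c^1 + (-738)*a^1*b^3 + (2511)*a^2*d^2 + (685)*a^2*c^1*d^1 + (19726)*a^2*c^2 + (1147)*a^2*b^1*d^1 + (-6687)*a^2*b^1*c^1 + (7020)*a^2*b^2 + (-4263)*a^3*d^1 + (-2871)*a^3*c^1 + (-3219)*a^3*b^1 + (1893)*a^4) * hK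

lemma cert4 (a b c d : ℤ) (hK : kum a b c d = 0) : 167616*d^8 = ev a b c d gg41 * dl1 a b c d + ev a b c d gg42 * dl2 a b c d + ev a b c d gg43 * dl3 a b c d + ev a b c d gg44 * dl4 a b c d := by
  simp only [ev, gg41, gg42, gg43, gg44, dl1, dl2, dl3, dl4]; unfold kum at hK
  linear_combination ((-457930)*d^4 + (779716)*c^1*d^3 + (-1197787)*c^2*d^2 + (-279268)*c^3*d^1 + (854724)*c^4 + (180912)*b^1*d^3 + (700064)*b^1*c^1*d^2 + (4343472)*b^1*c^2*d^1 + (-13728832)*b^1*c^3 + (-453108)*b^2*d^2 + (-1762580)*b^2*c^1*d^1 + (8316212)*b^2*c^2 + (140716)*b^3*d^1 + (-2038192)*b^3*c^1 + (1277656)*b^4 + (-200560)*a^1*d^3 + (101826)*a^1*c^1*d^2 + (-2250089)*a^1*c^2*d^1 + (-2520534)*a^1*c^3 + (-1442154)*a^1*b^1*d^2 + (-2129893)*a^1*b^1*c^1*d^1 + (542040)*a^1*b^1*c^2 + (-1474385)*a^1*b^2*d^1 + (-737568)*a^1*b^2*c^1 + (-2432058)*a^1*b^3 + (1233279)*a^2*d^2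 + (-1644081)*a^2*c^1*d^1 + (12844394)*a^2*c^2 + (987537)*a^2*b^1*d^1 + (1105)*a^2*b^1*c^1 + (3782171)*a^2*b^2 + (1217371)*a^3*d^1 + (-1329051)*a^3*c^1 + (-68645)*a^3*b^1 + (-949240)*a^4) * hK

end

open Polynomial NumberField
noncomputable section

def nr : List (ℤ × ℕ × ℕ × ℕ × ℕ) → ℚ
  | [] => 0
  | (n, i, j, k, l) :: t => (|n| : ℤ) * ((1/5)^i * (1/5)^j * (1/7)^k * (1/3)^l) + nr t

def deg4 : List (ℤ × ℕ × ℕ × ℕ × ℕ) → Bool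
  | [] => true
  | (_, i, j, k, l) :: t => (i + j + k + l == 4) && deg4 t

lemma ev_bound (a b c d : ℤ) (T : ℚ) (hT : 0 ≤ T) (ha : |(a:ℚ)| ≤ 1/5*T) (hb : |(b:ℚ)| ≤ 1/5*T)
    (hc : |(c:ℚ)| ≤ 1/7*T) (hd : |(d:ℚ)| ≤ 1/3*T) (l : List (ℤ × ℕ × ℕ × ℕ × ℕ)) (hl : deg4 l = true) :
    |(ev a b c d l : ℚ)| ≤ nr l * T^4 := by
  induction l with
  | nil => simp [ev, nr]
  | cons h t ih =>
    obtain ⟨n, i, j, k, l⟩ := h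
    simp only [deg4, Bool.and_eq_true, beq_iff_eq] at hl
    simp only [ev, nr]
    push_cast
    refine (abs_add_le _ _).trans ?_
    rw [add_mul]
    refine add_le_add ?_ (ih hl.2)
    rw [abs_mul, abs_mul, abs_mul, abs_mul, abs_pow, abs_pow, abs_pow, abs_pow, ← hl.1, mul_assoc |(n:ℚ)|]
    refine mul_le_mul_of_nonneg_left ?_ (abs_nonneg (n:ℚ))
    calc |(a:ℚ)|^i * |(b:ℚ)|^j * |(c:ℚ)|^k * |(d:ℚ)|^l
        ≤ (1/5*T)^i * (1/5*T)^j * (1/7*T)^k * (1/3*T)^l := by gcongr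
      _ = _ := by rw [mul_pow, mul_pow, mul_pow, mul_pow]; ring

/-- one coordinate of the height estimate -/
lemma coord_bound (a b c d v : ℤ) (g1 g2 g3 g4 : List (ℤ × ℕ × ℕ × ℕ × ℕ)) (w : ℚ) (hw : 0 ≤ w)
    (T S : ℚ) (hT : 0 ≤ T) (ha : |(a:ℚ)| ≤ 1/5*T) (hb : |(b:ℚ)| ≤ 1/5*T)
    (hc : |(c:ℚ)| ≤ 1/7*T) (hd : |(d:ℚ)| ≤ 1/3*T)
    (h1 : |(dl1 a b c d : ℚ)| ≤ 1/5*S) (h2 : |(dl2 a b c d : ℚ)| ≤ 1/5*S)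
    (h3 : |(dl3 a b c d : ℚ)| ≤ 1/7*S) (h4 : |(dl4 a b c d : ℚ)| ≤ 1/3*S)
    (hg : deg4 g1 = true ∧ deg4 g2 = true ∧ deg4 g3 = true ∧ deg4 g4 = true)
    (hS : 0 ≤ S)
    (hn : w^8*(nr g1 * (1/5) + nr g2 * (1/5) + nr g3 * (1/7) + nr g4 * (1/3)) ≤ 1353 * 167616)
    (h : (167616*v^8 : ℚ) = ev a b c d g1 * dl1 (a:ℚ) b c d + ev a b c d g2 * dl2 (a:ℚ) b c d
      + ev a b c d g3 * dl3 (a:ℚ) b c d + ev a b c d g4 * dl4 (a:ℚ) b c d) :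
    (w*|(v:ℚ)|)^8 ≤ 1353 * T^4 * S := by
  have e1 := ev_bound a b c d T hT ha hb hc hd g1 hg.1
  have e2 := ev_bound a b c d T hT ha hb hc hd g2 hg.2.1
  have e3 := ev_bound a b c d T hT ha hb hc hd g3 hg.2.2.1
  have e4 := ev_bound a b c d T hT ha hb hc hd g4 hg.2.2.2
  have m (x y X Y : ℚ) (hx : |x| ≤ X) (hy : |y| ≤ Y) : |x*y| ≤ X*Y := by
    rw [abs_mul]; exact mul_le_mul hx hy (abs_nonneg _) ((abs_nonneg _).trans hx)
  have f1 := m _ _ _ _ e1 h1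
  have f2 := m _ _ _ _ e2 h2
  have f3 := m _ _ _ _ e3 h3
  have f4 := m _ _ _ _ e4 h4
  have key : 167616*|(v:ℚ)|^8 ≤ (nr g1 * (1/5) + nr g2 * (1/5) + nr g3 * (1/7) + nr g4 * (1/3)) * (T^4*S) := by
    have : 167616*|(v:ℚ)|^8 = |(167616*v^8 : ℚ)| := by rw [abs_mul, abs_pow]; norm_num
    rw [this, h]
    refine (abs_add_le _ _).trans ?_
    refine (add_le_add ((abs_add_le _ _).trans (add_le_add ((abs_add_le _ _).trans (add_le_add f1 f2)) f3)) f4).trans ?_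
    apply le_of_eq; ring
  have k2 := mul_le_mul_of_nonneg_left key (pow_nonneg hw 8)
  have k3 := mul_le_mul_of_nonneg_right hn (show 0 ≤ T^4*S by positivity)
  rw [mul_pow]
  nlinarith

def hh (a b c d : ℤ) : ℤ := max (max (5*|a|) (5*|b|)) (max (7*|c|) (3*|d|))

lemma hh_nn (a b c d : ℤ) : 0 ≤ hh a b c d := by
  unfold hh; exact le_max_of_le_left (le_max_of_le_left (by positivity))

lemma hh_le (a b c d : ℤ) : |(a:ℚ)| ≤ 1/5*(hh a b c d : ℚ) ∧ |(b:ℚ)| ≤ 1/5*(hh a b c d : ℚ) ∧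
    |(c:ℚ)| ≤ 1/7*(hh a b c d : ℚ) ∧ |(d:ℚ)| ≤ 1/3*(hh a b c d : ℚ) := by
  have h1 : 5*|a| ≤ hh a b c d := (le_max_left _ _).trans (le_max_left _ _)
  have h2 : 5*|b| ≤ hh a b c d := (le_max_right _ _).trans (le_max_left _ _)
  have h3 : 7*|c| ≤ hh a b c d := (le_max_left _ _).trans (le_max_right _ _)
  have h4 : 3*|d| ≤ hh a b c d := (le_max_right _ _).trans (le_max_right _ _)
  have h1' : (5*|a| : ℚ) ≤ hh a b c d := by exact_mod_cast h1
  have h2' : (5*|b| : ℚ) ≤ hh a b c d := by exact_mod_cast h2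
  have h3' : (7*|c| : ℚ) ≤ hh a b c d := by exact_mod_cast h3
  have h4' : (3*|d| : ℚ) ≤ hh a b c d := by exact_mod_cast h4
  push_cast at h1' h2' h3' h4'
  refine ⟨?_, ?_, ?_, ?_⟩ <;> linarith

lemma dl1_cast (a b c d : ℤ) : ((dl1 a b c d : ℤ) : ℚ) = dl1 (a:ℚ) b c d := by unfold dl1; push_cast; ring
lemma dl2_cast (a b c d : ℤ) : ((dl2 a b c d : ℤ) : ℚ) = dl2 (a:ℚ) b c d := by unfold dl2; push_cast; ring
lemma dl3_cast (a b c d : ℤ) : ((dl3 a b c d : ℤ) : ℚ) = dl3 (a:ℚ) b c d := by unfold dl3; push_cast; ring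
lemma dl4_cast (a b c d : ℤ) : ((dl4 a b c d : ℤ) : ℚ) = dl4 (a:ℚ) b c d := by unfold dl4; push_cast; ring
lemma kum_cast (a b c d : ℤ) : ((kum a b c d : ℤ) : ℚ) = kum (a:ℚ) b c d := by unfold kum; push_cast; ring

lemma height_ineq (a b c d : ℤ) (hK : kum a b c d = 0) (S : ℚ) (hS : 0 ≤ S)
    (h1 : |(dl1 a b c d : ℚ)| ≤ 1/5*S) (h2 : |(dl2 a b c d : ℚ)| ≤ 1/5*S)
    (h3 : |(dl3 a b c d : ℚ)| ≤ 1/7*S) (h4 : |(dl4 a b c d : ℚ)| ≤ 1/3*S) :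
    (hh a b c d : ℚ)^8 ≤ 1353 * (hh a b c d : ℚ)^4 * S := by
  obtain ⟨ha, hb, hc, hd⟩ := hh_le a b c d
  have hT : (0:ℚ) ≤ hh a b c d := by exact_mod_cast hh_nn a b c d
  have c1 := congrArg (Int.cast : ℤ → ℚ) (cert1 a b c d hK)
  have c2 := congrArg (Int.cast : ℤ → ℚ) (cert2 a b c d hK)
  have c3 := congrArg (Int.cast : ℤ → ℚ) (cert3 a b c d hK)
  have c4 := congrArg (Int.cast : ℤ → ℚ) (cert4 a b c d hK)
  push_cast [dl1_cast, dl2_cast, dl3_cast, dl4_cast] at c1 c2 c3 c4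
  have r1 := coord_bound a b c d a gg11 gg12 gg13 gg14 5 (by norm_num) _ S hT ha hb hc hd h1 h2 h3 h4
    (by decide) hS (by norm_num [nr, gg11, gg12, gg13, gg14]) c1
  have r2 := coord_bound a b c d b gg21 gg22 gg23 gg24 5 (by norm_num) _ S hT ha hb hc hd h1 h2 h3 h4
    (by decide) hS (by norm_num [nr, gg21, gg22, gg23, gg24]) c2
  have r3 := coord_bound a b c d c gg31 gg32 gg33 gg34 7 (by norm_num) _ S hT ha hb hc hd h1 h2 h3 h4
    (by decide) hS (by norm_num [nr, gg31, gg32, gg33, gg34]) c3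
  have r4 := coord_bound a b c d d gg41 gg42 gg43 gg44 3 (by norm_num) _ S hT ha hb hc hd h1 h2 h3 h4
    (by decide) hS (by norm_num [nr, gg41, gg42, gg43, gg44]) c4
  generalize 1353 * (hh a b c d : ℚ)^4 * S = Z at *
  have : (hh a b c d : ℚ) = 5*|(a:ℚ)| ∨ (hh a b c d : ℚ) = 5*|(b:ℚ)| ∨ (hh a b c d : ℚ) = 7*|(c:ℚ)| ∨ (hh a b c d : ℚ) = 3*|(d:ℚ)| := by
    have : hh a b c d = 5*|a| ∨ hh a b c d = 5*|b| ∨ hh a b c d = 7*|c| ∨ hh a b c d = 3*|d| := by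
      unfold hh
      rcases max_choice (max (5*|a|) (5*|b|)) (max (7*|c|) (3*|d|)) with h | h <;> rw [h]
      · rcases max_choice (5*|a|) (5*|b|) with h | h <;> simp [h]
      · rcases max_choice (7*|c|) (3*|d|) with h | h <;> simp [h]
    rcases this with h | h | h | h
    · left; rw [h]; push_cast; rfl
    · right; left; rw [h]; push_cast; rfl
    · right; right; left; rw [h]; push_cast; rfl
    · right; right; right; rw [h]; push_cast; rfl
  rcases this with h | h | h | h <;> rw [h] <;> assumption
end

open Polynomial NumberField
noncomputable section

def kl : List (ℤ × ℤ × ℤ × ℤ) := [(1,0,0,1), (1,1,1,1), (0,1,0,0), (1,1,0,0), (1,2,1,-1), (1,-1,1,5), (2,0,1,2),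
  (1,1,0,3), (1,3,-1,1), (0,1,1,2)]

def Kn (a b c d : ℚ) : Prop := ∃ v ∈ kl, ∃ u : ℚ, a = u*v.1 ∧ b = u*v.2.1 ∧ c = u*v.2.2.1 ∧ d = u*v.2.2.2

lemma dl_hom (u a b c d : ℚ) : dl1 (u*a) (u*b) (u*c) (u*d) = u^4 * dl1 a b c d ∧
    dl2 (u*a) (u*b) (u*c) (u*d) = u^4 * dl2 a b c d ∧ dl3 (u*a) (u*b) (u*c) (u*d) = u^4 * dl3 a b c d ∧
    dl4 (u*a) (u*b) (u*c) (u*d) = u^4 * dl4 a b c d := by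
  refine ⟨?_, ?_, ?_, ?_⟩
  · unfold dl1; ring
  · unfold dl2; ring
  · unfold dl3; ring
  · unfold dl4; ring

lemma kl_dbl : ∀ v ∈ kl, ∃ w ∈ kl, ∃ e ∈ [(4:ℤ),32,9,36,288],
    dl1 v.1 v.2.1 v.2.2.1 v.2.2.2 = e * w.1 ∧
    dl2 v.1 v.2.1 v.2.2.1 v.2.2.2 = e * w.2.1 ∧ dl3 v.1 v.2.1 v.2.2.1 v.2.2.2 = e * w.2.2.1 ∧
    dl4 v.1 v.2.1 v.2.2.1 v.2.2.2 = e * w.2.2.2 := by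
  unfold kl dl1 dl2 dl3 dl4
  decide +kernel

lemma Kn_dbl (u a b c d : ℚ) (h : Kn a b c d) : Kn (u*dl1 a b c d) (u*dl2 a b c d) (u*dl3 a b c d) (u*dl4 a b c d) := by
  obtain ⟨v, hv, t, rfl, rfl, rfl, rfl⟩ := h
  obtain ⟨w, hw, e, _, h1, h2, h3, h4⟩ := kl_dbl v hv
  obtain ⟨g1, g2, g3, g4⟩ := dl_hom t v.1 v.2.1 v.2.2.1 v.2.2.2
  refine ⟨w, hw, u * t^4 * e, ?_, ?_, ?_, ?_⟩
  · rw [g1, ← dl1_cast, h1]; push_cast; ring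
  · rw [g2, ← dl2_cast, h2]; push_cast; ring
  · rw [g3, ← dl3_cast, h3]; push_cast; ring
  · rw [g4, ← dl4_cast, h4]; push_cast; ring

lemma Kn_smul (u a b c d : ℚ) (h : Kn a b c d) : Kn (u*a) (u*b) (u*c) (u*d) := by
  obtain ⟨v, hv, t, rfl, rfl, rfl, rfl⟩ := h
  exact ⟨v, hv, u*t, by ring, by ring, by ring, by ring⟩

/-- primitive integer vectors -/
def Pri (a b c d : ℤ) : Prop := ∃ p q r s : ℤ, p*a+q*b+r*c+s*d = 1

lemma prim_int (a b c d : ℤ) (h : a ≠ 0 ∨ b ≠ 0) : ∃ u a' b' c' d' : ℤ, u ≠ 0 ∧ Pri a' b' c' d' ∧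
    a = u*a' ∧ b = u*b' ∧ c = u*c' ∧ d = u*d' := by
  obtain ⟨g, hg⟩ := IsPrincipalIdealRing.principal (Ideal.span {a, b, c, d} : Ideal ℤ)
  have mem (x : ℤ) (hx : x ∈ ({a, b, c, d} : Set ℤ)) : ∃ y, x = g * y := by
    have : x ∈ Ideal.span {g} := by
      have h := Ideal.subset_span (α := ℤ) hx
      rw [hg] at h; exact h
    exact (Ideal.mem_span_singleton.1 this)
  obtain ⟨a', ha⟩ := mem a (by simp)
  obtain ⟨b', hb⟩ := mem b (by simp)
  obtain ⟨c', hc⟩ := mem c (by simp)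
  obtain ⟨d', hd⟩ := mem d (by simp)
  have g0 : g ≠ 0 := by
    rintro rfl
    simp at ha hb; rcases h with h | h <;> contradiction
  refine ⟨g, a', b', c', d', g0, ?_, ha, hb, hc, hd⟩
  have : g ∈ Ideal.span {a, b, c, d} := by rw [hg]; exact Ideal.mem_span_singleton_self g
  simp only [Ideal.mem_span_insert, Ideal.mem_span_singleton'] at this
  obtain ⟨p, z, ⟨q, z', ⟨r, z'', ⟨s, rfl⟩, rfl⟩, rfl⟩, h⟩ := this
  refine ⟨p, q, r, s, mul_left_cancel₀ g0 ?_⟩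
  rw [ha, hb, hc, hd] at h
  linear_combination -h

lemma prim_rat (a b c d : ℚ) (h : a ≠ 0 ∨ b ≠ 0) : ∃ (u : ℚ) (a' b' c' d' : ℤ), u ≠ 0 ∧ Pri a' b' c' d' ∧
    a = u*a' ∧ b = u*b' ∧ c = u*c' ∧ d = u*d' := by
  have e (q : ℚ) (m : ℚ) : q * (q.den * m) = q.num * m := by
    rw [← mul_assoc, Rat.mul_den_eq_num]
  have hD : ((a.den*b.den*c.den*d.den : ℤ) : ℚ) ≠ 0 := by
    have := a.den_nz; have := b.den_nz; have := c.den_nz; have := d.den_nz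
    exact_mod_cast (by positivity)
  set D : ℤ := a.den*b.den*c.den*d.den with hDd
  have h1 : a * D = ((a.num*(b.den*c.den*d.den) : ℤ) : ℚ) := by
    rw [hDd]; push_cast; rw [← e]; ring
  have h2 : b * D = ((b.num*(a.den*c.den*d.den) : ℤ) : ℚ) := by
    rw [hDd]; push_cast; rw [← e]; ring
  have h3 : c * D = ((c.num*(a.den*b.den*d.den) : ℤ) : ℚ) := by
    rw [hDd]; push_cast; rw [← e]; ring
  have h4 : d * D = ((d.num*(a.den*b.den*c.den) : ℤ) : ℚ) := by
    rw [hDd]; push_cast; rw [← e]; ring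
  obtain ⟨u, a', b', c', d', hu, hp, e1, e2, e3, e4⟩ := prim_int (a.num*(b.den*c.den*d.den)) (b.num*(a.den*c.den*d.den))
    (c.num*(a.den*b.den*d.den)) (d.num*(a.den*b.den*c.den)) (by
      rcases h with h | h
      · left; intro h0; rw [h0] at h1; simp at h1
        rcases h1 with h1 | h1
        · exact h h1
        · exact hD (by exact_mod_cast h1)
      · right; intro h0; rw [h0] at h2; simp at h2
        rcases h2 with h1 | h1
        · exact h h1
        · exact hD (by exact_mod_cast h1))
  rw [e1] at h1; rw [e2] at h2; rw [e3] at h3; rw [e4] at h4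
  push_cast at h1 h2 h3 h4
  refine ⟨u/D, a', b', c', d', div_ne_zero (by exact_mod_cast hu) hD, hp, ?_, ?_, ?_, ?_⟩
  · rw [div_mul_eq_mul_div, eq_div_iff hD, h1]
  · rw [div_mul_eq_mul_div, eq_div_iff hD, h2]
  · rw [div_mul_eq_mul_div, eq_div_iff hD, h3]
  · rw [div_mul_eq_mul_div, eq_div_iff hD, h4]

lemma KP_ne (a b c d : ℚ) (h : KP a b c d) : a ≠ 0 ∨ b ≠ 0 := by
  rcases h with h | h
  · exact Or.inl h.1
  · exact Or.inr h.2.1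

lemma gcd_dvd (a b c d g : ℤ) (hp : Pri a b c d) (hK : kum a b c d = 0) (h1 : g ∣ dl1 a b c d) (h2 : g ∣ dl2 a b c d)
    (h3 : g ∣ dl3 a b c d) (h4 : g ∣ dl4 a b c d) : g ∣ 167616 := by
  have m (x1 x2 x3 x4 v : ℤ) (h : 167616*v^8 = x1 * dl1 a b c d + x2 * dl2 a b c d + x3 * dl3 a b c d + x4 * dl4 a b c d) :
      g ∣ 167616 * v^8 := by
    rw [h]
    exact dvd_add (dvd_add (dvd_add (h1.mul_left _) (h2.mul_left _)) (h3.mul_left _)) (h4.mul_left _)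
  have k1 := m _ _ _ _ _ (cert1 a b c d hK)
  have k2 := m _ _ _ _ _ (cert2 a b c d hK)
  have k3 := m _ _ _ _ _ (cert3 a b c d hK)
  have k4 := m _ _ _ _ _ (cert4 a b c d hK)
  have top : Ideal.span {a, b, c, d} = (⊤ : Ideal ℤ) := by
    rw [Ideal.eq_top_iff_one]
    obtain ⟨p, q, r, s, h⟩ := hp
    simp only [Ideal.mem_span_insert, Ideal.mem_span_singleton']
    exact ⟨p, _, ⟨q, _, ⟨r, _, ⟨s, rfl⟩, rfl⟩, rfl⟩, by linear_combination -h⟩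
  have := Ideal.span_pow_eq_top _ top 8
  rw [Ideal.eq_top_iff_one] at this
  simp only [Set.image_insert_eq, Set.image_singleton, Ideal.mem_span_insert, Ideal.mem_span_singleton'] at this
  obtain ⟨p, z, ⟨q, z', ⟨r, z'', ⟨s, rfl⟩, rfl⟩, rfl⟩, h⟩ := this
  have : (167616:ℤ) = p * (167616*a^8) + (q * (167616*b^8) + (r * (167616*c^8) + s * (167616*d^8))) := by
    linear_combination 167616*h
  rw [this]
  exact dvd_add (k1.mul_left _) (dvd_add (k2.mul_left _) (dvd_add (k3.mul_left _) (k4.mul_left _)))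

theorem descent (base : ∀ a b c d : ℤ, Pri a b c d → KP a b c d → hh a b c d ≤ 609 → Kn a b c d)
    (n : ℕ) : ∀ a b c d : ℤ, Pri a b c d → KP a b c d → (hh a b c d).toNat = n → Kn a b c d := by
  induction n using Nat.strong_induction_on with
  | _ n ih =>
  intro a b c d hp hk hn
  by_cases hH : hh a b c d ≤ 609
  · exact base a b c d hp hk hH
  push Not at hH
  obtain ⟨u, a0, b0, c0, d0, hu, hk0, h1, h2, h3, h4⟩ := KP_half _ _ _ _ hk
  obtain ⟨v, a', b', c', d', hv, hp', rfl, rfl, rfl, rfl⟩ := prim_rat a0 b0 c0 d0 (KP_ne _ _ _ _ hk0)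
  obtain ⟨g1, g2, g3, g4⟩ := dl_hom v a' b' c' d'
  have hk' : KP (a':ℚ) b' c' d' := by
    have := KP_smul v⁻¹ _ _ _ _ (inv_ne_zero hv) hk0
    simpa [hv] using this
  rw [g1] at h1; rw [g2] at h2; rw [g3] at h3; rw [g4] at h4
  have hu' : u*v^4 ≠ 0 := mul_ne_zero hu (pow_ne_zero _ hv)
  have hK : kum a' b' c' d' = 0 := by
    have := KP_kum _ _ _ _ hk'
    rw [← kum_cast] at this; exact_mod_cast this
  obtain ⟨p, q, r, s, hb⟩ := hp
  -- the integer g = 1/(u v^4)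
  set G : ℤ := p * dl1 a' b' c' d' + q * dl2 a' b' c' d' + r * dl3 a' b' c' d' + s * dl4 a' b' c' d' with hG
  have hGu : (u*v^4) * (G:ℚ) = 1 := by
    have : ((p*a+q*b+r*c+s*d : ℤ):ℚ) = 1 := by rw [hb]; simp
    rw [← this, hG]; push_cast [dl1_cast, dl2_cast, dl3_cast, dl4_cast]
    rw [h1, h2, h3, h4]; ring
  have q1 : dl1 a' b' c' d' = G * a := by
    have : ((dl1 a' b' c' d' : ℤ):ℚ) = G * a := by rw [dl1_cast, h1]; linear_combination (-dl1 (a':ℚ) b' c' d')*hGu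
    exact_mod_cast this
  have q2 : dl2 a' b' c' d' = G * b := by
    have : ((dl2 a' b' c' d' : ℤ):ℚ) = G * b := by rw [dl2_cast, h2]; linear_combination (-dl2 (a':ℚ) b' c' d')*hGu
    exact_mod_cast this
  have q3 : dl3 a' b' c' d' = G * c := by
    have : ((dl3 a' b' c' d' : ℤ):ℚ) = G * c := by rw [dl3_cast, h3]; linear_combination (-dl3 (a':ℚ) b' c' d')*hGu
    exact_mod_cast this
  have q4 : dl4 a' b' c' d' = G * d := by
    have : ((dl4 a' b' c' d' : ℤ):ℚ) = G * d := by rw [dl4_cast, h4]; linear_combination (-dl4 (a':ℚ) b' c' d')*hGu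
    exact_mod_cast this
  have hGd : G ∣ 167616 := gcd_dvd a' b' c' d' G hp' hK ⟨_, q1⟩ ⟨_, q2⟩ ⟨_, q3⟩ ⟨_, q4⟩
  have hGb : |(G:ℚ)| ≤ 167616 := by
    have : |G| ≤ 167616 := Int.le_of_dvd (by norm_num) ((abs_dvd _ _).2 hGd)
    exact_mod_cast this
  obtain ⟨la, lb, lc, ld⟩ := hh_le a b c d
  have hX : (609:ℚ) < hh a b c d := by exact_mod_cast hH
  have hX' : (610:ℚ) ≤ hh a b c d := by exact_mod_cast hH
  have bd (x w : ℚ) (hx : |x| ≤ w * hh a b c d) : |G * x| ≤ w * (167616 * hh a b c d) := by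
    rw [abs_mul]
    calc |(G:ℚ)| * |x| ≤ 167616 * (w * hh a b c d) := mul_le_mul hGb hx (abs_nonneg _) (by norm_num)
      _ = _ := by ring
  have key := height_ineq a' b' c' d' hK (167616 * hh a b c d) (by linarith)
    (by rw [← dl1_cast, q1]; push_cast; exact bd _ _ la)
    (by rw [← dl2_cast, q2]; push_cast; exact bd _ _ lb)
    (by rw [← dl3_cast, q3]; push_cast; exact bd _ _ lc)
    (by rw [← dl4_cast, q4]; push_cast; exact bd _ _ ld)
  have hlt : hh a' b' c' d' < hh a b c d := by
    by_contra hge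
    push Not at hge
    have hge' : (hh a b c d : ℚ) ≤ hh a' b' c' d' := by exact_mod_cast hge
    generalize (hh a b c d : ℚ) = X at *
    generalize (hh a' b' c' d' : ℚ) = T at *
    have hT : 0 < T := by linarith
    have k1 : T^4 ≤ 1353 * (167616 * X) := by
      have : T^4 * T^4 ≤ T^4 * (1353 * (167616 * X)) := by linarith
      exact le_of_mul_le_mul_left this (by positivity)
    have k2 : T^4 ≤ 1353 * (167616 * T) := by linarith
    have k3 : T^3 ≤ 1353 * 167616 := by
      have : T * T^3 ≤ T * (1353 * 167616) := by linarith
      exact le_of_mul_le_mul_left this hT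
    have k4 : (610:ℚ)^3 ≤ T^3 := pow_le_pow_left₀ (by norm_num) (by linarith) 3
    norm_num at k4; linarith
  have hy := ih (hh a' b' c' d').toNat (by have := hh_nn a' b' c' d'; omega) a' b' c' d' hp' hk' rfl
  have := Kn_dbl (u*v^4) _ _ _ _ hy
  rw [h1, h2, h3, h4]
  convert this using 1 <;> ring

theorem KP_Kn (base : ∀ a b c d : ℤ, Pri a b c d → KP a b c d → hh a b c d ≤ 609 → Kn a b c d)
    (a b c d : ℚ) (h : KP a b c d) : Kn a b c d := by
  obtain ⟨v, a', b', c', d', hv, hp', rfl, rfl, rfl, rfl⟩ := prim_rat a b c d (KP_ne _ _ _ _ h)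
  apply Kn_smul
  refine descent base _ a' b' c' d' hp' ?_ rfl
  have := KP_smul v⁻¹ _ _ _ _ (inv_ne_zero hv) h
  simpa [hv] using this
end

open Polynomial NumberField
noncomputable section

lemma sieve (a b c : ℤ) (x : LL) (h : (a:LL)^2 - a*b*φL + a*c*φL^2 = x^2) (p : ℕ) (ρ t i : ZMod p)
    (hρ : ρ^5=3*ρ^3-ρ+2) (ht : (2*ρ^2-ρ^4)*t=1) (hi : 18624*i=1) :
    ∃ z : ZMod p, z^2 = a*(a*t^2 - b*t + c) := by
  have hx : IsIntegral ℤ x := by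
    apply IsIntegral.of_pow (n := 2) (by norm_num)
    rw [← h, φL_eq]
    have hw := wL_int
    have hint (n : ℤ) : IsIntegral ℤ (n:LL) := isIntegral_algebraMap (R := ℤ) (A := LL) (x := n)
    have h2 : IsIntegral ℤ (2*wL^2 - wL^4) := (((hint 2).mul (hw.pow 2)).sub (hw.pow 4) : _)
    exact (((hint a).pow 2).sub (((hint a).mul (hint b)).mul h2)).add (((hint a).mul (hint c)).mul (h2.pow 2))
  let pb : PowerBasis ℚ LL := ⟨wL, 5, bL, bL_apply⟩
  have hm := Algebra.discr_mul_isIntegral_mem_adjoin ℚ (R := ℤ) (B := pb) wL_int hx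
  change Algebra.discr ℚ bL • x ∈ Algebra.adjoin ℤ {wL} at hm
  rw [discr_bL, Algebra.adjoin_singleton_eq_range_aeval] at hm
  obtain ⟨P, hP⟩ := hm
  have hP' : aeval wL P = 18624 * x := by
    have : (18624:ℚ) • x = 18624 * x := by rw [Algebra.smul_def]; simp
    rw [← this]; exact hP
  let Q : ℤ[X] := P^2 - 18624^2 * (C a^2 - C a * C b * (2*X^2-X^4) + C a * C c * (2*X^2-X^4)^2)
  have hQ : aeval wL Q = 0 := by
    have e1 : aeval wL (18624 : ℤ[X]) = 18624 := map_ofNat _ _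
    have e2 : aeval wL (2 : ℤ[X]) = 2 := map_ofNat _ _
    simp only [Q, map_sub, map_add, map_mul, map_pow, hP', aeval_X, e1, e2, aeval_C]
    rw [φL_eq] at h
    simp only [eq_intCast]
    linear_combination -(18624^2)*h
  have hmz : minpoly ℤ wL = gZ := by
    apply Polynomial.map_injective (Int.castRingHom ℚ) (RingHom.injective_int _)
    exact ((minpoly.isIntegrallyClosed_eq_field_fractions' ℚ wL_int).symm.trans minpoly_wL).trans gZ_map.symm
  obtain ⟨R, hR⟩ := minpoly.isIntegrallyClosed_dvd wL_int hQ
  rw [hmz] at hR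
  have hg : aeval ρ gZ = 0 := by
    have e2 : aeval ρ (2 : ℤ[X]) = 2 := map_ofNat _ _
    have e3 : aeval ρ (3 : ℤ[X]) = 3 := map_ofNat _ _
    simp only [gZ, map_sub, map_add, map_mul, map_pow, aeval_X, e3, e2]
    linear_combination hρ
  have hQ0 : aeval ρ Q = 0 := by rw [hR, map_mul, hg, zero_mul]
  have e1 : aeval ρ (18624 : ℤ[X]) = 18624 := map_ofNat _ _
  have e2 : aeval ρ (2 : ℤ[X]) = 2 := map_ofNat _ _
  simp only [Q, map_sub, map_add, map_mul, map_pow, aeval_X, e1, e2, eq_intCast, map_intCast] at hQ0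
  refine ⟨aeval ρ P * i * t, ?_⟩
  generalize aeval ρ P = w at *
  generalize 2*ρ^2-ρ^4 = r at *
  have k1 : w^2*i^2 = a^2-a*b*r+a*c*r^2 := by
    linear_combination i^2*hQ0 + (18624*i+1)*(a^2-a*b*r+a*c*r^2)*hi
  linear_combination t^2*k1 - a*b*t*ht + a*c*(r*t+1)*ht

lemma sieveKP (a b c : ℤ) (d : ℚ) (ha : a ≠ 0) (h : KP a b c d) (p : ℕ) (ρ t i : ZMod p)
    (hρ : ρ^5=3*ρ^3-ρ+2) (ht : (2*ρ^2-ρ^4)*t=1) (hi : 18624*i=1) :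
    ∃ z : ZMod p, z^2 = a*(a*t^2 - b*t + c) := by
  rcases h with ⟨-, s, q, b1, b0, hM, hb, hc, -⟩ | ⟨h, -⟩
  · obtain ⟨x, hx⟩ := A_II s q b1 b0 hM
    refine sieve a b c (a*x) ?_ p ρ t i hρ ht hi
    have hb' : (b:LL) = a * s := by
      have := congrArg (Rat.cast : ℚ → LL) hb; push_cast at this; exact this
    have hc' : (c:LL) = a * q := by
      have := congrArg (Rat.cast : ℚ → LL) hc; push_cast at this; exact this
    rw [hb', hc']; linear_combination (a:LL)^2*hx
  · exact absurd (by exact_mod_cast h) ha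

end

open Polynomial NumberField
noncomputable section

def frc (n : ℕ) (f : ℕ → Bool) : Bool := Nat.rec (f 0) (fun k _ => f (Nat.succ k)) n
lemma frc_eq (n : ℕ) (f : ℕ → Bool) : frc n f = f n := by cases n <;> rfl

def allb (N : ℕ) (f : ℕ → Bool) : Bool := Nat.rec true (fun k ih => cond (f k) ih false) N
lemma allb_spec (N : ℕ) (f : ℕ → Bool) (h : allb N f = true) (n : ℕ) (hn : n < N) : f n = true := by
  induction N with
  | zero => omega
  | succ N ih =>
    have h' : cond (f N) (allb N f) false = true := h
    cases hf : f N with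
    | false => rw [hf] at h'; simp at h'
    | true =>
      rw [hf] at h'
      rcases Nat.lt_succ_iff_lt_or_eq.1 hn with h1 | rfl
      · exact ih h' h1
      · exact hf

abbrev CT := ℕ × ℕ × ℕ × ℕ × ℕ × ℕ

def cs : List CT := [(23, 11, 22, 19, 322462577977084738562538175264012996101916269546704239670111, 79296453019239688167797072475540235766869008420189108882593),
  (29, 9, 3, 5, 20816652882892439258641638501688408575383375228035274820887283, 17749860203268570224996455606486662358744261417482127340920077),
  (29, 12, 19, 5, 20816652882892439258641638501688408575383375228035274820887283, 17749860203268570224996455606486662358744261417482127340920077),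
  (31, 14, 12, 22, 85361437662191803348694809867310031553296163302525016018339767, 17482695250098235374803886835098248955237887638363093692758089),
  (37, 9, 19, 20, 5042955844445106954501830013759355494859441715027665523642015387, 1539062433879574522183302107116237512575253418948876487907795301),
  (41, 30, 5, 37, 95020206074838155644248732684986878298969290480556963849143912247, 10343507611135342126512835090718986448448001562830428468782233801),
  (41, 33, 32, 37, 95020206074838155644248732684986878298969290480556963849143912247, 10343507611135342126512835090718986448448001562830428468782233801),
  (43, 10, 11, 26, 179990282075451516703982954042493466470035856159850845569932324435, 293915030433061809747354678592941175100021177217073225700973744557),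
  (47, 10, 45, 4, 1863722311718328663299185351900521605142282804360680319397638132703, 4876264355461650143829238755187272718565182184874210322338329177121),
  (53, 9, 19, 48, 294582106155693300737570930397259881161619902401199975870312000761555, 136783622536946220802000681690449890558825820133876550359615383818541),
  (53, 22, 3, 48, 294582106155693300737570930397259881161619902401199975870312000761555, 136783622536946220802000681690449890558825820133876550359615383818541),
  (53, 34, 34, 48, 294582106155693300737570930397259881161619902401199975870312000761555, 136783622536946220802000681690449890558825820133876550359615383818541),
  (59, 30, 36, 56, 2339216569408360293625151448950735929631010143274901630514153031176891, 25267768817753895047675814608393473507273803085424261344890851510480197),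
  (61, 15, 24, 45, 68674779399965853899374528375004891634797074449710634075400935562670651, 41753162148683178959545892348538387788108869447152513678183679822007749),
  (61, 28, 8, 45, 68674779399965853899374528375004891634797074449710634075400935562670651, 41753162148683178959545892348538387788108869447152513678183679822007749),
  (71, 15, 42, 42, 80196214935764071321919941509971781361149629994566817373106595328799119231, 32881997223216562229980746874820332298567776101120069162496243985916520577),
  (79, 69, 59, 75, 17143529072797859596824834274510432013720910484312918655822944452907498286903, 11804714092414286557109109890214513223743789847135253619053197312074516189385),
  (83, 46, 49, 13, 140489277066605290867602570349369635095214877066023249772207998675804437552795, 323583705579826023603428018099298475387146520116775162257429269905922982732133),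
  (89, 65, 81, 31, 23975697766327254310248074186604390746385789941006302121022469494614446451396407, 5667077078425691718186098358743598880523540722984439679625987558786232731889865)]

/-- choice of mask -/
def pick (SQ NS k : ℕ) : ℕ := cond (SQ.testBit k) SQ NS

def tbt (S m : ℕ) : Bool := Nat.rec false (fun _ _ => true) (Nat.land 1 (Nat.shiftRight S m))
lemma tbt_eq (S m : ℕ) : tbt S m = S.testBit m := by
  unfold tbt Nat.testBit
  change Nat.rec (motive := fun _ => Bool) false (fun _ _ => true) (1 &&& (S >>> m)) = _
  cases (1 &&& (S >>> m)) <;> rfl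

def eul (k h p : ℕ) : Bool := Nat.beq (Nat.mod (Nat.pow k h) p) 1

def vc (c : CT) : Bool :=
  match c with
  | (p, r, t, i, SQ, NS) =>
    Nat.ble 1 p && Nat.ble t p && Nat.beq ((r^5+r)%p) ((3*r^3+2)%p) && Nat.beq ((2*r^2*t)%p) ((r^4*t+1)%p) &&
    Nat.beq ((18624*i)%p) (1%p) &&
    frc p fun p => frc (p/2) fun h => frc SQ fun SQ => frc NS fun NS =>
    (Nat.beq (Nat.shiftRight SQ p) (Nat.mod SQ (2^175)) && Nat.beq (Nat.shiftRight NS p) (Nat.mod NS (2^175))) &&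
    allb p (fun z => tbt SQ (Nat.mod (Nat.mul z z) p)) &&
    allb p (fun k => (!tbt SQ k || Nat.beq k 0 || eul k h p) && (tbt NS k || eul k h p))

lemma per_spec (S p : ℕ) (hp : 1 ≤ p) (h : S >>> p = S % 2^175) (m : ℕ) (hm : m < 175 + p) : S.testBit m = S.testBit (m%p) := by
  induction m using Nat.strong_induction_on with
  | _ m ih =>
    rcases lt_or_ge m p with h1 | h1
    · rw [Nat.mod_eq_of_lt h1]
    · have h2 := congrArg (fun q => Nat.testBit q (m-p)) h
      simp only [Nat.testBit_shiftRight, Nat.testBit_mod_two_pow] at h2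
      rw [show p + (m-p) = m by omega, show decide (m-p < 175) = true by simp; omega, Bool.true_and] at h2
      rw [h2, ih (m-p) (by omega) (by omega), Nat.mod_eq_sub_mod h1]

lemma cs_prime : ∀ c ∈ cs, c.1.Prime := by
  simp only [cs, List.forall_mem_cons, List.not_mem_nil, false_imp_iff, implies_true, and_true]
  norm_num

lemma eul_sq (k p : ℕ) [Fact p.Prime] (h : eul k (p/2) p = true) : IsSquare (k : ZMod p) ∧ (k:ZMod p) ≠ 0 := by
  have hp : p.Prime := Fact.out
  have h : k^(p/2) % p = 1 := by
    have h : Nat.beq (k^(p/2) % p) 1 = true := h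
    rwa [Nat.beq_eq] at h
  have h1 : (k:ZMod p)^(p/2) = 1 := by
    have := (ZMod.natCast_eq_natCast_iff' (k^(p/2)) 1 p).2 (by rw [h, Nat.mod_eq_of_lt hp.one_lt])
    push_cast at this; exact this
  have h0 : (k:ZMod p) ≠ 0 := by
    intro h0
    have hp2 := hp.two_le
    rw [h0, zero_pow (by omega)] at h1
    exact zero_ne_one h1
  exact ⟨(ZMod.euler_criterion p h0).2 h1, h0⟩

lemma cs_valid : cs.all vc = true := by decide +kernel

lemma vc_spec (p r t i SQ NS : ℕ) [hpF : Fact p.Prime] (h : vc (p, r, t, i, SQ, NS) = true) (a b c : ℤ) (d : ℚ) (a' j n : ℕ)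
    (ha : a = a') (hb : b = (j:ℤ) - 121) (hc : c = (n:ℤ) - 87) (hn : n < 175) (ha0 : a ≠ 0) (hap : a' % p ≠ 0)
    (hK : KP a b c d) :
    ((pick SQ NS (a'%p)) >>> (((a'*t*t + (121*t+87*(p-1)))%p + j*(p-t))%p)).testBit n = true := by
  simp only [vc, frc_eq, Bool.and_eq_true, Nat.beq_eq, Nat.ble_eq] at h
  obtain ⟨⟨⟨⟨⟨h1, h2⟩, h3⟩, h4⟩, h5⟩, ⟨⟨h6, h6'⟩, h7⟩, h8⟩ := h
  have hρ : (r:ZMod p)^5 = 3*(r:ZMod p)^3 - r + 2 := by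
    have := (ZMod.natCast_eq_natCast_iff' _ _ p).2 h3
    push_cast at this; linear_combination this
  have ht : (2*(r:ZMod p)^2 - (r:ZMod p)^4) * t = 1 := by
    have := (ZMod.natCast_eq_natCast_iff' _ _ p).2 h4
    push_cast at this; linear_combination this
  have hi : (18624:ZMod p) * i = 1 := by
    have := (ZMod.natCast_eq_natCast_iff' _ _ p).2 h5
    push_cast at this; linear_combination this
  obtain ⟨z, hz⟩ := sieveKP a b c d ha0 hK p r t i hρ ht hi
  set s := ((a'*t*t + (121*t+87*(p-1)))%p + j*(p-t))%p with hs
  have hsp : s < p := Nat.mod_lt _ h1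
  rw [Nat.testBit_shiftRight]
  have hcast : ((s + n : ℕ) : ZMod p) = a*t^2 - b*t + c := by
    rw [hs, ha, hb, hc]
    push_cast [Nat.cast_sub h1, Nat.cast_sub h2, ZMod.natCast_mod, ZMod.natCast_self]
    ring
  set m := (s+n)%p with hm
  have hmp : m < p := Nat.mod_lt _ h1
  have hkp : a' % p < p := Nat.mod_lt _ h1
  have sqb (k : ℕ) (hk : k < p) (hs : IsSquare (k:ZMod p)) : SQ.testBit k = true := by
    obtain ⟨w, hw⟩ := hs
    have := allb_spec _ _ h7 w.val (ZMod.val_lt w)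
    rw [tbt_eq] at this
    rw [← this]
    congr 1
    change k = w.val * w.val % p
    rw [← Nat.mod_eq_of_lt hk]
    rw [← ZMod.natCast_eq_natCast_iff', Nat.cast_mul, ZMod.natCast_zmod_val, hw]
  have hmc : (m : ZMod p) = a*t^2 - b*t + c := by rw [hm, ZMod.natCast_mod, hcast]
  have hkc : ((a' % p : ℕ) : ZMod p) = a := by rw [ZMod.natCast_mod, ha]; push_cast; rfl
  have hz' : z^2 = ((a'%p : ℕ):ZMod p) * (m : ZMod p) := by rw [hz, hmc, hkc]
  have hk0 : ((a'%p : ℕ):ZMod p) ≠ 0 := by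
    intro h0; rw [ZMod.natCast_mod, ZMod.natCast_eq_zero_iff] at h0
    exact hap (Nat.mod_eq_zero_of_dvd h0)
  unfold pick
  cases hc : SQ.testBit (a'%p) with
  | true =>
    change SQ.testBit (s+n) = true
    rw [per_spec SQ p h1 h6 (s+n) (by omega)]
    have hk := allb_spec _ _ h8 (a'%p) hkp
    simp only [Bool.and_eq_true, Bool.or_eq_true, tbt_eq, hc, Nat.beq_eq, hap, Bool.not_true, or_false] at hk
    obtain ⟨⟨w, hw⟩, -⟩ := eul_sq _ p (hk.1.resolve_left (by simp))
    apply sqb m hmp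
    rw [hw] at hz' hk0
    have hw0 : w ≠ 0 := by rintro rfl; simp at hk0
    exact ⟨z/w, by field_simp; linear_combination -hz'⟩
  | false =>
    change NS.testBit (s+n) = true
    rw [per_spec NS p h1 h6' (s+n) (by omega)]
    have hk := allb_spec _ _ h8 m hmp
    simp only [Bool.and_eq_true, Bool.or_eq_true, tbt_eq] at hk
    rcases hk.2 with hk | hk
    · exact hk
    · exfalso
      obtain ⟨⟨w, hw⟩, hm0⟩ := eul_sq _ p hk
      rw [hw] at hz' hm0
      have hw0 : w ≠ 0 := by rintro rfl; simp at hm0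
      have := sqb (a'%p) hkp ⟨z/w, by field_simp; linear_combination -hz'⟩
      rw [hc] at this; simp at this

abbrev QT := ℕ × ℕ × ℕ × ℕ

def prep (a : ℕ) (l : List CT) : (List QT → Bool) → Bool :=
  List.rec (fun k => k []) (fun c _ ih k =>
    Nat.rec (ih k) (fun _ _ =>
      frc ((a*c.2.2.1*c.2.2.1 + (121*c.2.2.1+87*(c.1-1)))%c.1) fun s0 =>
      frc (pick c.2.2.2.2.1 c.2.2.2.2.2 (a%c.1)) fun M =>
      frc (c.1-c.2.2.1) fun pt =>
      ih (fun L => k ((c.1, pt, s0, M) :: L))) (a%c.1)) l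

lemma prep_spec (a : ℕ) (l : List CT) (k : List QT → Bool) (h : prep a l k = true) :
    ∃ L, k L = true ∧ ∀ x ∈ L, ∃ c ∈ l, a % c.1 ≠ 0 ∧ x = (c.1, c.1-c.2.2.1,
      (a*c.2.2.1*c.2.2.1 + (121*c.2.2.1+87*(c.1-1)))%c.1, pick c.2.2.2.2.1 c.2.2.2.2.2 (a%c.1)) := by
  induction l generalizing k with
  | nil => exact ⟨[], h, by simp⟩
  | cons c l ih =>
    have h' : Nat.rec (motive := fun _ => Bool) (prep a l k) (fun _ _ =>
      frc ((a*c.2.2.1*c.2.2.1 + (121*c.2.2.1+87*(c.1-1)))%c.1) fun s0 =>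
      frc (pick c.2.2.2.2.1 c.2.2.2.2.2 (a%c.1)) fun M =>
      frc (c.1-c.2.2.1) fun pt =>
      prep a l (fun L => k ((c.1, pt, s0, M) :: L))) (a%c.1) = true := h
    by_cases hc : a % c.1 = 0
    · rw [hc] at h'
      obtain ⟨L, h1, h2⟩ := ih _ h'
      refine ⟨L, h1, fun x hx => ?_⟩
      obtain ⟨c', hc', h3⟩ := h2 x hx
      exact ⟨c', List.mem_cons_of_mem _ hc', h3⟩
    · have h2 : (frc ((a*c.2.2.1*c.2.2.1 + (121*c.2.2.1+87*(c.1-1)))%c.1) fun s0 =>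
        frc (pick c.2.2.2.2.1 c.2.2.2.2.2 (a%c.1)) fun M =>
        frc (c.1-c.2.2.1) fun pt =>
        prep a l (fun L => k ((c.1, pt, s0, M) :: L))) = true := by
          revert h'
          generalize (frc ((a*c.2.2.1*c.2.2.1 + (121*c.2.2.1+87*(c.1-1)))%c.1) fun s0 =>
            frc (pick c.2.2.2.2.1 c.2.2.2.2.2 (a%c.1)) fun M =>
            frc (c.1-c.2.2.1) fun pt =>
            prep a l (fun L => k ((c.1, pt, s0, M) :: L))) = B
          obtain ⟨q, hq⟩ := Nat.exists_eq_succ_of_ne_zero hc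
          rw [hq]; exact id
      rw [frc_eq, frc_eq, frc_eq] at h2
      obtain ⟨L, h1, h3⟩ := ih _ h2
      refine ⟨_, h1, fun x hx => ?_⟩
      rcases List.mem_cons.1 hx with rfl | hx
      · exact ⟨c, List.mem_cons_self, hc, rfl⟩
      · obtain ⟨c', hc', h4⟩ := h3 x hx
        exact ⟨c', List.mem_cons_of_mem _ hc', h4⟩

def go (j : ℕ) (L : List QT) : ℕ → (ℕ → Bool) → Bool :=
  List.rec (fun m k => k m) (fun x _ ih m k =>
    Nat.rec true (fun q _ => ih (Nat.land (Nat.succ q) (Nat.shiftRight x.2.2.2 (Nat.mod (Nat.add x.2.2.1 (Nat.mul j x.2.1)) x.1))) k) m) L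

lemma go_spec (j n : ℕ) (L : List QT) (hL : ∀ x ∈ L, (x.2.2.2 >>> ((x.2.2.1 + j*x.2.1)%x.1)).testBit n = true)
    (m : ℕ) (hm : m.testBit n = true) (k : ℕ → Bool) (h : go j L m k = true) :
    ∃ m', m'.testBit n = true ∧ k m' = true := by
  induction L generalizing m with
  | nil => exact ⟨m, hm, h⟩
  | cons x L ih =>
    have h' : Nat.rec (motive := fun _ => Bool) true (fun q _ => go j L (Nat.land (Nat.succ q) (Nat.shiftRight x.2.2.2 ((x.2.2.1 + j*x.2.1)%x.1))) k) m = true := h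
    cases m with
    | zero => simp at hm
    | succ q =>
      refine ih (fun y hy => hL y (List.mem_cons_of_mem _ hy)) _ ?_ h'
      have e := hL x List.mem_cons_self
      change ((q+1) &&& (x.2.2.2 >>> ((x.2.2.1 + j*x.2.1)%x.1))).testBit n = true
      rw [Nat.testBit_and, hm, e]; rfl

def nsq (W : ℤ) : Bool := decide (W < 0) || [3,5,7,11,13,17,19,23,29].any (fun q =>
  allb q (fun z => !(Nat.beq (z*z%q) (W % (q:ℤ)).toNat)))

lemma nsq_spec (W w : ℤ) (h : nsq W = true) (hw : w^2 = W) : False := by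
  simp only [nsq, Bool.or_eq_true, decide_eq_true_eq, List.any_eq_true] at h
  rcases h with h | ⟨q, hq, h⟩
  · nlinarith [sq_nonneg w]
  · have q0 : 0 < q := by
      have := (show ∀ q ∈ [3,5,7,11,13,17,19,23,29], 0 < q by decide)
      exact this q hq
    have hlt : (w % (q:ℤ)).toNat < q := by
      have := Int.emod_lt_of_pos w (show (0:ℤ) < q by exact_mod_cast q0)
      have := Int.emod_nonneg w (show (q:ℤ) ≠ 0 by positivity)
      omega
    have h := allb_spec _ _ h _ hlt
    simp only [Bool.not_eq_true', ← Bool.not_eq_true, Nat.beq_eq] at h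
    apply h
    have e1 : (((w % (q:ℤ)).toNat : ℕ) : ℤ) = w % q := Int.toNat_of_nonneg (Int.emod_nonneg w (by positivity))
    have e2 : (((W % (q:ℤ)).toNat : ℕ) : ℤ) = W % q := Int.toNat_of_nonneg (Int.emod_nonneg W (by positivity))
    zify
    rw [e1, e2, ← hw, pow_two, ← Int.mul_emod]

def kA (a b c : ℤ) : ℤ := b*b-4*a*c
def kB (a b c : ℤ) : ℤ := -a*a*a-a*a*b+5*a*a*c-a*b*b-3*a*b*c+7*a*c*c-4*b*c*c
def kC (a b c : ℤ) : ℤ := a*a*a*a-a*a*a*b-3*a*a*a*c+2*a*a*b*b+7*a*a*b*c-a*a*c*c-2*a*b*b*b-4*a*b*b*c+4*a*b*c*c-6*a*c*c*c+4*c*c*c*c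

lemma kum_ABC (a b c d : ℤ) : kum a b c d = kA a b c * d*d + kB a b c * d + kC a b c := by
  unfold kum kA kB kC; ring

def isK (a b c d : ℤ) : Bool := kl.any (fun v => decide (v.1 ≠ 0) && decide (a*v.2.1 = b*v.1) && decide (a*v.2.2.1 = c*v.1)
  && decide (a*v.2.2.2 = d*v.1))

lemma isK_spec (a b c d : ℤ) (h : isK a b c d = true) : Kn a b c d := by
  simp only [isK, List.any_eq_true, Bool.and_eq_true, decide_eq_true_eq] at h
  obtain ⟨v, hv, ⟨⟨h0, h1⟩, h2⟩, h3⟩ := h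
  have h0' : (v.1:ℚ) ≠ 0 := by exact_mod_cast h0
  have h1' : (a:ℚ)*v.2.1 = b*v.1 := by exact_mod_cast h1
  have h2' : (a:ℚ)*v.2.2.1 = c*v.1 := by exact_mod_cast h2
  have h3' : (a:ℚ)*v.2.2.2 = d*v.1 := by exact_mod_cast h3
  refine ⟨v, hv, a/v.1, ?_, ?_, ?_, ?_⟩
  · field_simp
  · rw [div_mul_eq_mul_div, h1']; field_simp
  · rw [div_mul_eq_mul_div, h2']; field_simp
  · rw [div_mul_eq_mul_div, h3']; field_simp

def fin4 (a b c d : ℤ) : Bool := decide (kA a b c * d*d + kB a b c * d + kC a b c ≠ 0) || isK a b c d ||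
  nsq (4*d*(a*a*a)-3*(a*a*a*a)+8*b*(b*b-a*c)*a-7*b*b*a*a+6*b*(a*a*a))

lemma fin4_spec (a b c d : ℤ) (ha : a ≠ 0) (hK : KP a b c d) (h : fin4 a b c d = true) : Kn a b c d := by
  have hk := KP_kum _ _ _ _ hK
  rw [← kum_cast] at hk
  have hk : kum a b c d = 0 := by exact_mod_cast hk
  rw [kum_ABC] at hk
  simp only [fin4, hk, Bool.or_eq_true, decide_eq_true_eq] at h
  rcases h with (h | h) | h
  · exact absurd rfl h
  · exact isK_spec _ _ _ _ h
  · exfalso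
    rcases hK with ⟨-, s, q, b1, b0, hM, hb, hc, hd⟩ | ⟨h, -⟩
    · have hsq : IsSquare (((4*d*(a*a*a)-3*(a*a*a*a)+8*b*(b*b-a*c)*a-7*b*b*a*a+6*b*(a*a*a) : ℤ)) : ℚ) := by
        refine ⟨a^2*b1, ?_⟩
        push_cast; rw [hb, hc]; linear_combination (a:ℚ)^3*hd
      rw [Rat.isSquare_intCast_iff] at hsq
      obtain ⟨w, hw⟩ := hsq
      exact nsq_spec _ w h (by rw [hw]; ring)
    · exact ha (by exact_mod_cast h)

def PP : ℕ := 1000003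
def QQ : ℕ := 999800
lemma PQ : QQ + 203 = PP := by decide +kernel

def nz (n : ℕ) (b : Bool) : Bool := Nat.rec b (fun _ _ => true) n
lemma nz_spec (n : ℕ) (b : Bool) (h : nz n b = true) (hn : n = 0) : b = true := by subst hn; exact h

def dchk (a b c : ℤ) : Bool :=
  frc (kA a b c % (PP:ℤ)).toNat fun A => frc (kB a b c % (PP:ℤ)).toNat fun B => frc (kC a b c % (PP:ℤ)).toNat fun C =>
  allb 407 fun e => nz (Nat.mod (Nat.add (Nat.mul (Nat.add (Nat.mul A (Nat.add e 999800)) B) (Nat.add e 999800)) C) 1000003) (fin4 a b c ((e:ℤ) - 203))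

lemma dmod (N q : ℕ) (hN : q + 203 = N) (A B C d : ℤ) (e : ℕ) (hd : d = (e:ℤ)-203) (hk : A*d*d+B*d+C = 0) :
    ((((A % (N:ℤ)).toNat*(e+q)+(B % (N:ℤ)).toNat)*(e+q))+(C % (N:ℤ)).toNat)%N = 0 := by
  have cv (x : ℤ) : (((x % (N:ℤ)).toNat : ℕ) : ZMod N) = (x : ZMod N) := by
    have e1 : (((x % (N:ℤ)).toNat : ℕ) : ℤ) = x % (N:ℤ) := Int.toNat_of_nonneg (Int.emod_nonneg _ (by omega))
    have := congrArg (Int.cast : ℤ → ZMod N) e1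
    rw [Int.cast_natCast] at this
    rw [this]; exact ZMod.intCast_mod x N
  rw [← Nat.dvd_iff_mod_eq_zero, ← ZMod.natCast_eq_zero_iff]
  push_cast [cv]
  have h3 : (q : ZMod N) = -203 := by
    have := ZMod.natCast_self N
    have h4 := congrArg (Nat.cast : ℕ → ZMod N) hN
    push_cast at h4
    linear_combination this + h4
  have hk' := congrArg (Int.cast : ℤ → ZMod N) hk
  rw [hd] at hk'
  push_cast at hk'
  rw [h3]
  linear_combination hk'

lemma dchk_spec (a b c d : ℤ) (ha : a ≠ 0) (hK : KP a b c d) (e : ℕ) (he : e < 407) (hd : d = (e:ℤ)-203)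
    (h : dchk a b c = true) : Kn a b c d := by
  unfold dchk at h
  rw [frc_eq, frc_eq, frc_eq] at h
  have h := allb_spec _ _ h e he
  have hk := KP_kum _ _ _ _ hK
  rw [← kum_cast] at hk
  have hk : kum a b c d = 0 := by exact_mod_cast hk
  rw [kum_ABC] at hk
  have h0 := dmod PP QQ PQ _ _ _ d e hd hk
  have h := nz_spec _ _ h h0
  rw [hd]
  rw [hd] at hK
  exact fin4_spec a b c _ ha hK h

def bits (N : ℕ) : ℕ → (ℕ → Bool) → Bool := Nat.rec (fun m _ => Nat.beq m 0) (fun _ ih m f =>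
  Nat.rec true (fun q _ => frc (Nat.log2 (Nat.succ q)) fun l => cond (f l) (ih (Nat.xor (Nat.succ q) (Nat.pow 2 l)) f) false) m) N

lemma bits_spec (N m : ℕ) (f : ℕ → Bool) (h : bits N m f = true) (n : ℕ) (hn : m.testBit n = true) : f n = true := by
  induction N generalizing m with
  | zero =>
    have h : Nat.beq m 0 = true := h
    rw [Nat.beq_eq] at h; rw [h] at hn; simp at hn
  | succ N ih =>
    cases m with
    | zero => simp at hn
    | succ q =>
      have h : (frc (Nat.log2 (q+1)) fun l => cond (f l) (bits N ((q+1) ^^^ (2^l)) f) false) = true := h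
      rw [frc_eq] at h
      cases hf : f (Nat.log2 (q+1)) with
      | false => rw [hf] at h; simp at h
      | true =>
        rw [hf] at h
        by_cases hl : n = Nat.log2 (q+1)
        · rw [hl, hf]
        · refine ih _ h ?_
          rw [Nat.testBit_xor, hn, Nat.testBit_two_pow_of_ne (Ne.symm hl)]; rfl

def chkI (a j m : ℕ) : Bool := bits 12 m fun n => dchk (a:ℤ) ((j:ℤ)-121) ((n:ℤ)-87)

def chkA (a : ℕ) : Bool := prep a cs fun L => allb 243 fun j => go j L (2^175-1) fun m => chkI a j m

lemma chkA_spec (a' : ℕ) (h : chkA a' = true) (a b c d : ℤ) (haa : a = a') (ha : a ≠ 0) (hb : |b| ≤ 121) (hc : |c| ≤ 87) (hd : |d| ≤ 203)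
    (hK : KP a b c d) : Kn a b c d := by
  obtain ⟨L, h1, h2⟩ := prep_spec a' cs _ h
  rw [abs_le] at hb hc hd
  obtain ⟨j, hj⟩ := Int.eq_ofNat_of_zero_le (show 0 ≤ b + 121 by omega)
  obtain ⟨n, hn⟩ := Int.eq_ofNat_of_zero_le (show 0 ≤ c + 87 by omega)
  obtain ⟨e, he⟩ := Int.eq_ofNat_of_zero_le (show 0 ≤ d + 203 by omega)
  have hj' : b = (j:ℤ) - 121 := by omega
  have hn' : c = (n:ℤ) - 87 := by omega
  have h3 := allb_spec _ _ h1 j (by omega)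
  obtain ⟨m, hm, h4⟩ := go_spec j n L (by
    intro x hx
    obtain ⟨q, hq, hap, rfl⟩ := h2 x hx
    obtain ⟨p, r, t, i, SQ, NS⟩ := q
    have : Fact p.Prime := ⟨cs_prime _ hq⟩
    exact vc_spec p r t i SQ NS (List.all_eq_true.1 cs_valid _ hq) a b c d a' j n haa hj' hn' (by omega) ha hap hK)
    (2^175-1) (by rw [Nat.testBit_two_pow_sub_one]; simp; omega) _ h3
  have h6 : dchk (a':ℤ) ((j:ℤ)-121) ((n:ℤ)-87) = true := bits_spec _ _ _ h4 n hm
  rw [← haa, ← hj', ← hn'] at h6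
  exact dchk_spec a b c d ha hK e (by omega) (by omega) h6

end

open Polynomial NumberField
noncomputable section

set_option maxHeartbeats 4000000 in
lemma chk_all (n : ℕ) (h1 : 1 ≤ n) (h2 : n ≤ 121) : chkA n = true := by
  interval_cases n <;> decide +kernel

def WW (b c : ℤ) : ℤ := b*(8*(c*c*c*c*c)-7*(c*c*c*c)*b+6*(c*c*c)*(b*b)-c*c*(b*b*b)+2*c*(b*b*b*b)+b*b*b*b*b)

def chkB : Bool := allb 121 fun i => allb 175 fun n =>
  nz (Nat.mod (Nat.mul 2 (Nat.mul (Nat.add n (Nat.mul 87 i)) (Nat.add n (Nat.mul 87 i)))) (Nat.succ i))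
    (decide ((n:ℤ)-87 = 0) || decide ((n:ℤ)-87 = (i:ℤ)+1) || nsq (WW ((i:ℤ)+1) ((n:ℤ)-87)))

lemma chkB_ok : chkB = true := by decide +kernel

lemma base0 (b c d : ℤ) (hb0 : 0 < b) (hb : |b| ≤ 121) (hc : |c| ≤ 87) (hK : KP (0:ℤ) b c d) : Kn (0:ℤ) b c d := by
  rcases hK with ⟨h, -⟩ | ⟨-, hb', x, y, hxy, h1, h2⟩
  · exact absurd (by norm_num) h
  rw [abs_le] at hb hc
  obtain ⟨i, hi⟩ := Int.eq_ofNat_of_zero_le (show 0 ≤ b - 1 by omega)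
  obtain ⟨n, hn⟩ := Int.eq_ofNat_of_zero_le (show 0 ≤ c + 87 by omega)
  have hi' : b = (i:ℤ)+1 := by omega
  have hn' : c = (n:ℤ)-87 := by omega
  have h := allb_spec _ _ (allb_spec _ _ chkB_ok i (by omega)) n (by omega)
  have hbd : b*d = 2*c^2 := by
    have : (b:ℚ)*d = 2*c^2 := by rw [h2, h1]; ring
    exact_mod_cast this
  have h := nz_spec _ _ h (by
    change (2*((n+87*i)*(n+87*i))) % (i+1) = 0
    rw [← Nat.dvd_iff_mod_eq_zero]
    zify
    rw [← hi', show (n:ℤ) = c+87 by omega, show (i:ℤ) = b-1 by omega]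
    exact ⟨d + 2*(87*(2*c+87*b)), by linear_combination -hbd⟩)
  rw [← hi', ← hn'] at h
  simp only [Bool.or_eq_true, decide_eq_true_eq] at h
  rcases h with (h | h) | h
  · refine ⟨(0,1,0,0), by simp [kl], b, ?_⟩
    rw [h] at h1 hbd
    have : d = 0 := by
      have : b*d = 0 := by rw [hbd]; norm_num
      rcases mul_eq_zero.1 this with h | h
      · omega
      · exact h
    rw [h, this]; norm_num
  · refine ⟨(0,1,1,2), by simp [kl], b, ?_⟩
    rw [h] at hbd
    have : d = 2*b := by
      apply mul_left_cancel₀ (show b ≠ 0 by omega)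
      rw [hbd]; ring
    rw [h, this]; push_cast; norm_num; ring
  · exfalso
    have hsq : IsSquare ((WW b c : ℤ) : ℚ) := by
      refine ⟨b^3*y, ?_⟩
      unfold WW; push_cast; rw [h1]; linear_combination -(b:ℚ)^6*hxy
    rw [Rat.isSquare_intCast_iff] at hsq
    obtain ⟨w, hw⟩ := hsq
    exact nsq_spec _ w h (by rw [hw]; ring)

lemma baseP (a b c d : ℤ) (ha : 0 < a) (hK : KP a b c d) (hb' : |a| ≤ 121) (hb : |b| ≤ 121) (hc : |c| ≤ 87) (hd : |d| ≤ 203) : Kn a b c d := by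
  rw [abs_le] at hb'
  obtain ⟨i, hi⟩ := Int.eq_ofNat_of_zero_le (show 0 ≤ a - 1 by omega)
  exact chkA_spec (i+1) (chk_all (i+1) (by omega) (by omega)) a b c d (by push_cast; omega) (by omega) hb hc hd hK

lemma base (a b c d : ℤ) (_ : Pri a b c d) (hK : KP a b c d) (hh' : hh a b c d ≤ 609) : Kn a b c d := by
  unfold hh at hh'
  simp only [max_le_iff] at hh'
  obtain ⟨⟨h1, h2⟩, h3, h4⟩ := hh'
  have e1 : |a| ≤ 121 := by norm_cast at h1; omega
  have e2 : |b| ≤ 121 := by norm_cast at h2; omega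
  have e3 : |c| ≤ 87 := by norm_cast at h3; omega
  have e4 : |d| ≤ 203 := by norm_cast at h4; omega
  have hneg : KP ((-a:ℤ):ℚ) ((-b:ℤ):ℚ) ((-c:ℤ):ℚ) ((-d:ℤ):ℚ) := by
    have := KP_smul (-1) a b c d (by norm_num) hK
    push_cast; simpa using this
  have back (h : Kn ((-a:ℤ):ℚ) ((-b:ℤ):ℚ) ((-c:ℤ):ℚ) ((-d:ℤ):ℚ)) : Kn a b c d := by
    have := Kn_smul (-1) _ _ _ _ h
    push_cast at this; simpa using this
  rcases lt_trichotomy a 0 with ha | ha | ha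
  · exact back (baseP _ _ _ _ (by omega) hneg (by rwa [abs_neg]) (by rwa [abs_neg]) (by rwa [abs_neg]) (by rwa [abs_neg]))
  · subst ha
    rcases lt_trichotomy b 0 with hb | hb | hb
    · refine back ?_
      rw [neg_zero] at hneg ⊢
      exact base0 _ _ _ (by omega) (by rwa [abs_neg]) (by rwa [abs_neg]) hneg
    · exfalso
      subst hb
      rcases hK with ⟨h, -⟩ | ⟨-, h, -⟩ <;> exact h (by norm_num)
    · exact base0 _ _ _ hb e2 e3 hK
  · exact baseP _ _ _ _ ha hK e1 e2 e3 e4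

end

open Polynomial NumberField
noncomputable section

theorem stmt_18 (k : Type) [Field k] [Algebra ℚ k]
    (hk : Module.finrank ℚ k = 2) (x y : k)
    (hxy : y ^ 2 = 8 * x ^ 5 - 7 * x ^ 4 + 6 * x ^ 3 - x ^ 2 + 2 * x + 1)
    (hx : x ∉ Set.range (algebraMap ℚ k)) :
    4 * x ^ 2 = -2 ∨ (2 * x + 1) ^ 2 = -3 ∨ (2 * x - 1) ^ 2 = -3 ∨
    (2 * x - 3) ^ 2 = 13 := by
  have : FiniteDimensional ℚ k := Module.finite_of_finrank_pos (by omega)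
  have hinj := (algebraMap ℚ k).injective
  have hindep (u v : ℚ) (h : (algebraMap ℚ k u) * x + algebraMap ℚ k v = 0) : u = 0 ∧ v = 0 := by
    have hu : u = 0 := by
      by_contra hu
      apply hx
      have : algebraMap ℚ k u ≠ 0 := fun h0 => hu (hinj (by rw [h0, map_zero]))
      refine ⟨-v/u, ?_⟩
      rw [map_div₀, map_neg]
      field_simp
      linear_combination -h
    subst hu
    refine ⟨rfl, hinj ?_⟩
    rw [map_zero] at h ⊢
    linear_combination h
  have hli : LinearIndependent ℚ ![x, 1] := by
    rw [LinearIndependent.pair_iff]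
    intro s t h
    apply hindep
    simpa [Algebra.smul_def] using h
  have hspan := hli.span_eq_top_of_card_eq_finrank' (by simp [hk])
  have hrep (z : k) : ∃ u v : ℚ, z = algebraMap ℚ k u * x + algebraMap ℚ k v := by
    have hz : z ∈ Submodule.span ℚ (Set.range ![x, 1]) := by rw [hspan]; trivial
    simp only [Matrix.range_cons, Matrix.range_empty, Set.union_empty, Set.singleton_union] at hz
    obtain ⟨u, v, h⟩ := Submodule.mem_span_pair.1 hz
    exact ⟨u, v, by rw [← h]; simp [Algebra.smul_def]⟩
  obtain ⟨s, p', hs⟩ := hrep (x^2)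
  obtain ⟨b1, b0, hy⟩ := hrep y
  obtain ⟨p, rfl⟩ : ∃ p, p' = -p := ⟨-p', by ring⟩
  have hM : MC s p b1 b0 := by
    rw [MC_iff]
    have := hindep
      ((2*b0*b1+s*b1^2) - (2 + s*(-1+s*(6+s*(-7+s*8)-p*8)-p*(-7+s*8))-p*(6+s*(-7+s*8)-p*8)))
      ((b0^2-p*b1^2) - (1 - p*(-1+s*(6+s*(-7+s*8)-p*8)-p*(-7+s*8)))) (by
        rw [hy] at hxy
        simp only [map_sub, map_add, map_mul, map_pow, map_neg, map_ofNat, map_one] at hs hxy ⊢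
        generalize algebraMap ℚ k s = s at *
        generalize algebraMap ℚ k p = p at *
        generalize algebraMap ℚ k b1 = b1 at *
        generalize algebraMap ℚ k b0 = b0 at *
        have hs3 : x^3 = s*x^2-p*x := by linear_combination x*hs
        have hs4 : x^4 = s*x^3-p*x^2 := by linear_combination x^2*hs
        have hs5 : x^5 = s*x^4-p*x^3 := by linear_combination x^3*hs
        linear_combination hxy - b1^2*hs + 8*hs5 + (8*s-7)*hs4 + (8*s^2-7*s-8*p+6)*hs3 + (s*(8*s^2-7*s-8*p+6)-p*(8*s-7)-1)*hs)
    exact ⟨sub_eq_zero.1 this.1, sub_eq_zero.1 this.2⟩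
  have hKP : KP 1 s p ((b1^2-(8*s*(s^2-p)-7*s^2+6*s-1)+2)/4) :=
    Or.inl ⟨one_ne_zero, s, p, b1, b0, hM, by ring, by ring, by ring⟩
  obtain ⟨v, hv, u, h1, h2, h3, -⟩ := KP_Kn base _ _ _ _ hKP
  have nr (q : ℚ) (h : x = algebraMap ℚ k q) : False := hx ⟨q, h.symm⟩
  simp only [kl, List.mem_cons, List.not_mem_nil, or_false] at hv
  have key (v1 v2 v3 : ℤ) (hv1 : v1 ≠ 0) (h1 : 1 = u*v1) (h2 : s = u*v2) (h3 : p = u*v3) :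
      (v1:k)*x^2 = v2*x - v3 := by
    have e1 : (v1:ℚ)*s = v2 := by rw [h2]; linear_combination -(v2:ℚ)*h1
    have e2 : (v1:ℚ)*p = v3 := by rw [h3]; linear_combination -(v3:ℚ)*h1
    have e1 := congrArg (algebraMap ℚ k) e1
    have e2 := congrArg (algebraMap ℚ k) e2
    simp only [map_mul, map_intCast] at e1 e2
    rw [map_neg] at hs
    linear_combination (v1:k)*hs + x*e1 - e2
  rcases hv with rfl | rfl | rfl | rfl | rfl | rfl | rfl | rfl | rfl | rfl
  · have e := key _ _ _ (by norm_num) h1 h2 h3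
    norm_num at e
    exact (nr 0 (by rw [e, map_zero])).elim
  · have e := key _ _ _ (by norm_num) h1 h2 h3
    norm_num at e
    right; right; left; linear_combination 4*e
  · norm_num at h1
  · have e := key _ _ _ (by norm_num) h1 h2 h3
    norm_num at e
    have : x * (x-1) = 0 := by linear_combination e
    rcases mul_eq_zero.1 this with h | h
    · exact (nr 0 (by rw [h, map_zero])).elim
    · exact (nr 1 (by rw [map_one]; linear_combination h)).elim
  · have e := key _ _ _ (by norm_num) h1 h2 h3
    norm_num at e
    have : (x-1)^2 = 0 := by linear_combination e
    exact (nr 1 (by rw [map_one]; linear_combination pow_eq_zero_iff (two_ne_zero) |>.1 this)).elim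
  · have e := key _ _ _ (by norm_num) h1 h2 h3
    norm_num at e
    right; left; linear_combination 4*e
  · have e := key _ _ _ (by norm_num) h1 h2 h3
    norm_num at e
    left; linear_combination 2*e
  · have e := key _ _ _ (by norm_num) h1 h2 h3
    norm_num at e
    have : x * (x-1) = 0 := by linear_combination e
    rcases mul_eq_zero.1 this with h | h
    · exact (nr 0 (by rw [h, map_zero])).elim
    · exact (nr 1 (by rw [map_one]; linear_combination h)).elim
  · have e := key _ _ _ (by norm_num) h1 h2 h3
    norm_num at e
    right; right; right; linear_combination 4*e
  · norm_num at h1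

end
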